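/- Let q ∈ {2,3,4}. Work on ℤ². For N ≥ 1 let Λ_N = {−N,…,N}², and let μ¹_{β,N} be the q-state Potts measure on {1,…,q}^{Λ_N} with boundary condition 1: μ¹_{β,N}(σ) is proportional to exp(β [Σ 𝟙_{σ_u = σ_v} + Σ' 𝟙_{σ_u = 1}]), where the first sum is over unordered pairs {u,v} ⊆ Λ_N with ‖u−v‖₁ = 1 and the second sum Σ' is over pairs (u,v) with u ∈ Λ_N, v ∈ ℤ² ∖ Λ_N and ‖u−v‖₁ = 1. Define m_N(β) = μ¹_{β,N}(σ_0 = 1) − 1/q and m*(β) = limsup_{N→∞} m_N(β). Then at the critical point β_c(q) = log(1 + √q) one has m*(β_c(q)) = 0: the phase transition of the planar q-state Potts model is continuous for q ≤ 4. -/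

import Mathlib

open scoped Classical
open Filter

noncomputable section

/-- The `ℓ¹`-distance on `ℤ^d`. -/
def dist1 {d : ℕ} (u v : Fin d → ℤ) : ℤ := ∑ i, |u i - v i|

/-- The box `Λ_N = {-N,…,N}² ⊆ ℤ²`. -/
def cube (N : ℕ) : Finset (Fin 2 → ℤ) :=
  Fintype.piFinset fun _ => Finset.Icc (-(N : ℤ)) N

/-- The set of nearest neighbours of `u` in `ℤ²`. -/
def nbrs (u : Fin 2 → ℤ) : Finset (Fin 2 → ℤ) :=
  (Fintype.piFinset fun i => Finset.Icc (u i - 1) (u i + 1)).filter fun v => dist1 u v = 1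

/-- The number of nearest neighbours of `u` lying outside `Λ_N` (counted with
multiplicity). -/
def bCount (N : ℕ) (u : Fin 2 → ℤ) : ℕ := (nbrs u \ cube N).card

/-- The Boltzmann weight
`exp(β[∑_{{u,v}⊆Λ_N, ‖u-v‖₁=1} 𝟙_{σ_u=σ_v} + ∑_{u∈Λ_N, v∉Λ_N, ‖u-v‖₁=1} 𝟙_{σ_u=c₀}])`
of a `q`-state Potts configuration `σ` on `Λ_N` with boundary colour `c₀` (the sum over
unordered pairs is written as half the sum over ordered pairs). -/
def pottsWeight (q N : ℕ) (c₀ : Fin q) (β : ℝ) (σ : {x // x ∈ cube N} → Fin q) : ℝ :=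
  Real.exp (β * ((1 / 2) * (∑ u ∈ (cube N).attach, ∑ v ∈ (cube N).attach,
      if dist1 (u : Fin 2 → ℤ) (v : Fin 2 → ℤ) = 1 then
        (if σ u = σ v then (1 : ℝ) else 0) else 0) +
    ∑ u ∈ (cube N).attach,
      (bCount N (u : Fin 2 → ℤ) : ℝ) * (if σ u = c₀ then (1 : ℝ) else 0)))

lemma origin_mem_cube (N : ℕ) : (fun _ => (0 : ℤ)) ∈ cube N := by
  simp only [cube, Fintype.mem_piFinset, Finset.mem_Icc]
  intro i
  omega

/-- `m_N(β) = μ¹_{β,N}(σ_0 = c₀) - 1/q` for the `q`-state Potts model on `Λ_N ⊆ ℤ²` with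
boundary colour `c₀`. -/
def pottsMag (q N : ℕ) (c₀ : Fin q) (β : ℝ) : ℝ :=
  (∑ σ : {x // x ∈ cube N} → Fin q,
      pottsWeight q N c₀ β σ *
        (if σ ⟨fun _ => 0, origin_mem_cube N⟩ = c₀ then (1 : ℝ) else 0)) /
    (∑ σ : {x // x ∈ cube N} → Fin q, pottsWeight q N c₀ β σ) - 1 / q

/-- The spontaneous magnetisation `m*(β) = limsup_N m_N(β)`. -/
def pottsMstar (q : ℕ) (c₀ : Fin q) (β : ℝ) : ℝ :=
  atTop.limsup fun N => pottsMag q N c₀ β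

end

namespace PlanarPotts

/-! ### Finite product-space measures and the FKG and Holley inequalities -/

/-- The indicator of a proposition as a real number. -/
noncomputable def ind (p : Prop) : ℝ := if p then 1 else 0

lemma ind_true {p : Prop} (h : p) : ind p = 1 := by simp [ind, h]

lemma ind_false {p : Prop} (h : ¬p) : ind p = 0 := by simp [ind, h]

lemma ind_nonneg (p : Prop) : 0 ≤ ind p := by unfold ind; split_ifs <;> norm_num

lemma ind_le_one (p : Prop) : ind p ≤ 1 := by unfold ind; split_ifs <;> norm_num

lemma ind_mono {p r : Prop} (h : p → r) : ind p ≤ ind r := by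
  by_cases hp : p
  · rw [ind_true hp, ind_true (h hp)]
  · rw [ind_false hp]; exact ind_nonneg _

lemma ind_congr {p r : Prop} (h : p ↔ r) : ind p = ind r :=
  le_antisymm (ind_mono h.1) (ind_mono h.2)

lemma ind_and (p r : Prop) : ind (p ∧ r) = ind p * ind r := by
  unfold ind; by_cases p <;> by_cases r <;> simp [*]

lemma ind_not (p : Prop) : ind (¬p) = 1 - ind p := by
  unfold ind; by_cases p <;> simp [*]

lemma ind_or_le (p r : Prop) : ind (p ∨ r) ≤ ind p + ind r := by
  unfold ind; by_cases p <;> by_cases r <;> simp [*]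

section Measures

set_option linter.unusedSectionVars false

variable {α : Type*} [DecidableEq α]

/-- The total weight of the subsets of `F`. -/
def zsum (F : Finset α) (w : Finset α → ℝ) : ℝ := ∑ s ∈ F.powerset, w s

/-- The weighted sum of an observable over the subsets of `F`. -/
def wsum (F : Finset α) (w : Finset α → ℝ) (f : Set α → ℝ) : ℝ :=
  ∑ s ∈ F.powerset, w s * f ↑s

/-- The expectation of an observable under the measure on subsets of `F` with weight `w`. -/
noncomputable def ex (F : Finset α) (w : Finset α → ℝ) (f : Set α → ℝ) : ℝ :=
  wsum F w f / zsum F w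

variable {F : Finset α} {w w₁ w₂ : Finset α → ℝ}

lemma zsum_pos (hw : ∀ s, 0 < w s) : 0 < zsum F w :=
  Finset.sum_pos (fun s _ => hw s) ⟨∅, by simp⟩

lemma wsum_one : wsum F w (fun _ => 1) = zsum F w := by simp [wsum, zsum]

lemma ex_one (hw : ∀ s, 0 < w s) : ex F w (fun _ => 1) = 1 := by
  rw [ex, wsum_one, div_self (zsum_pos hw).ne']

lemma ex_add (f g : Set α → ℝ) : ex F w (fun s => f s + g s) = ex F w f + ex F w g := by
  simp [ex, wsum, mul_add, Finset.sum_add_distrib, add_div]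

lemma ex_smul (c : ℝ) (f : Set α → ℝ) : ex F w (fun s => c * f s) = c * ex F w f := by
  simp only [ex, wsum, ← mul_div_assoc, Finset.mul_sum]
  congr 1
  exact Finset.sum_congr rfl fun s _ => by ring

lemma ex_sub (f g : Set α → ℝ) : ex F w (fun s => f s - g s) = ex F w f - ex F w g := by
  simp [ex, wsum, mul_sub, Finset.sum_sub_distrib, sub_div]

lemma ex_const (hw : ∀ s, 0 < w s) (c : ℝ) : ex F w (fun _ => c) = c := by
  simpa [ex_one hw] using ex_smul (F := F) (w := w) c (fun _ => 1)

lemma ex_mono (hw : ∀ s, 0 < w s) {f g : Set α → ℝ} (h : ∀ s ⊆ F, f ↑s ≤ g ↑s) :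
    ex F w f ≤ ex F w g := by
  refine div_le_div_of_nonneg_right (Finset.sum_le_sum fun s hs => ?_) (zsum_pos hw).le
  exact mul_le_mul_of_nonneg_left (h s (Finset.mem_powerset.1 hs)) (hw s).le

lemma ex_congr {f g : Set α → ℝ} (h : ∀ s ⊆ F, f ↑s = g ↑s) : ex F w f = ex F w g := by
  unfold ex wsum
  congr 1
  exact Finset.sum_congr rfl fun s hs => by rw [h s (Finset.mem_powerset.1 hs)]

lemma ex_nonneg (hw : ∀ s, 0 < w s) {f : Set α → ℝ} (h : ∀ s, 0 ≤ f s) : 0 ≤ ex F w f := by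
  simpa [ex_const hw] using ex_mono (F := F) hw (f := fun _ => 0) (g := f) fun s _ => h s

lemma ex_le_one (hw : ∀ s, 0 < w s) {f : Set α → ℝ} (h : ∀ s, f s ≤ 1) : ex F w f ≤ 1 := by
  simpa [ex_const hw] using ex_mono (F := F) hw (f := f) (g := fun _ => 1) fun s _ => h s

/-- The single-edge comparison condition between two weights. -/
def EdgeLe (F : Finset α) (w₁ w₂ : Finset α → ℝ) : Prop :=
  ∀ s t : Finset α, ∀ e, s ⊆ t → t ⊆ F → e ∈ F → e ∉ t →
    w₁ (insert e s) * w₂ t ≤ w₁ s * w₂ (insert e t)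

lemma EdgeLe.union (h₁ : ∀ s, 0 < w₁ s) (h₂ : ∀ s, 0 < w₂ s) (h : EdgeLe F w₁ w₂)
    (c : Finset α) : ∀ s t : Finset α, s ⊆ t → t ∪ c ⊆ F → Disjoint c t →
      w₁ (s ∪ c) * w₂ t ≤ w₁ s * w₂ (t ∪ c) := by
  induction c using Finset.induction_on with
  | empty => intro s t _ _ _; simp
  | insert e c he ih =>
    intro s t hst hF hd
    rw [Finset.disjoint_insert_left] at hd
    have hF' : t ∪ c ⊆ F := fun x hx => hF (by
      simp only [Finset.mem_union, Finset.mem_insert] at hx ⊢; tauto)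
    have i1 := ih s t hst hF' hd.2
    have heF : e ∈ F := hF (by simp)
    have i2 := h (s ∪ c) (t ∪ c) e (Finset.union_subset_union_left hst) hF' heF
      (by simp [he, hd.1])
    rw [Finset.union_insert, Finset.union_insert]
    have p1 := h₁ (s ∪ c)
    have p2 := h₂ (t ∪ c)
    have p3 := h₁ (insert e (s ∪ c))
    have p4 := h₂ (insert e (t ∪ c))
    have p5 := h₁ s
    have p6 := h₂ t
    have := mul_le_mul i2 i1 (mul_pos p1 p6).le (mul_pos p1 p4).le
    refine le_of_mul_le_mul_left ?_ (mul_pos p1 p2)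
    calc _ = (w₁ (insert e (s ∪ c)) * w₂ (t ∪ c)) * (w₁ (s ∪ c) * w₂ t) := by ring
      _ ≤ _ := this
      _ = _ := by ring

lemma EdgeLe.lattice (h₁ : ∀ s, 0 < w₁ s) (h₂ : ∀ s, 0 < w₂ s) (h : EdgeLe F w₁ w₂)
    {a b : Finset α} (ha : a ⊆ F) (hb : b ⊆ F) :
    w₁ a * w₂ b ≤ w₁ (a ∩ b) * w₂ (a ∪ b) := by
  have := h.union h₁ h₂ (a \ b) (a ∩ b) b Finset.inter_subset_right
    (by simpa [Finset.union_comm] using Finset.union_subset ha hb) Finset.sdiff_disjoint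
  rwa [Finset.union_comm (a ∩ b), Finset.sdiff_union_inter, Finset.union_sdiff_self_eq_union,
    Finset.union_comm b a] at this

lemma holley_aux (h₁ : ∀ s, 0 < w₁ s) (h₂ : ∀ s, 0 < w₂ s) (h : EdgeLe F w₁ w₂)
    {f g : Set α → ℝ} (hf : Monotone f) (hg : Monotone g) (hf0 : ∀ s, 0 ≤ f s)
    (hg0 : ∀ s, 0 ≤ g s) :
    wsum F w₁ f * wsum F w₂ g ≤ zsum F w₁ * wsum F w₂ (fun s => f s * g s) := by
  have := Finset.four_functions_theorem F (f₁ := fun s => w₁ s * f ↑s)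
    (f₂ := fun s => w₂ s * g ↑s) (f₃ := w₁) (f₄ := fun s => w₂ s * (f ↑s * g ↑s))
    (fun s => mul_nonneg (h₁ s).le (hf0 _)) (fun s => mul_nonneg (h₂ s).le (hg0 _))
    (fun s => (h₁ s).le) (fun s => mul_nonneg (h₂ s).le (mul_nonneg (hf0 _) (hg0 _)))
    (fun a ha b hb => by
      have l := h.lattice h₁ h₂ ha hb
      have m1 : f ↑a ≤ f ↑(a ∪ b) := hf (by simp)
      have m2 : g ↑b ≤ g ↑(a ∪ b) := hg (by simp)
      calc w₁ a * f ↑a * (w₂ b * g ↑b) = (w₁ a * w₂ b) * (f ↑a * g ↑b) := by ring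
        _ ≤ (w₁ (a ∩ b) * w₂ (a ∪ b)) * (f ↑(a ∪ b) * g ↑(a ∪ b)) := by
          refine mul_le_mul l (mul_le_mul m1 m2 (hg0 _) (hf0 _))
            (mul_nonneg (hf0 _) (hg0 _)) (mul_pos (h₁ _) (h₂ _)).le
        _ = _ := by ring)
    (𝒜 := F.powerset) (ℬ := F.powerset) (Finset.Subset.refl _) (Finset.Subset.refl _)
  simpa [wsum, zsum] using this

/-- **Holley's inequality** with a single-edge hypothesis. -/
lemma holley (h₁ : ∀ s, 0 < w₁ s) (h₂ : ∀ s, 0 < w₂ s) (h : EdgeLe F w₁ w₂)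
    {f : Set α → ℝ} (hf : Monotone f) : ex F w₁ f ≤ ex F w₂ f := by
  have key : ex F w₁ (fun s => f s - f ∅) ≤ ex F w₂ (fun s => f s - f ∅) := by
    have := holley_aux (F := F) h₁ h₂ h (f := fun s => f s - f ∅) (g := fun _ => 1)
      (fun s t hst => sub_le_sub_right (hf hst) _) monotone_const
      (fun s => sub_nonneg.2 (hf (Set.empty_subset s))) (fun _ => zero_le_one)
    simp only [mul_one, wsum_one] at this
    unfold ex
    rw [div_le_div_iff₀ (zsum_pos h₁) (zsum_pos h₂)]
    linarith
  rw [ex_sub, ex_sub, ex_const h₁, ex_const h₂] at key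
  linarith

/-- The **FKG inequality** with a single-edge hypothesis. -/
lemma fkg (hw : ∀ s, 0 < w s) (h : EdgeLe F w w) {f g : Set α → ℝ} (hf : Monotone f)
    (hg : Monotone g) : ex F w f * ex F w g ≤ ex F w (fun s => f s * g s) := by
  have key : ex F w (fun s => f s - f ∅) * ex F w (fun s => g s - g ∅) ≤
      ex F w (fun s => (f s - f ∅) * (g s - g ∅)) := by
    have := holley_aux (F := F) hw hw h (f := fun s => f s - f ∅) (g := fun s => g s - g ∅)
      (fun s t hst => sub_le_sub_right (hf hst) _) (fun s t hst => sub_le_sub_right (hg hst) _)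
      (fun s => sub_nonneg.2 (hf (Set.empty_subset s)))
      (fun s => sub_nonneg.2 (hg (Set.empty_subset s)))
    have hz := zsum_pos (F := F) hw
    unfold ex
    rw [div_mul_div_comm, div_le_div_iff₀ (mul_pos hz hz) hz]
    nlinarith
  have e : (fun s => (f s - f ∅) * (g s - g ∅)) =
      fun s => (f s * g s - f ∅ * g s) - (g ∅ * f s - f ∅ * g ∅) := by
    funext s; ring
  rw [e, ex_sub, ex_sub, ex_sub, ex_sub, ex_sub, ex_smul, ex_smul, ex_const hw, ex_const hw,
    ex_const hw] at key
  linarith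

lemma fkg_anti (hw : ∀ s, 0 < w s) (h : EdgeLe F w w) {f g : Set α → ℝ} (hf : Antitone f)
    (hg : Antitone g) : ex F w f * ex F w g ≤ ex F w (fun s => f s * g s) := by
  have := fkg hw h (f := fun s => (-1) * f s) (g := fun s => (-1) * g s)
    (fun s t hst => by have := hf hst; linarith) (fun s t hst => by have := hg hst; linarith)
  rw [ex_smul, ex_smul] at this
  simpa using this

lemma fkg_mono_anti (hw : ∀ s, 0 < w s) (h : EdgeLe F w w) {f g : Set α → ℝ} (hf : Monotone f)
    (hg : Antitone g) : ex F w (fun s => f s * g s) ≤ ex F w f * ex F w g := by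
  have := fkg hw h (f := f) (g := fun s => (-1) * g s) hf
    (fun s t hst => by have := hg hst; linarith)
  have e : (fun s => f s * (-1 * g s)) = fun s => (-1) * (f s * g s) := by funext s; ring
  rw [e, ex_smul, ex_smul] at this
  linarith

lemma wsum_ind_subset {F₀ : Finset α} (h : F₀ ⊆ F) (f : Set α → ℝ) :
    wsum F w (fun s => f s * ind (s ⊆ ↑F₀)) = wsum F₀ w f := by
  unfold wsum
  rw [← Finset.sum_subset (Finset.powerset_mono.2 h)]
  · refine Finset.sum_congr rfl fun s hs => ?_
    simp only
    rw [ind_true (by exact_mod_cast Finset.mem_powerset.1 hs), mul_one]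
  · intro s _ hs
    simp only
    rw [ind_false (by simpa using hs)]; ring

/-- Monotonicity in the domain for measures with free boundary condition. -/
lemma ex_domain_mono (hw : ∀ s, 0 < w s) (h : EdgeLe F w w) {F₀ : Finset α} (hF : F₀ ⊆ F)
    {f : Set α → ℝ} (hf : Monotone f) : ex F₀ w f ≤ ex F w f := by
  have a := fkg_mono_anti hw h hf (g := fun s => ind (s ⊆ ↑F₀))
    (fun s t hst => ind_mono fun ht => hst.trans ht)
  have e0 : wsum F w (fun s => ind (s ⊆ ↑F₀)) = zsum F₀ w := by
    have := wsum_ind_subset (w := w) hF (fun _ => 1)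
    simpa [wsum_one] using this
  unfold ex at *
  rw [wsum_ind_subset hF, e0] at a
  have z1 := zsum_pos (F := F) hw
  have z2 := zsum_pos (F := F₀) hw
  rw [div_le_iff₀ z2]
  rw [mul_div_assoc', div_le_div_iff_of_pos_right z1] at a
  exact a

lemma sum_powerset_split {F₀ : Finset α} (hF : F₀ ⊆ F) (g : Finset α → ℝ) :
    ∑ s ∈ F.powerset, g s = ∑ η ∈ (F \ F₀).powerset, ∑ s ∈ F₀.powerset, g (s ∪ η) := by
  rw [← Finset.sum_product']
  symm
  refine Finset.sum_nbij' (fun p => p.2 ∪ p.1) (fun s => (s \ F₀, s ∩ F₀)) ?_ ?_ ?_ ?_ ?_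
  · intro p hp
    simp only [Finset.mem_product, Finset.mem_powerset] at hp ⊢
    exact Finset.union_subset (hp.2.trans hF) (hp.1.trans Finset.sdiff_subset)
  · intro s hs
    simp only [Finset.mem_product, Finset.mem_powerset] at hs ⊢
    exact ⟨Finset.sdiff_subset_sdiff hs (Finset.Subset.refl _), Finset.inter_subset_right⟩
  · rintro ⟨η, s⟩ hp
    simp only [Finset.mem_product, Finset.mem_powerset] at hp
    have h1 : ∀ x ∈ η, x ∉ F₀ := fun x hx => (Finset.mem_sdiff.1 (hp.1 hx)).2
    ext x
    · simp only [Finset.mem_sdiff, Finset.mem_union]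
      have := @hp.2 x; have := h1 x; grind
    · simp only [Finset.mem_inter, Finset.mem_union]
      have := @hp.2 x; have := h1 x; grind
  · intro s hs
    simp only
    rw [Finset.union_comm, Finset.sdiff_union_inter]
  · intro p _; rfl

/-- The spatial Markov property combined with monotonicity in boundary conditions. -/
lemma ex_markov (hw : ∀ s, 0 < w s) (h : EdgeLe F w w) {F₀ : Finset α} (hF : F₀ ⊆ F)
    {f g : Set α → ℝ} (hf : Monotone f) (hg0 : ∀ s, 0 ≤ g s) (hg : ∀ s, g (s \ ↑F₀) = g s) :
    ex F₀ w f * ex F w g ≤ ex F w (fun s => f s * g s) := by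
  have z1 := zsum_pos (F := F) hw
  unfold ex
  rw [← mul_div_assoc, div_le_div_iff_of_pos_right z1]
  unfold wsum
  rw [sum_powerset_split hF, sum_powerset_split hF, Finset.mul_sum]
  refine Finset.sum_le_sum fun η hη => ?_
  have hη' : η ⊆ F \ F₀ := Finset.mem_powerset.1 hη
  have hgη : ∀ s ∈ F₀.powerset, g ↑(s ∪ η) = g ↑η := by
    intro s hs
    rw [← hg ↑(s ∪ η), ← hg ↑η]
    congr 1
    ext x
    have hs' := Finset.mem_powerset.1 hs
    have := @hs' x
    simp only [Finset.coe_union, Set.mem_sdiff, Set.mem_union, Finset.mem_coe]; grind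
  have hE : EdgeLe F₀ w (fun s => w (s ∪ η)) := by
    intro s t e hst ht he het
    simp only
    rw [Finset.insert_union]
    refine h s (t ∪ η) e (hst.trans Finset.subset_union_left)
      (Finset.union_subset (ht.trans hF) (hη'.trans Finset.sdiff_subset)) (hF he) ?_
    rw [Finset.mem_union, not_or]
    exact ⟨het, fun hc => (Finset.mem_sdiff.1 (hη' hc)).2 he⟩
  have hol := holley (F := F₀) hw (fun s => hw (s ∪ η)) hE (f := fun s => f (s ∪ ↑η))
    (fun s t hst => hf (Set.union_subset_union_left _ hst))
  have hol2 : ex F₀ w f ≤ ex F₀ w (fun s => f (s ∪ ↑η)) :=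
    ex_mono hw fun s _ => hf Set.subset_union_left
  have hol3 := hol2.trans hol
  unfold ex at hol3
  rw [le_div_iff₀ (zsum_pos fun s => hw (s ∪ η))] at hol3
  have e1 : ∑ s ∈ F₀.powerset, w (s ∪ η) * g ↑(s ∪ η) = g ↑η * zsum F₀ (fun s => w (s ∪ η)) := by
    rw [zsum, Finset.mul_sum]
    exact Finset.sum_congr rfl fun s hs => by rw [hgη s hs]; ring
  have e2 : ∑ s ∈ F₀.powerset, w (s ∪ η) * (f ↑(s ∪ η) * g ↑(s ∪ η)) =
      g ↑η * wsum F₀ (fun s => w (s ∪ η)) (fun s => f (s ∪ ↑η)) := by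
    rw [wsum, Finset.mul_sum]
    exact Finset.sum_congr rfl fun s hs => by
      rw [hgη s hs, Finset.coe_union]; ring
  rw [e1, e2]
  have := mul_le_mul_of_nonneg_left hol3 (hg0 ↑η)
  unfold wsum at this ⊢
  linarith

/-- Change of variables. -/
lemma ex_bij {β : Type*} {F' : Finset β} {w' : Finset β → ℝ}
    (φ : Finset α → Finset β) (ψ : Finset β → Finset α) (c : ℝ) (hc : 0 < c)
    (h1 : ∀ s ⊆ F, φ s ⊆ F') (h2 : ∀ t ⊆ F', ψ t ⊆ F) (h3 : ∀ s ⊆ F, ψ (φ s) = s)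
    (h4 : ∀ t ⊆ F', φ (ψ t) = t) (h5 : ∀ s ⊆ F, w' (φ s) = c * w s)
    {f : Set β → ℝ} {g : Set α → ℝ} (hfg : ∀ s ⊆ F, f ↑(φ s) = g ↑s) :
    ex F' w' f = ex F w g := by
  have e1 : wsum F' w' f = c * wsum F w g := by
    unfold wsum
    rw [Finset.mul_sum]
    symm
    refine Finset.sum_nbij' φ ψ ?_ ?_ ?_ ?_ ?_ <;> intro s hs <;>
      simp only [Finset.mem_powerset] at hs ⊢
    · exact h1 s hs
    · exact h2 s hs
    · exact h3 s hs
    · exact h4 s hs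
    · rw [h5 s hs, hfg s hs]; ring
  have e2 : zsum F' w' = c * zsum F w := by
    unfold zsum
    rw [Finset.mul_sum]
    symm
    refine Finset.sum_nbij' φ ψ ?_ ?_ ?_ ?_ ?_ <;> intro s hs <;>
      simp only [Finset.mem_powerset] at hs ⊢
    · exact h1 s hs
    · exact h2 s hs
    · exact h3 s hs
    · exact h4 s hs
    · rw [h5 s hs]
  rw [ex, ex, e1, e2, mul_div_mul_left _ _ hc.ne']

end Measures

/-! ### Local observables -/

section Local

variable {X : Type*}

/-- `f` depends only on the bits in `G`. -/
def DepOn (G : Set X) (f : Set X → ℝ) : Prop := ∀ ω, f ω = f (ω ∩ G)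

/-- `f` depends on finitely many bits. -/
def IsLocal (f : Set X → ℝ) : Prop := ∃ G : Finset X, DepOn ↑G f

lemma DepOn.mono {G H : Set X} {f : Set X → ℝ} (h : DepOn G f) (hGH : G ⊆ H) : DepOn H f := by
  intro ω
  rw [h ω, h (ω ∩ H), Set.inter_assoc, Set.inter_eq_right.2 hGH]

lemma DepOn.map2 {G : Set X} {f g : Set X → ℝ} (hf : DepOn G f) (hg : DepOn G g)
    (k : ℝ → ℝ → ℝ) : DepOn G (fun ω => k (f ω) (g ω)) := by
  intro ω; simp only; rw [hf ω, hg ω]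

lemma IsLocal.map2 {f g : Set X → ℝ} (hf : IsLocal f) (hg : IsLocal g) (k : ℝ → ℝ → ℝ) :
    IsLocal (fun ω => k (f ω) (g ω)) := by
  obtain ⟨G, hG⟩ := hf
  obtain ⟨H, hH⟩ := hg
  exact ⟨G ∪ H, (hG.mono (by simp)).map2 (hH.mono (by simp)) k⟩

lemma isLocal_const (c : ℝ) : IsLocal (fun _ : Set X => c) := ⟨∅, fun _ => rfl⟩

lemma IsLocal.mul {f g : Set X → ℝ} (hf : IsLocal f) (hg : IsLocal g) :
    IsLocal (fun ω => f ω * g ω) := hf.map2 hg (· * ·)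

lemma IsLocal.add {f g : Set X → ℝ} (hf : IsLocal f) (hg : IsLocal g) :
    IsLocal (fun ω => f ω + g ω) := hf.map2 hg (· + ·)

lemma IsLocal.sub {f g : Set X → ℝ} (hf : IsLocal f) (hg : IsLocal g) :
    IsLocal (fun ω => f ω - g ω) := hf.map2 hg (· - ·)

lemma IsLocal.smul {f : Set X → ℝ} (hf : IsLocal f) (c : ℝ) :
    IsLocal (fun ω => c * f ω) := (isLocal_const c).map2 hf (· * ·)

lemma IsLocal.sum {ι : Type*} {s : Finset ι} {f : ι → Set X → ℝ} (h : ∀ i ∈ s, IsLocal (f i)) :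
    IsLocal (fun ω => ∑ i ∈ s, f i ω) := by
  induction s using Finset.induction_on with
  | empty => simpa using isLocal_const 0
  | insert i s hi ih =>
    simp only [Finset.sum_insert hi]
    exact (h i (by simp)).add (ih fun j hj => h j (by simp [hj]))

/-- The indicator that all bits in `A` are on. -/
noncomputable def cyl (A : Finset X) (ω : Set X) : ℝ := ind (↑A ⊆ ω)

lemma cyl_mono (A : Finset X) : Monotone (cyl A) := fun _ _ h => ind_mono fun hA => hA.trans h

lemma cyl_local (A : Finset X) : IsLocal (cyl A) := by
  refine ⟨A, fun ω => ind_congr ?_⟩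
  simp

/-- To prove a linear property of all local observables, it suffices to check it on
cylinders. -/
lemma local_induction {P : (Set X → ℝ) → Prop} (hcyl : ∀ A, P (cyl A))
    (hadd : ∀ f g, P f → P g → P (fun ω => f ω + g ω))
    (hsmul : ∀ (c : ℝ) f, P f → P (fun ω => c * f ω)) {f : Set X → ℝ} (hf : IsLocal f) : P f := by
  obtain ⟨G, hG⟩ := hf
  suffices H : ∀ A : Finset X, P (fun ω => cyl A ω * f ω) by
    have := H ∅
    simpa [cyl, ind] using this
  induction G using Finset.induction_on generalizing f with
  | empty =>
    intro A
    have : (fun ω => cyl A ω * f ω) = fun ω => f ∅ * cyl A ω := by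
      funext ω; rw [hG ω]; simp [mul_comm]
    rw [this]; exact hsmul _ _ (hcyl A)
  | insert x G hx ih =>
    intro A
    have d0 : DepOn ↑G (fun ω => f (ω ∩ ↑G)) := fun ω => by
      simp only; rw [Set.inter_assoc, Set.inter_self]
    have d1 : DepOn ↑G (fun ω => f (insert x (ω ∩ ↑G))) := fun ω => by
      simp only; rw [Set.inter_assoc, Set.inter_self]
    have a0 := ih d0
    have a1 := ih d1
    have := hadd _ _ (a0 A) (hadd _ _ (a1 (insert x A)) (hsmul (-1) _ (a0 (insert x A))))
    convert this using 1
    funext ω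
    by_cases hxω : x ∈ ω
    · have e1 : cyl (insert x A) ω = cyl A ω := ind_congr (by
        rw [Finset.coe_insert, Set.insert_subset_iff]; exact and_iff_right hxω)
      have e2 : ω ∩ ↑(insert x G) = insert x (ω ∩ ↑G) := by
        rw [Finset.coe_insert, Set.inter_insert_of_mem hxω]
      have e3 : f ω = f (insert x (ω ∩ ↑G)) := (hG ω).trans (congrArg f e2)
      simp only [e1, e3]; ring
    · have e1 : cyl (insert x A) ω = 0 := ind_false (by
        rw [Finset.coe_insert, Set.insert_subset_iff]; exact fun h => hxω h.1)
      have e2 : ω ∩ ↑(insert x G) = ω ∩ ↑G := by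
        rw [Finset.coe_insert, Set.inter_insert_of_notMem hxω]
      have e3 : f ω = f (ω ∩ ↑G) := (hG ω).trans (congrArg f e2)
      simp only [e1]; rw [← e3]; ring

end Local

/-! ### The square lattice, connectivity and rank -/

/-- Sites of the square lattice. -/
abbrev Site := ℤ × ℤ

/-- Edges of the square lattice: `(x, false)` joins `x` to `x + (1, 0)` and `(x, true)` joins `x`
to `x + (0, 1)`. -/
abbrev Edge := Site × Bool

/-- The first endpoint of an edge. -/
def src (e : Edge) : Site := e.1

/-- The second endpoint of an edge. -/
def tgt (e : Edge) : Site := if e.2 then (e.1.1, e.1.2 + 1) else (e.1.1 + 1, e.1.2)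

/-- One step of a connection in `ω` with the sites of `C` wired together. -/
def CnStep (C : Set Site) (ω : Set Edge) (u v : Site) : Prop :=
  (∃ e ∈ ω, src e = u ∧ tgt e = v) ∨ (u ∈ C ∧ v ∈ C)

/-- Connection in `ω` with the sites of `C` wired together. -/
def Cn (C : Set Site) (ω : Set Edge) (u v : Site) : Prop := Relation.EqvGen (CnStep C ω) u v

section Connectivity

variable {C C' : Set Site} {ω ω' : Set Edge} {u v x : Site}

lemma Cn.refl (u : Site) : Cn C ω u u := Relation.EqvGen.refl u

lemma Cn.symm (h : Cn C ω u v) : Cn C ω v u := Relation.EqvGen.symm _ _ h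

lemma Cn.trans (h : Cn C ω u v) (h' : Cn C ω v x) : Cn C ω u x := Relation.EqvGen.trans _ _ _ h h'

lemma Cn.of_edge {e : Edge} (h : e ∈ ω) : Cn C ω (src e) (tgt e) :=
  Relation.EqvGen.rel _ _ (Or.inl ⟨e, h, rfl, rfl⟩)

lemma Cn.of_wired (hu : u ∈ C) (hv : v ∈ C) : Cn C ω u v :=
  Relation.EqvGen.rel _ _ (Or.inr ⟨hu, hv⟩)

/-- Functions constant along open edges and on the wired set are constant on clusters. -/
lemma Cn.eq_of {β : Sort*} {f : Site → β} (h : Cn C ω u v)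
    (h1 : ∀ e ∈ ω, f (src e) = f (tgt e)) (h2 : ∀ a ∈ C, ∀ b ∈ C, f a = f b) : f u = f v := by
  induction h with
  | rel a b hab =>
    rcases hab with ⟨e, he, rfl, rfl⟩ | ⟨ha, hb⟩
    · exact h1 e he
    · exact h2 a ha b hb
  | refl => rfl
  | symm _ _ _ ih => exact ih.symm
  | trans _ _ _ _ _ ih1 ih2 => exact ih1.trans ih2

lemma Cn.of_forall (h : Cn C ω u v) (h1 : ∀ e ∈ ω, Cn C' ω' (src e) (tgt e))
    (h2 : ∀ a ∈ C, ∀ b ∈ C, Cn C' ω' a b) : Cn C' ω' u v := by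
  have key : ∀ a b, Cn C' ω' a b → (Cn C' ω' u a) = (Cn C' ω' u b) := fun a b hab =>
    propext ⟨fun h => h.trans hab, fun h => h.trans hab.symm⟩
  have := h.eq_of (f := fun y => Cn C' ω' u y) (fun e he => key _ _ (h1 e he))
    (fun a ha b hb => key _ _ (h2 a ha b hb))
  exact this.mp (Cn.refl u)

lemma Cn.mono (h : Cn C ω u v) (hC : C ⊆ C') (hω : ω ⊆ ω') : Cn C' ω' u v :=
  h.of_forall (fun _ he => .of_edge (hω he)) fun _ ha _ hb => .of_wired (hC ha) (hC hb)

end Connectivity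

/-- Chains of sites. -/
abbrev Chain0 := Site →₀ ZMod 2

/-- The sum of two sites as a chain. -/
noncomputable def pr (u v : Site) : Chain0 := Finsupp.single u 1 + Finsupp.single v 1

/-- The boundary of an edge. -/
noncomputable def bdE (e : Edge) : Chain0 := pr (src e) (tgt e)

/-- Chains generated by pairs of wired sites. -/
noncomputable def spanC (C : Set Site) : Submodule (ZMod 2) Chain0 :=
  Submodule.span (ZMod 2) {z | ∃ a ∈ C, ∃ b ∈ C, z = pr a b}

lemma pr_self (u : Site) : pr u u = 0 := by
  unfold pr; rw [← Finsupp.single_add]; simp [show (1 : ZMod 2) + 1 = 0 from rfl]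

lemma pr_add (u v x : Site) : pr u v + pr v x = pr u x := by
  unfold pr
  have : Finsupp.single v (1 : ZMod 2) + Finsupp.single v 1 = 0 := pr_self v
  calc _ = Finsupp.single u (1 : ZMod 2) + (Finsupp.single v 1 + Finsupp.single v 1)
        + Finsupp.single x 1 := by abel
    _ = _ := by rw [this, add_zero]

lemma pr_comm (u v : Site) : pr u v = pr v u := add_comm _ _

/-- A cluster connection is the same as membership of the pair of endpoints in the span of the
boundaries. -/
lemma cn_iff_mem_span {C : Set Site} {ω : Set Edge} {u v : Site} :
    Cn C ω u v ↔ pr u v ∈ spanC C ⊔ Submodule.span (ZMod 2) (bdE '' ω) := by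
  constructor
  · intro h
    induction h with
    | rel a b hab =>
      rcases hab with ⟨e, he, rfl, rfl⟩ | ⟨ha, hb⟩
      · exact Submodule.mem_sup_right (Submodule.subset_span ⟨e, he, rfl⟩)
      · exact Submodule.mem_sup_left (Submodule.subset_span ⟨a, ha, b, hb, rfl⟩)
    | refl => rw [pr_self]; exact Submodule.zero_mem _
    | symm _ _ _ ih => rwa [pr_comm]
    | trans a b c _ _ ih1 ih2 => rw [← pr_add a b c]; exact Submodule.add_mem _ ih1 ih2
  · intro h
    set L : Chain0 →ₗ[ZMod 2] ZMod 2 :=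
      Finsupp.linearCombination (ZMod 2) (fun x => if Cn C ω u x then (1 : ZMod 2) else 0) with hL
    have hpr : ∀ a b, L (pr a b) =
        (if Cn C ω u a then (1 : ZMod 2) else 0) + (if Cn C ω u b then (1 : ZMod 2) else 0) := by
      intro a b; simp [hL, pr]
    have hz : ∀ a b, Cn C ω a b → L (pr a b) = 0 := by
      intro a b hab
      have : Cn C ω u a ↔ Cn C ω u b := ⟨fun h => h.trans hab, fun h => h.trans hab.symm⟩
      rw [hpr]; simp only [this]; split_ifs <;> rfl
    have hker : spanC C ⊔ Submodule.span (ZMod 2) (bdE '' ω) ≤ LinearMap.ker L := by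
      refine sup_le (Submodule.span_le.2 ?_) (Submodule.span_le.2 ?_)
      · rintro z ⟨a, ha, b, hb, rfl⟩
        exact hz a b (.of_wired ha hb)
      · rintro z ⟨e, he, rfl⟩
        exact hz _ _ (.of_edge he)
    have h0 : L (pr u v) = 0 := hker h
    rw [hpr, if_pos (Cn.refl u)] at h0
    by_contra hv
    rw [if_neg hv] at h0
    simp at h0

/-- The rank of an edge set with the sites of `C` wired together. -/
noncomputable def rk (C : Set Site) (ω : Finset Edge) : ℕ :=
  Module.finrank (ZMod 2) (Submodule.span (ZMod 2)
    ((fun e => (spanC C).mkQ (bdE e)) '' (ω : Set Edge)))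

lemma rk_empty (C : Set Site) : rk C ∅ = 0 := by
  unfold rk
  rw [Finset.coe_empty, Set.image_empty, Submodule.span_empty, finrank_bot]

lemma cn_iff_mem_quot {C : Set Site} {ω : Finset Edge} {e : Edge} :
    Cn C ω (src e) (tgt e) ↔ (spanC C).mkQ (bdE e) ∈ Submodule.span (ZMod 2)
      ((fun e => (spanC C).mkQ (bdE e)) '' (ω : Set Edge)) := by
  rw [cn_iff_mem_span, ← Submodule.comap_map_mkQ, Submodule.mem_comap, Submodule.map_span,
    Set.image_image]
  rfl

lemma rk_insert_of_cn {C : Set Site} {ω : Finset Edge} {e : Edge} (h : Cn C ω (src e) (tgt e)) :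
    rk C (insert e ω) = rk C ω := by
  unfold rk
  rw [Finset.coe_insert, Set.image_insert_eq, Submodule.span_insert_eq_span (cn_iff_mem_quot.1 h)]

lemma rk_insert_of_not_cn {C : Set Site} {ω : Finset Edge} {e : Edge}
    (h : ¬Cn C ω (src e) (tgt e)) : rk C (insert e ω) = rk C ω + 1 := by
  rw [cn_iff_mem_quot] at h
  unfold rk
  rw [Finset.coe_insert, Set.image_insert_eq, Submodule.span_insert]
  set S := Submodule.span (ZMod 2) ((fun e => (spanC C).mkQ (bdE e)) '' (ω : Set Edge)) with hS
  set y := (spanC C).mkQ (bdE e) with hy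
  have fin : FiniteDimensional (ZMod 2) S :=
    FiniteDimensional.span_of_finite _ ((ω.finite_toSet).image _)
  have hy0 : y ≠ 0 := fun h0 => h (h0 ▸ S.zero_mem)
  have hd : Disjoint (Submodule.span (ZMod 2) {y}) S := by
    rw [disjoint_comm, Submodule.disjoint_span_singleton' hy0]
    exact h
  have := Submodule.finrank_sup_add_finrank_inf_eq (Submodule.span (ZMod 2) {y}) S
  rw [hd.eq_bot, finrank_bot, finrank_span_singleton hy0] at this
  omega

/-- The increment of the rank when an edge is added, as a natural number. -/
noncomputable def dr (C : Set Site) (ω : Set Edge) (e : Edge) : ℕ :=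
  if Cn C ω (src e) (tgt e) then 0 else 1

lemma rk_insert (C : Set Site) (ω : Finset Edge) (e : Edge) :
    rk C (insert e ω) = rk C ω + dr C ω e := by
  unfold dr
  split_ifs with h
  · rw [rk_insert_of_cn h]; rfl
  · rw [rk_insert_of_not_cn h]

lemma dr_le_one (C : Set Site) (ω : Set Edge) (e : Edge) : dr C ω e ≤ 1 := by
  unfold dr; split_ifs <;> simp

lemma dr_anti {C C' : Set Site} {ω ω' : Set Edge} (hC : C ⊆ C') (h : ω ⊆ ω') (e : Edge) :
    dr C' ω' e ≤ dr C ω e := by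
  unfold dr
  by_cases h1 : Cn C ω (src e) (tgt e)
  · simp [h1, h1.mono hC h]
  · rw [if_neg h1]; split_ifs <;> simp

/-- The rank only depends on the connectivity induced by the wired set. -/
lemma rk_congr {C C' : Set Site} {ω : Finset Edge}
    (h : ∀ η : Finset Edge, η ⊆ ω → ∀ e ∈ ω,
      (Cn C η (src e) (tgt e) ↔ Cn C' η (src e) (tgt e))) : rk C ω = rk C' ω := by
  induction ω using Finset.induction_on with
  | empty => rw [rk_empty, rk_empty]
  | insert e ω he ih =>
    rw [rk_insert, rk_insert, ih fun η hη e' he' => h η (hη.trans (Finset.subset_insert _ _)) e'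
      (Finset.mem_insert_of_mem he')]
    unfold dr
    simp only [h ω (Finset.subset_insert _ _) e (Finset.mem_insert_self _ _)]

lemma rk_anti_wired {C C' : Set Site} (h : C ⊆ C') {ω η : Finset Edge} (hω : ω ⊆ η) :
    rk C' η + rk C ω ≤ rk C η + rk C' ω := by
  obtain ⟨ζ, rfl⟩ : ∃ ζ, η = ω ∪ ζ := ⟨η, (Finset.union_eq_right.2 hω).symm⟩
  clear hω
  induction ζ using Finset.induction_on with
  | empty => simp [add_comm]
  | insert e ζ _ ih =>
    rw [Finset.union_insert, rk_insert, rk_insert]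
    have := dr_anti h (Set.Subset.refl (↑(ω ∪ ζ) : Set Edge)) e
    omega

lemma rk_wired_le {C C' : Set Site} (h : C ⊆ C') (ω : Finset Edge) : rk C' ω ≤ rk C ω := by
  have := rk_anti_wired h (Finset.empty_subset ω)
  simpa [rk_empty] using this

/-! ### Counting colourings -/

/-- Colourings equal to `c` off `B` and constant along the edges of `ω`. -/
def Cols {K : Type*} (B : Finset Site) (c : K) (ω : Set Edge) : Set (Site → K) :=
  {σ | (∀ x ∉ B, σ x = c) ∧ ∀ e ∈ ω, σ (src e) = σ (tgt e)}

lemma Cols.eq_of_cn {K : Type*} {B : Finset Site} {c : K} {ω : Set Edge} {σ : Site → K}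
    (h : σ ∈ Cols B c ω) {u v : Site} (huv : Cn ((B : Set Site)ᶜ) ω u v) : σ u = σ v :=
  huv.eq_of h.2 fun a ha b hb => by rw [h.1 a (by simpa using ha), h.1 b (by simpa using hb)]

lemma card_cols_empty {K : Type*} [Fintype K] (B : Finset Site) (c : K) :
    Nat.card (Cols B c (∅ : Set Edge)) = Fintype.card K ^ B.card := by
  let φ : Cols B c (∅ : Set Edge) ≃ (B → K) :=
    { toFun := fun σ x => σ.1 x
      invFun := fun τ => ⟨fun x => if h : x ∈ B then τ ⟨x, h⟩ else c,
        fun x hx => by simp [hx], fun e he => by simp at he⟩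
      left_inv := fun σ => by
        ext x
        by_cases h : x ∈ B
        · simp [h]
        · simp [h, σ.2.1 x h]
      right_inv := fun τ => by
        ext x; simp }
  rw [Nat.card_congr φ, Nat.card_eq_fintype_card, Fintype.card_fun, Fintype.card_coe]

lemma card_cols_insert_aux {K : Type*} [AddCommGroup K] {B : Finset Site} {c : K} {ω : Set Edge}
    {e : Edge} {u v : Site} (huv : (u = src e ∧ v = tgt e) ∨ (u = tgt e ∧ v = src e))
    (h : ¬Cn ((B : Set Site)ᶜ) ω u v) (hu : ∀ x ∉ B, ¬Cn ((B : Set Site)ᶜ) ω u x) :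
    Nat.card (Cols B c ω) = Nat.card (Cols B c (insert e ω)) * Nat.card K := by
  set A : Site → Prop := fun x => Cn ((B : Set Site)ᶜ) ω u x with hA
  have hAe : ∀ e ∈ ω, (A (src e) ↔ A (tgt e)) := fun e he =>
    ⟨fun h => h.trans (.of_edge he), fun h => h.trans (Cn.of_edge he).symm⟩
  let sh : K → (Site → K) → (Site → K) := fun k σ x => if A x then σ x + k else σ x
  have hsh : ∀ k σ, σ ∈ Cols B c ω → sh k σ ∈ Cols B c ω := by
    intro k σ hσ
    refine ⟨fun x hx => ?_, fun e he => ?_⟩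
    · simp only [sh]; rw [if_neg (hu x hx), hσ.1 x hx]
    · simp only [sh, hAe e he, hσ.2 e he]
  have hsu : ∀ k σ, sh k σ u = σ u + k := fun k σ => if_pos (Cn.refl u)
  have hsv : ∀ k σ, sh k σ v = σ v := fun k σ => if_neg h
  have hss : ∀ k k' σ, sh k (sh k' σ) = sh (k' + k) σ := by
    intro k k' σ; funext x; simp only [sh]; split_ifs <;> simp [add_assoc]
  have hs0 : ∀ σ, sh 0 σ = σ := by
    intro σ; funext x; simp [sh]
  have hmem : ∀ σ, σ ∈ Cols B c (insert e ω) ↔ σ ∈ Cols B c ω ∧ σ u = σ v := by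
    intro σ
    have : σ u = σ v ↔ σ (src e) = σ (tgt e) := by
      rcases huv with ⟨rfl, rfl⟩ | ⟨rfl, rfl⟩
      · rfl
      · exact eq_comm
    simp only [Cols, Set.mem_ofPred_eq, Set.forall_mem_insert, this]
    tauto
  let φ : Cols B c ω ≃ Cols B c (insert e ω) × K :=
    { toFun := fun σ => (⟨sh (σ.1 v - σ.1 u) σ.1, (hmem _).2 ⟨hsh _ _ σ.2, by
          rw [hsu, hsv]; abel⟩⟩, σ.1 u - σ.1 v)
      invFun := fun p => ⟨sh p.2 p.1.1, hsh _ _ ((hmem _).1 p.1.2).1⟩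
      left_inv := fun σ => by
        apply Subtype.ext
        simp only [hss]
        rw [show σ.1 v - σ.1 u + (σ.1 u - σ.1 v) = 0 by abel, hs0]
      right_inv := fun p => by
        have := ((hmem _).1 p.1.2).2
        refine Prod.ext (Subtype.ext ?_) ?_
        · simp only [hss, hsu, hsv, this]
          rw [show p.2 + (p.1.1 v - (p.1.1 v + p.2)) = 0 by abel, hs0]
        · simp only [hsu, hsv, this]; abel }
  rw [Nat.card_congr φ, Nat.card_prod]

/-- The number of colourings compatible with `ω` is a power determined by the rank. -/
lemma card_cols {K : Type*} [AddCommGroup K] [Fintype K] (B : Finset Site) (c : K)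
    (ω : Finset Edge) :
    Nat.card (Cols B c (ω : Set Edge)) * Fintype.card K ^ rk ((B : Set Site)ᶜ) ω =
      Fintype.card K ^ B.card := by
  induction ω using Finset.induction_on with
  | empty => rw [Finset.coe_empty, card_cols_empty, rk_empty, pow_zero, mul_one]
  | insert e ω he ih =>
    by_cases h : Cn ((B : Set Site)ᶜ) ω (src e) (tgt e)
    · rw [rk_insert_of_cn h, ← ih]
      congr 2
      have : Cols B c (↑(insert e ω) : Set Edge) = Cols B c (↑ω : Set Edge) := by
        ext σ
        refine ⟨fun hσ => ⟨hσ.1, fun e' he' => hσ.2 e' (by simp [Finset.mem_coe.1 he'])⟩,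
          fun hσ => ⟨hσ.1, fun e' he' => ?_⟩⟩
        rw [Finset.coe_insert] at he'
        rcases he' with rfl | he'
        · exact Cols.eq_of_cn hσ h
        · exact hσ.2 e' he'
      rw [this]
    · rw [rk_insert_of_not_cn h, ← ih, pow_succ, Finset.coe_insert]
      have key : Nat.card (Cols B c (ω : Set Edge)) =
          Nat.card (Cols B c (insert e (ω : Set Edge))) * Nat.card K := by
        by_cases hu : ∀ x ∉ B, ¬Cn ((B : Set Site)ᶜ) ω (src e) x
        · exact card_cols_insert_aux (Or.inl ⟨rfl, rfl⟩) h hu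
        · push Not at hu
          obtain ⟨x, hx, hux⟩ := hu
          refine card_cols_insert_aux (Or.inr ⟨rfl, rfl⟩) (fun h' => h h'.symm) ?_
          intro y hy hty
          exact h (hux.trans ((Cn.of_wired (by simpa using hx) (by simpa using hy)).trans hty.symm))
      rw [key, Nat.card_eq_fintype_card (α := K)]
      ring

/-! ### Planar duality -/

/-- The duality of edges: the dual edge, translated back to the square lattice. -/
def dl : Edge ≃ Edge where
  toFun e := if e.2 then ((e.1.1 - 1, e.1.2), false) else ((e.1.1, e.1.2 - 1), true)
  invFun e := if e.2 then ((e.1.1, e.1.2 + 1), false) else ((e.1.1 + 1, e.1.2), true)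
  left_inv := by rintro ⟨⟨x, y⟩, _ | _⟩ <;> simp
  right_inv := by rintro ⟨⟨x, y⟩, _ | _⟩ <;> simp

lemma dl_h (x y : ℤ) : dl ((x, y), false) = ((x, y - 1), true) := rfl

lemma dl_v (x y : ℤ) : dl ((x, y), true) = ((x - 1, y), false) := rfl

lemma dl_symm_h (x y : ℤ) : dl.symm ((x, y), false) = ((x + 1, y), true) := rfl

lemma dl_symm_v (x y : ℤ) : dl.symm ((x, y), true) = ((x, y + 1), false) := rfl

lemma src_mk (x : Site) (b : Bool) : src (x, b) = x := rfl

lemma tgt_h (x y : ℤ) : tgt ((x, y), false) = (x + 1, y) := rfl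

lemma tgt_v (x y : ℤ) : tgt ((x, y), true) = (x, y + 1) := rfl

/-- Translation of edges. -/
def shE (z : Site) : Edge ≃ Edge := (Equiv.addRight z).prodCongr (Equiv.refl Bool)

lemma shE_apply (z : Site) (e : Edge) : shE z e = (e.1 + z, e.2) := rfl

lemma src_shE (z : Site) (e : Edge) : src (shE z e) = src e + z := rfl

lemma tgt_shE (z : Site) (e : Edge) : tgt (shE z e) = tgt e + z := by
  obtain ⟨⟨x, y⟩, _ | _⟩ := e <;> obtain ⟨a, b⟩ := z <;> simp [shE_apply, tgt] <;> ring

/-- The inversion of edges. -/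
def ivE : Edge ≃ Edge where
  toFun e := if e.2 then ((-e.1.1, -e.1.2 - 1), true) else ((-e.1.1 - 1, -e.1.2), false)
  invFun e := if e.2 then ((-e.1.1, -e.1.2 - 1), true) else ((-e.1.1 - 1, -e.1.2), false)
  left_inv := by rintro ⟨⟨x, y⟩, _ | _⟩ <;> simp
  right_inv := by rintro ⟨⟨x, y⟩, _ | _⟩ <;> simp

lemma src_ivE (e : Edge) : src (ivE e) = -tgt e := by
  obtain ⟨⟨x, y⟩, _ | _⟩ := e <;> simp [ivE, tgt, src] <;> ring

lemma tgt_ivE (e : Edge) : tgt (ivE e) = -src e := by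
  obtain ⟨⟨x, y⟩, _ | _⟩ := e <;> simp [ivE, tgt, src]

lemma Cn.shift {C : Set Site} {ω : Set Edge} {u v : Site} (h : Cn C ω u v) (z : Site) :
    Cn ((· + z) '' C) (shE z '' ω) (u + z) (v + z) := by
  have := h.eq_of (f := fun y => Cn ((· + z) '' C) (shE z '' ω) (u + z) (y + z))
    (fun e he => by
      have : Cn ((· + z) '' C) (shE z '' ω) (src e + z) (tgt e + z) := by
        rw [← src_shE, ← tgt_shE]; exact .of_edge ⟨e, he, rfl⟩
      exact propext ⟨fun h => h.trans this, fun h => h.trans this.symm⟩)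
    (fun a ha b hb => by
      have : Cn ((· + z) '' C) (shE z '' ω) (a + z) (b + z) :=
        .of_wired ⟨a, ha, rfl⟩ ⟨b, hb, rfl⟩
      exact propext ⟨fun h => h.trans this, fun h => h.trans this.symm⟩)
  exact this.mp (Cn.refl _)

/-- Chains of edges. -/
abbrev Chain1 := Edge →₀ ZMod 2

/-- The boundary operator. -/
noncomputable def bd : Chain1 →ₗ[ZMod 2] Chain0 := Finsupp.linearCombination (ZMod 2) bdE

lemma bd_single (e : Edge) : bd (Finsupp.single e 1) = bdE e := by simp [bd]

/-- The height function of a cycle: the parity of the number of horizontal edges below `x`. -/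
noncomputable def ht (x : Site) : Chain1 →ₗ[ZMod 2] ZMod 2 :=
  Finsupp.linearCombination (ZMod 2)
    (fun e => if e.2 = false ∧ e.1.1 = x.1 ∧ e.1.2 ≤ x.2 then (1 : ZMod 2) else 0)

/-- The parity of a chain of sites along the vertical ray below `x`. -/
noncomputable def ray (x : Site) : Chain0 →ₗ[ZMod 2] ZMod 2 :=
  Finsupp.linearCombination (ZMod 2)
    (fun p => if p.1 = x.1 ∧ p.2 ≤ x.2 then (1 : ZMod 2) else 0)

lemma zmod2_add_self (a : ZMod 2) : a + a = 0 := CharTwo.add_self_eq_zero a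

lemma ht_col (x y : ℤ) (z : Chain1) : ht (x, y - 1) z + ht (x, y) z = z ((x, y), false) := by
  have : ht (x, y - 1) + ht (x, y) = Finsupp.lapply ((x, y), false) := by
    refine Finsupp.lhom_ext' fun e => LinearMap.ext_ring ?_
    obtain ⟨⟨a, b⟩, c⟩ := e
    simp only [LinearMap.comp_apply, LinearMap.add_apply, Finsupp.lsingle_apply, ht,
      Finsupp.linearCombination_single, one_smul, Finsupp.lapply_apply, Finsupp.single_apply,
      Prod.mk.injEq]
    by_cases hc : c = false
    · by_cases ha : a = x
      · rcases lt_trichotomy b y with hb | hb | hb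
        · have h1 : b ≤ y - 1 := by omega
          simp [hc, ha, h1, hb.le, hb.ne, zmod2_add_self]
        · simp [hc, ha, hb]
        · have h1 : ¬b ≤ y - 1 := by omega
          simp [hc, ha, h1, hb.not_ge, hb.ne']
      · simp [ha]
    · simp [hc]
  exact congrArg (fun L => L z) this

lemma ht_row (x y : ℤ) (z : Chain1) :
    ht (x - 1, y) z + ht (x, y) z = z ((x, y), true) + ray (x, y) (bd z) := by
  have : ht (x - 1, y) + ht (x, y) =
      Finsupp.lapply ((x, y), true) + (ray (x, y)).comp bd := by
    refine Finsupp.lhom_ext' fun e => LinearMap.ext_ring ?_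
    obtain ⟨⟨a, b⟩, c⟩ := e
    simp only [LinearMap.comp_apply, LinearMap.add_apply, Finsupp.lsingle_apply, ht, ray, bd_single,
      Finsupp.linearCombination_single, one_smul, Finsupp.lapply_apply, Finsupp.single_apply,
      Prod.mk.injEq, bdE, pr, map_add, src, tgt]
    cases c
    · by_cases hb : b ≤ y
      · by_cases ha : a = x
        · have h2 : ¬x = x - 1 := by omega
          simp [ha, hb, h2]
        · by_cases ha' : a + 1 = x
          · have h2 : a = x - 1 := by omega
            simp [hb, h2]
          · have h2 : ¬a = x - 1 := by omega
            simp [ha, ha', h2]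
      · simp [hb]
    · by_cases ha : a = x
      · rcases lt_trichotomy b y with hb | hb | hb
        · have h1 : b + 1 ≤ y := by omega
          simp [ha, h1, hb.le, hb.ne, zmod2_add_self]
        · simp [ha, hb, zmod2_add_self]
        · have h1 : ¬b + 1 ≤ y := by omega
          simp [ha, h1, hb.not_ge, hb.ne']
      · simp [ha]
  exact congrArg (fun L => L z) this

/-- The height function of a cycle changes exactly across the edges of the cycle. -/
lemma ht_dl {z : Chain1} (hz : bd z = 0) (e : Edge) :
    ht (src (dl e)) z + ht (tgt (dl e)) z = z e := by
  obtain ⟨⟨x, y⟩, _ | _⟩ := e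
  · rw [dl_h, src_mk, tgt_v, sub_add_cancel]; exact ht_col x y z
  · rw [dl_v, src_mk, tgt_h, sub_add_cancel, ht_row, hz]; simp

lemma ht_eq_of_zero {z : Chain1} (hz : bd z = 0) {e : Edge} (he : z e = 0) :
    ht (src (dl e)) z = ht (tgt (dl e)) z := by
  have := ht_dl hz e
  rw [he] at this
  exact CharTwo.add_eq_zero.1 this

lemma spanC_empty : spanC ∅ = ⊥ := by simp [spanC]

/-- A connection gives a chain with the two endpoints as its boundary. -/
lemma Cn.exists_chain {ω : Set Edge} {u v : Site} (h : Cn ∅ ω u v) :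
    ∃ z : Chain1, (∀ e, z e ≠ 0 → e ∈ ω) ∧ bd z = pr u v := by
  rw [cn_iff_mem_span, spanC_empty, bot_sup_eq,
    Finsupp.mem_span_image_iff_linearCombination] at h
  obtain ⟨z, hz, h⟩ := h
  exact ⟨z, fun e he => (Finsupp.mem_supported _ _).1 hz (Finsupp.mem_support_iff.2 he), h⟩

/-- The endpoints of a closed edge and those of its dual edge are not both connected. -/
lemma not_cn_and_cn_dual {ω : Set Edge} {e : Edge} (he : e ∉ ω) (h : Cn ∅ ω (src e) (tgt e))
    (h' : Cn ∅ (dl '' {e' | e' ∉ ω ∧ e' ≠ e}) (src (dl e)) (tgt (dl e))) : False := by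
  obtain ⟨z, hz, hb⟩ := h.exists_chain
  set y := z + Finsupp.single e 1 with hy
  have hby : bd y = 0 := by
    rw [hy, map_add, bd_single, hb, bdE]
    ext a; simp [zmod2_add_self]
  have hze : z e = 0 := by by_contra hne; exact he (hz e hne)
  have hye : y e = 1 := by simp [hy, hze]
  have hc := h'.eq_of (f := fun x => ht x y) (fun e' he' => by
    obtain ⟨e'', ⟨h1, h2⟩, rfl⟩ := he'
    refine ht_eq_of_zero hby ?_
    have : z e'' = 0 := by by_contra hne; exact h1 (hz _ hne)
    simp [hy, this, h2.symm]) (by simp)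
  have := ht_dl hby e
  rw [hye, hc, zmod2_add_self] at this
  exact zero_ne_one this

/-- The four edges at a site. -/
noncomputable def star (x : Site) : Chain1 :=
  Finsupp.single (x, false) 1 + Finsupp.single ((x.1 - 1, x.2), false) 1 +
    (Finsupp.single (x, true) 1 + Finsupp.single ((x.1, x.2 - 1), true) 1)

/-- The coboundary operator. -/
noncomputable def cobd : Chain0 →ₗ[ZMod 2] Chain1 := Finsupp.linearCombination (ZMod 2) star

lemma cobd_apply (f : Chain0) (e : Edge) : cobd f e = f (src e) + f (tgt e) := by
  have : (Finsupp.lapply e).comp cobd =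
      (Finsupp.lapply (src e) + Finsupp.lapply (tgt e) : Chain0 →ₗ[ZMod 2] ZMod 2) := by
    refine Finsupp.lhom_ext' fun p => LinearMap.ext_ring ?_
    obtain ⟨a, b⟩ := p
    obtain ⟨⟨x, y⟩, c⟩ := e
    simp only [LinearMap.comp_apply, LinearMap.add_apply, Finsupp.lsingle_apply, cobd,
      Finsupp.linearCombination_single, one_smul, Finsupp.lapply_apply, Finsupp.single_apply,
      star, Finsupp.add_apply, Prod.mk.injEq, src, tgt]
    cases c
    · simp [sub_eq_iff_eq_add]
    · simp [sub_eq_iff_eq_add]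
  exact congrArg (fun L => L f) this

lemma bd_dual_cobd (f : Chain0) : (cobd f).sum (fun e c => c • bdE (dl e)) = 0 := by
  have : (Finsupp.linearCombination (ZMod 2) (fun e => bdE (dl e))).comp cobd = 0 := by
    refine Finsupp.lhom_ext' fun p => LinearMap.ext_ring ?_
    obtain ⟨a, b⟩ := p
    simp only [LinearMap.comp_apply, Finsupp.lsingle_apply, cobd,
      Finsupp.linearCombination_single, one_smul, star, map_add, dl_h, dl_v, bdE, pr, src_mk,
      tgt_h, tgt_v, LinearMap.zero_apply, sub_add_cancel]
    ext q
    simp only [Finsupp.add_apply, Finsupp.zero_apply]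
    generalize (Finsupp.single (a, b) (1 : ZMod 2)) q = t1
    generalize (Finsupp.single (a, b - 1) (1 : ZMod 2)) q = t2
    generalize (Finsupp.single (a - 1, b) (1 : ZMod 2)) q = t3
    generalize (Finsupp.single (a - 1, b - 1) (1 : ZMod 2)) q = t4
    revert t1 t2 t3 t4
    decide
  exact congrArg (fun L => L f) this

lemma cluster_finite (ω : Finset Edge) (u : Site) : {x | Cn ∅ ω u x}.Finite := by
  refine ((ω.image src ∪ ω.image tgt) ∪ {u} : Finset Site).finite_toSet.subset ?_
  intro x hx
  by_contra hn
  simp only [Finset.coe_union, Finset.coe_singleton, Set.mem_union, Set.mem_singleton_iff,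
    Finset.mem_coe, not_or, Finset.mem_image, not_exists, not_and] at hn
  have := Cn.eq_of (f := fun y => y = x) hx (fun e he => by
    have h1 : src e ≠ x := hn.1.1 e he
    have h2 : tgt e ≠ x := hn.1.2 e he
    simp [h1, h2]) (by simp)
  simp only [eq_iff_iff, iff_true] at this
  exact hn.2 this.symm

/-- If the endpoints of an edge are not connected, those of the dual edge are connected in the
dual configuration. -/
lemma cn_dual_of_not_cn {ω : Finset Edge} {e : Edge} (h : ¬Cn ∅ ω (src e) (tgt e)) :
    Cn ∅ (dl '' {e' | e' ∉ ω ∧ e' ≠ e}) (src (dl e)) (tgt (dl e)) := by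
  set A := (cluster_finite ω (src e)).toFinset with hA
  have hmem : ∀ x, x ∈ A ↔ Cn ∅ ω (src e) x := fun x => by simp [hA]
  set f : Chain0 := ∑ x ∈ A, Finsupp.single x 1 with hf
  have hfx : ∀ x, f x = if x ∈ A then 1 else 0 := by
    intro x
    simp [hf, Finsupp.finsetSum_apply, Finsupp.single_apply]
  set ζ := cobd f with hζ
  have hζe : ζ e = 1 := by
    rw [hζ, cobd_apply, hfx, hfx, if_pos ((hmem _).2 (Cn.refl _)), if_neg (fun h' => h ((hmem _).1 h')),
      add_zero]
  have hζω : ∀ e' ∈ ω, ζ e' = 0 := by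
    intro e' he'
    have : src e' ∈ A ↔ tgt e' ∈ A := by
      rw [hmem, hmem]
      exact ⟨fun h => h.trans (.of_edge (by exact_mod_cast he')),
        fun h => h.trans (Cn.of_edge (by exact_mod_cast he')).symm⟩
    rw [hζ, cobd_apply, hfx, hfx]
    simp only [this, zmod2_add_self]
  have hsum := bd_dual_cobd f
  rw [← hζ, Finsupp.sum, ← Finset.add_sum_erase _ _ (show e ∈ ζ.support by
    rw [Finsupp.mem_support_iff, hζe]; exact one_ne_zero), hζe, one_smul] at hsum
  rw [cn_iff_mem_span, spanC_empty, bot_sup_eq]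
  have e1 : bdE (dl e) = ∑ x ∈ ζ.support.erase e, ζ x • bdE (dl x) := by
    have h2 : ∀ a b : Chain0, a + b = 0 → a = b := fun a b hab => by
      ext q
      have := congrArg (fun c => c q) hab
      exact CharTwo.add_eq_zero.1 this
    exact h2 _ _ hsum
  change bdE (dl e) ∈ _
  rw [e1]
  refine Submodule.sum_mem _ fun x hx => Submodule.smul_mem _ _ (Submodule.subset_span ?_)
  rw [Finset.mem_erase, Finsupp.mem_support_iff] at hx
  exact ⟨dl x, ⟨x, ⟨fun hxω => hx.2 (hζω x hxω), hx.1⟩, rfl⟩, rfl⟩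

lemma dl_symm_eq (e : Edge) : dl.symm e = shE (1, 1) (dl e) := by
  obtain ⟨⟨x, y⟩, _ | _⟩ := e
  · rw [dl_h, dl_symm_h, shE_apply]; simp
  · rw [dl_v, dl_symm_v, shE_apply]; simp

/-- The analogue of `cn_dual_of_not_cn` for the inverse duality. -/
lemma cn_dual_symm_of_not_cn {ω : Finset Edge} {e : Edge} (h : ¬Cn ∅ ω (src e) (tgt e)) :
    Cn ∅ (dl.symm '' {e' | e' ∉ ω ∧ e' ≠ e}) (src (dl.symm e)) (tgt (dl.symm e)) := by
  have := (cn_dual_of_not_cn h).shift (1, 1)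
  rw [← src_shE, ← tgt_shE, ← dl_symm_eq, Set.image_image, Set.image_empty] at this
  simpa only [← dl_symm_eq] using this

/-- The box `{-M,…,M}²`. -/
noncomputable def box (M : ℕ) : Finset Site := Finset.Icc (-(M : ℤ)) M ×ˢ Finset.Icc (-(M : ℤ)) M

lemma mem_box {M : ℕ} {x : Site} :
    x ∈ box M ↔ (-(M : ℤ) ≤ x.1 ∧ x.1 ≤ M) ∧ (-(M : ℤ) ≤ x.2 ∧ x.2 ≤ M) := by
  simp [box, Finset.mem_product]

/-- The height function of a cycle vanishes outside of every box containing the cycle. -/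
lemma ht_eq_zero {z : Chain1} (hz : bd z = 0) {M : ℕ}
    (hM : ∀ e, z e ≠ 0 → src e ∈ box M) {x : Site} (hx : x ∉ box M) : ht x z = 0 := by
  have key : ∀ x : Site, (x.1 < -(M : ℤ) ∨ (M : ℤ) < x.1 ∨ x.2 < -(M : ℤ)) → ht x z = 0 := by
    intro x hx
    rw [ht, Finsupp.linearCombination_apply, Finsupp.sum]
    refine Finset.sum_eq_zero fun e he => ?_
    have h1 := mem_box.1 (hM e (Finsupp.mem_support_iff.1 he))
    rw [src] at h1
    rw [if_neg (by intro h2; omega), smul_zero]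
  by_cases h1 : (x.1 < -(M : ℤ) ∨ (M : ℤ) < x.1 ∨ x.2 < -(M : ℤ))
  · exact key x h1
  · obtain ⟨a, b⟩ := x
    rw [mem_box] at hx
    simp only at h1 hx
    have hb : (M : ℤ) < b := by omega
    have step : ∀ n : ℕ, ht (-(M : ℤ) - 1 + n, b) z = 0 := by
      intro n
      induction n with
      | zero => exact key _ (Or.inl (by simp))
      | succ n ih =>
        have := ht_row (-(M : ℤ) - 1 + (n + 1 : ℕ)) b z
        have hv : z ((-(M : ℤ) - 1 + (n + 1 : ℕ), b), true) = 0 := by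
          by_contra hne
          have := mem_box.1 (hM _ hne)
          simp only [src] at this
          omega
        rw [hv, hz, map_zero, add_zero,
          show -(M : ℤ) - 1 + (n + 1 : ℕ) - 1 = -(M : ℤ) - 1 + n by push_cast; ring, ih,
          zero_add] at this
        exact this
    have := step (a + M + 1).toNat
    rwa [show -(M : ℤ) - 1 + ((a + M + 1).toNat : ℤ) = a by omega] at this

/-! ### Connections inside a region and the trifurcation count -/

section Region

variable {V : Type*}

/-- Connection by steps of `r` that stay inside the region `R`. -/
def CR (r : V → V → Prop) (R : Set V) (u v : V) : Prop :=
  Relation.ReflTransGen (fun a b => r a b ∧ a ∈ R ∧ b ∈ R) u v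

variable {r r' : V → V → Prop} {R R' S : Set V} {u v x : V}

lemma CR.refl (u : V) : CR r R u u := Relation.ReflTransGen.refl

lemma CR.trans (h : CR r R u v) (h' : CR r R v x) : CR r R u x := Relation.ReflTransGen.trans h h'

lemma CR.single (h : r u v) (hu : u ∈ R) (hv : v ∈ R) : CR r R u v :=
  Relation.ReflTransGen.single ⟨h, hu, hv⟩

lemma CR.symm (hr : ∀ a b, r a b → r b a) (h : CR r R u v) : CR r R v u := by
  induction h with
  | refl => exact CR.refl _
  | tail _ hbc ih => exact (CR.single (hr _ _ hbc.1) hbc.2.2 hbc.2.1).trans ih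

lemma CR.mono' (h : CR r R u v) (hr : ∀ a ∈ R, ∀ b ∈ R, r a b → r' a b) (hR : R ⊆ R') :
    CR r' R' u v := by
  induction h with
  | refl => exact CR.refl _
  | tail _ hbc ih =>
    exact ih.trans (CR.single (hr _ hbc.2.1 _ hbc.2.2 hbc.1) (hR hbc.2.1) (hR hbc.2.2))

lemma CR.mono_set (h : CR r R u v) (hR : R ⊆ R') : CR r R' u v := h.mono' (fun _ _ _ _ h => h) hR

lemma CR.map {V' : Type*} {s : V' → V' → Prop} {R' : Set V'} (f : V → V')
    (hf : ∀ a b, r a b → s (f a) (f b)) (hR : ∀ a ∈ R, f a ∈ R') (h : CR r R u v) :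
    CR s R' (f u) (f v) := by
  induction h with
  | refl => exact CR.refl _
  | tail _ hbc ih => exact ih.trans (CR.single (hf _ _ hbc.1) (hR _ hbc.2.1) (hR _ hbc.2.2))

/-- The first exit of a path from a set `A`. -/
lemma CR.first_exit {A : Set V} (h : CR r R u v) (hu : u ∈ A) (hv : v ∉ A) :
    ∃ a ∈ A, ∃ b ∉ A, r a b ∧ a ∈ R ∧ b ∈ R ∧ CR r (R ∩ A) u a := by
  induction h with
  | refl => exact absurd hu hv
  | @tail b c hab hbc ih =>
    by_cases hb : b ∈ A
    · by_cases hex : CR r (R ∩ A) u b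
      · exact ⟨b, hb, c, hv, hbc.1, hbc.2.1, hbc.2.2, hex⟩
      · have key : ∀ y, CR r R u y → CR r (R ∩ A) u y ∨
            ∃ a ∈ A, ∃ b ∉ A, r a b ∧ a ∈ R ∧ b ∈ R ∧ CR r (R ∩ A) u a := by
          intro y hy
          induction hy with
          | refl => exact Or.inl (CR.refl _)
          | @tail p q _ hpq ih' =>
            rcases ih' with h1 | h1
            · have hp : p ∈ A := by
                rcases Relation.ReflTransGen.cases_tail h1 with h2 | ⟨_, _, h3⟩
                · rw [h2]; exact hu
                · exact h3.2.2.2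
              by_cases hq : q ∈ A
              · exact Or.inl (h1.trans (CR.single hpq.1 ⟨hpq.2.1, hp⟩ ⟨hpq.2.2, hq⟩))
              · exact Or.inr ⟨p, hp, q, hq, hpq.1, hpq.2.1, hpq.2.2, h1⟩
            · exact Or.inr h1
        rcases key b hab with h1 | h1
        · exact absurd h1 hex
        · exact h1
    · exact ih hb

/-- The last exit of a path from a set `S`. -/
lemma CR.last_exit (h : CR r R u v) (hu : u ∈ S) (hv : v ∉ S) :
    ∃ a ∈ S, ∃ b ∉ S, r a b ∧ b ∈ R ∧ CR r (R \ S) b v := by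
  induction h with
  | refl => exact absurd hu hv
  | @tail b c hab hbc ih =>
    by_cases hb : b ∈ S
    · exact ⟨b, hb, c, hv, hbc.1, hbc.2.2, CR.refl _⟩
    · obtain ⟨p, hp, q, hq, h1, h2, h3⟩ := ih hb
      exact ⟨p, hp, q, hq, h1, h2, h3.trans (CR.single hbc.1 ⟨hbc.2.1, hb⟩ ⟨hbc.2.2, hv⟩)⟩

/-- A path avoiding nothing either avoids `S` or reaches `S` through the component of its starting
point in the complement of `S`. -/
lemma CR.avoid_or_hit (h : CR r R u v) (hu : u ∉ S) :
    CR r (R \ S) u v ∨ ∃ a ∉ S, ∃ b ∈ S, r a b ∧ a ∈ R ∧ b ∈ R ∧ CR r (R \ S) u a := by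
  induction h with
  | refl => exact Or.inl (CR.refl _)
  | @tail b c hab hbc ih =>
    rcases ih with h1 | h1
    · have hb : b ∉ S := by
        rcases Relation.ReflTransGen.cases_tail h1 with h2 | ⟨_, _, h3⟩
        · rw [h2]; exact hu
        · exact h3.2.2.2
      by_cases hc : c ∈ S
      · exact Or.inr ⟨b, hb, c, hc, hbc.1, hbc.2.1, hbc.2.2, h1⟩
      · exact Or.inl (h1.trans (CR.single hbc.1 ⟨hbc.2.1, hb⟩ ⟨hbc.2.2, hc⟩))
    · exact Or.inr h1

/-- Paths inside a component of `R \ S` avoid every set disjoint from that component. -/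
lemma CR.restrict_component (h : CR r (R \ S) u v) {S' : Set V} (hd : ∀ y ∈ S', ¬CR r (R \ S) u y) :
    CR r (R \ S') u v := by
  induction h with
  | refl => exact CR.refl _
  | @tail b c hab hbc ih =>
    refine ih.trans (CR.single hbc.1 ⟨hbc.2.1.1, fun hb => hd b hb hab⟩
      ⟨hbc.2.2.1, fun hc => hd c hc (hab.tail hbc)⟩)

end Region

section Count

variable {V Z : Type*}

/-- The data of a trifurcation: a connected set with three distinct branches reaching `Y`. -/
structure Trifurcation (r : V → V → Prop) (R : Set V) (Y : Finset V) (S : Set V) : Prop where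
  nonempty : S.Nonempty
  subset : S ⊆ R
  conn : ∀ u ∈ S, ∀ v ∈ S, CR r S u v
  branch : ∃ b : Fin 3 → V, (∀ i, b i ∈ R \ S ∧ (∃ s ∈ S, r s (b i)) ∧
    ∃ t ∈ Y, CR r (R \ S) (b i) t) ∧ ∀ i j, i ≠ j → ¬CR r (R \ S) (b i) (b j)

/-- The two selected branches of a trifurcation. -/
structure TwoBranch (r : V → V → Prop) (R : Set V) (Y : Finset V) (S : Set V) (ρ : V → ℕ)
    (ystar b₁ b₂ m₁ m₂ : V) : Prop where
  star_mem : ystar ∈ Y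
  star_conn : ∀ s ∈ S, CR r R s ystar
  star_max : ∀ y ∈ Y, CR r R ystar y → ρ y ≤ ρ ystar
  mem₁ : b₁ ∈ R \ S
  mem₂ : b₂ ∈ R \ S
  adj₁ : ∃ s ∈ S, r s b₁
  adj₂ : ∃ s ∈ S, r s b₂
  max_mem₁ : m₁ ∈ Y
  max_mem₂ : m₂ ∈ Y
  conn₁ : CR r (R \ S) b₁ m₁
  conn₂ : CR r (R \ S) b₂ m₂
  max₁ : ∀ y ∈ Y, CR r (R \ S) b₁ y → ρ y ≤ ρ m₁
  lt : ρ m₁ < ρ m₂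
  disj : ¬CR r (R \ S) b₁ b₂
  star₁ : ¬CR r (R \ S) b₁ ystar
  star₂ : ¬CR r (R \ S) b₂ ystar

variable {r : V → V → Prop} {R : Set V} {Y : Finset V} {S S' : Set V} {ρ : V → ℕ}

lemma exists_max_in (ρ : V → ℕ) (Y : Finset V) (P : V → Prop) (h : ∃ y ∈ Y, P y) :
    ∃ m ∈ Y, P m ∧ ∀ y ∈ Y, P y → ρ y ≤ ρ m := by
  obtain ⟨y, hy, hP⟩ := h
  obtain ⟨m, hm, hmax⟩ := Finset.exists_max_image (Y.filter P) ρ ⟨y, by simp [hy, hP]⟩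
  rw [Finset.mem_filter] at hm
  exact ⟨m, hm.1, hm.2, fun y hy hP => hmax y (by simp [hy, hP])⟩

lemma Trifurcation.exists_twoBranch (hr : ∀ a b, r a b → r b a) (hρ : Function.Injective ρ)
    (h : Trifurcation r R Y S) :
    ∃ ystar b₁ b₂ m₁ m₂, TwoBranch r R Y S ρ ystar b₁ b₂ m₁ m₂ := by
  obtain ⟨b, hb, hne⟩ := h.branch
  obtain ⟨s₀, hs₀⟩ := h.nonempty
  have hconn : ∀ s ∈ S, ∀ i t, CR r (R \ S) (b i) t → CR r R s t := by
    intro s hs i t ht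
    obtain ⟨hbi, ⟨s', hs', hr'⟩, -⟩ := hb i
    exact ((h.conn s hs s' hs').mono_set h.subset).trans
      ((CR.single hr' (h.subset hs') hbi.1).trans (ht.mono_set Set.sdiff_subset))
  obtain ⟨ystar, hy1, hy2, hy3⟩ := exists_max_in ρ Y (fun y => CR r R s₀ y) (by
    obtain ⟨t, ht, hc⟩ := (hb 0).2.2
    exact ⟨t, ht, hconn s₀ hs₀ 0 t hc⟩)
  choose m hm1 hm2 hm3 using fun i => exists_max_in ρ Y (fun y => CR r (R \ S) (b i) y) (hb i).2.2
  have hρne : ∀ i j, i ≠ j → ρ (m i) ≠ ρ (m j) := by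
    intro i j hij heq
    have e := hρ heq
    exact hne i j hij ((hm2 i).trans (e ▸ (hm2 j).symm hr))
  have hstar : ∀ i j, i ≠ j → CR r (R \ S) (b i) ystar → ¬CR r (R \ S) (b j) ystar :=
    fun i j hij h1 h2 => hne i j hij (h1.trans (h2.symm hr))
  obtain ⟨i, j, hij, hi, hj⟩ : ∃ i j : Fin 3, i ≠ j ∧ ¬CR r (R \ S) (b i) ystar ∧
      ¬CR r (R \ S) (b j) ystar := by
    by_cases h0 : CR r (R \ S) (b 0) ystar
    · exact ⟨1, 2, by decide, hstar 0 1 (by decide) h0, hstar 0 2 (by decide) h0⟩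
    · by_cases h1 : CR r (R \ S) (b 1) ystar
      · exact ⟨0, 2, by decide, h0, hstar 1 2 (by decide) h1⟩
      · exact ⟨0, 1, by decide, h0, h1⟩
  have fin : ∀ i j : Fin 3, i ≠ j → ¬CR r (R \ S) (b i) ystar → ¬CR r (R \ S) (b j) ystar →
      ρ (m i) < ρ (m j) → TwoBranch r R Y S ρ ystar (b i) (b j) (m i) (m j) := by
    intro i j hij hi hj hlt
    exact ⟨hy1, fun s hs => ((h.conn s hs s₀ hs₀).mono_set h.subset).trans hy2,
      fun y hy hc => hy3 y hy (hy2.trans hc), (hb i).1, (hb j).1, (hb i).2.1, (hb j).2.1, hm1 i,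
      hm1 j, hm2 i, hm2 j, hm3 i, hlt, hne i j hij, hi, hj⟩
  rcases lt_or_gt_of_ne (hρne i j hij) with hlt | hlt
  · exact ⟨ystar, _, _, _, _, fin i j hij hi hj hlt⟩
  · exact ⟨ystar, _, _, _, _, fin j i hij.symm hj hi hlt⟩

lemma TwoBranch.star_eq (hr : ∀ a b, r a b → r b a) (hρ : Function.Injective ρ)
    (hSR : S ⊆ R) (hSR' : S' ⊆ R)
    {ystar b₁ b₂ m₁ m₂ ystar' b₁' b₂' m₂' : V}
    (h : TwoBranch r R Y S ρ ystar b₁ b₂ m₁ m₂) (h' : TwoBranch r R Y S' ρ ystar' b₁' b₂' m₁ m₂') :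
    ystar = ystar' := by
  have c1 : CR r R ystar m₁ := by
    obtain ⟨s, hs, hsb⟩ := h.adj₁
    exact ((h.star_conn s hs).symm hr).trans ((CR.single hsb (hSR hs) h.mem₁.1).trans
      (h.conn₁.mono_set Set.sdiff_subset))
  have c2 : CR r R ystar' m₁ := by
    obtain ⟨s, hs, hsb⟩ := h'.adj₁
    exact ((h'.star_conn s hs).symm hr).trans ((CR.single hsb (hSR' hs) h'.mem₁.1).trans
      (h'.conn₁.mono_set Set.sdiff_subset))
  exact hρ (le_antisymm (h'.star_max _ h.star_mem (c2.trans (c1.symm hr)))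
    (h.star_max _ h'.star_mem (c1.trans (c2.symm hr))))

/-- A connected set disjoint from `S` that meets a component of `R \ S` is contained in it. -/
lemma component_of_meet (hSR' : S' ⊆ R)
    (hconn' : ∀ u ∈ S', ∀ v ∈ S', CR r S' u v) (hd : Disjoint S S') {b y : V} (hy : y ∈ S')
    (h : CR r (R \ S) b y) : ∀ y' ∈ S', CR r (R \ S) b y' := fun y' hy' =>
  h.trans ((hconn' y hy y' hy').mono_set fun _ hx =>
    ⟨hSR' hx, fun hxS => Set.disjoint_left.1 hd hxS hx⟩)

lemma TwoBranch.branch₂_avoid (hr : ∀ a b, r a b → r b a) (hS : Trifurcation r R Y S)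
    (hS' : Trifurcation r R Y S') (hd : Disjoint S S')
    {ystar b₁ b₂ m₁ m₂ b₁' b₂' m₂' : V}
    (h : TwoBranch r R Y S ρ ystar b₁ b₂ m₁ m₂) (h' : TwoBranch r R Y S' ρ ystar b₁' b₂' m₁ m₂') :
    ∀ y ∈ S', ¬CR r (R \ S) b₂ y := by
  intro y hy hc
  have hall := component_of_meet hS'.subset hS'.conn hd hy hc
  have inS : ∀ s ∈ S, s ∈ R \ S' := fun s hs =>
    ⟨hS.subset hs, fun hs' => Set.disjoint_left.1 hd hs hs'⟩
  have b1avoid : ∀ y' ∈ S', ¬CR r (R \ S) b₁ y' := fun y' hy' h1 =>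
    h.disj (h1.trans ((hall y' hy').symm hr))
  have hm : CR r (R \ S') b₁ m₁ := h.conn₁.restrict_component b1avoid
  have b1mem : b₁ ∈ R \ S' := ⟨h.mem₁.1, fun hb => b1avoid b₁ hb (CR.refl _)⟩
  obtain ⟨s, hs, hsb⟩ := h.adj₁
  have hsS : CR r (R \ S') s m₁ := (CR.single hsb (inS s hs) b1mem).trans hm
  have sconn : ∀ s' ∈ S, CR r (R \ S') s' s := fun s' hs' => (hS.conn s' hs' s hs).mono_set inS
  have hstar : ∃ s' ∈ S, CR r (R \ S') ystar s' := by
    by_cases hys : ystar ∈ S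
    · exact ⟨ystar, hys, CR.refl _⟩
    · have hav : ∀ y' ∈ S', ¬CR r (R \ S) ystar y' := fun y' hy' h1 =>
        h.star₂ ((hall y' hy').trans (h1.symm hr))
      rcases ((h.star_conn s hs).symm hr).avoid_or_hit hys with h1 | ⟨a, ha, s', hs', hra, haR, -, h1⟩
      · rcases Relation.ReflTransGen.cases_tail h1 with h2 | ⟨_, _, h3⟩
        · exact absurd (h2 ▸ hs) hys
        · exact absurd hs h3.2.2.2
      · exact ⟨s', hs', (h1.restrict_component hav).trans
          (CR.single hra ⟨haR, fun haS => hav a haS h1⟩ (inS s' hs'))⟩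
  obtain ⟨s', hs', hc'⟩ := hstar
  exact h'.star₁ (h'.conn₁.trans (((hc'.trans (sconn s' hs')).trans hsS).symm hr))

lemma TwoBranch.false_of_conn (hr : ∀ a b, r a b → r b a) (hS : Trifurcation r R Y S)
    (hS' : Trifurcation r R Y S') (hd : Disjoint S S')
    {ystar b₁ b₂ m₁ m₂ b₁' b₂' m₂' : V}
    (h : TwoBranch r R Y S ρ ystar b₁ b₂ m₁ m₂) (h' : TwoBranch r R Y S' ρ ystar b₁' b₂' m₁ m₂')
    {s : V} (hs : s ∈ S) (hc : CR r (R \ S') m₁ s) : False := by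
  have hav := h.branch₂_avoid hr hS hS' hd h'
  have inS : ∀ s ∈ S, s ∈ R \ S' := fun s hs =>
    ⟨hS.subset hs, fun hs' => Set.disjoint_left.1 hd hs hs'⟩
  obtain ⟨s', hs', hsb⟩ := h.adj₂
  have h1 : CR r (R \ S') s m₂ := ((hS.conn s hs s' hs').mono_set inS).trans
    ((CR.single hsb (inS s' hs') ⟨h.mem₂.1, fun hb => hav b₂ hb (CR.refl _)⟩).trans
      (h.conn₂.restrict_component hav))
  have := h'.max₁ m₂ h.max_mem₂ (h'.conn₁.trans (hc.trans h1))
  exact absurd h.lt (not_lt.2 this)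

lemma TwoBranch.false (hr : ∀ a b, r a b → r b a) (hS : Trifurcation r R Y S)
    (hS' : Trifurcation r R Y S') (hd : Disjoint S S')
    {ystar b₁ b₂ m₁ m₂ b₁' b₂' m₂' : V}
    (h : TwoBranch r R Y S ρ ystar b₁ b₂ m₁ m₂) (h' : TwoBranch r R Y S' ρ ystar b₁' b₂' m₁ m₂') :
    False := by
  have meet : ∃ s ∈ S, CR r (R \ S') b₁' s := by
    by_contra hno
    push Not at hno
    obtain ⟨s, hs, hsb⟩ := h'.adj₁
    refine h'.false_of_conn hr hS' hS hd.symm h hs ?_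
    have inS : ∀ s ∈ S', s ∈ R \ S := fun s hs =>
      ⟨hS'.subset hs, fun hs' => Set.disjoint_left.1 hd hs' hs⟩
    have hb : b₁' ∈ R \ S := ⟨h'.mem₁.1, fun hb => hno _ hb (CR.refl _)⟩
    exact ((CR.single hsb (inS s hs) hb).trans (h'.conn₁.restrict_component hno)).symm hr
  obtain ⟨s, hs, hc⟩ := meet
  exact h.false_of_conn hr hS hS' hd h' hs ((h'.conn₁.symm hr).trans hc)

/-- Disjoint trifurcations are at most as numerous as the boundary points. -/
lemma card_trifurcation_le [Countable V] (hr : ∀ a b, r a b → r b a) (Zs : Finset Z)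
    (S : Z → Set V) (hS : ∀ z ∈ Zs, Trifurcation r R Y (S z))
    (hd : ∀ z ∈ Zs, ∀ z' ∈ Zs, z ≠ z' → Disjoint (S z) (S z')) : Zs.card ≤ Y.card := by
  obtain ⟨ρ, hρ⟩ := exists_injective_nat V
  rcases Zs.eq_empty_or_nonempty with rfl | ⟨z₀, hz₀⟩
  · simp
  have : Nonempty V := ⟨(hS z₀ hz₀).nonempty.some⟩
  choose! ystar b₁ b₂ m₁ m₂ h using fun z hz => (hS z hz).exists_twoBranch hr hρ
  refine Finset.card_le_card_of_injOn m₁ (fun z hz => (h z hz).max_mem₁) ?_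
  intro z hz z' hz' heq
  by_contra hne
  have h1 := h z hz
  have h2 := h z' hz'
  rw [← show m₁ z = m₁ z' from heq] at h2
  have e := h1.star_eq hr hρ (hS z hz).subset
    (hS z' hz').subset h2
  rw [← e] at h2
  exact h1.false hr (hS z hz) (hS z' hz') (hd z hz z' hz' hne) h2

end Count

/-! ### Infinite-volume limits -/

section Insertion

set_option linter.unusedSectionVars false

variable {α : Type*} [DecidableEq α] {F : Finset α} {w : Finset α → ℝ}

lemma sum_powerset_erase {x : α} (hx : x ∈ F) (g : Finset α → ℝ) :
    ∑ s ∈ F.powerset, g s = ∑ s ∈ (F.erase x).powerset, (g s + g (insert x s)) := by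
  conv_lhs => rw [← Finset.insert_erase hx]
  rw [Finset.sum_powerset_insert (Finset.notMem_erase x F), Finset.sum_add_distrib]

/-- Insertion tolerance. -/
lemma ex_insert_le (hw : ∀ s, 0 < w s) {κ : ℝ} {x : α} (hx : x ∈ F)
    (h : ∀ s ⊆ F, x ∉ s → w s ≤ κ * w (insert x s)) {f : Set α → ℝ} (hf : ∀ s, 0 ≤ f s) :
    ex F w (fun s => f (insert x s)) ≤ (1 + κ) * ex F w (fun s => f s * ind (x ∈ s)) := by
  unfold ex
  rw [← mul_div_assoc, div_le_div_iff_of_pos_right (zsum_pos hw)]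
  unfold wsum
  rw [sum_powerset_erase hx, sum_powerset_erase hx, Finset.mul_sum]
  refine Finset.sum_le_sum fun s hs => ?_
  rw [Finset.mem_powerset] at hs
  have hxs : x ∉ s := fun h => Finset.notMem_erase x F (hs h)
  have h1 := h s (hs.trans (Finset.erase_subset _ _)) hxs
  simp only
  rw [ind_false (by simpa using hxs), ind_true (by simp), Finset.coe_insert,
    Set.insert_idem, mul_zero, mul_zero, zero_add, mul_one]
  have := mul_le_mul_of_nonneg_right h1 (hf (insert x ↑s))
  linarith

/-- Finite energy: each bit is off with probability bounded below. -/
lemma ex_off_ge (hw : ∀ s, 0 < w s) {κ : ℝ} {x : α} (hx : x ∈ F)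
    (h : ∀ s ⊆ F, x ∉ s → w (insert x s) ≤ κ * w s) :
    1 ≤ (1 + κ) * ex F w (fun s => ind (x ∉ s)) := by
  unfold ex
  rw [← mul_div_assoc, le_div_iff₀ (zsum_pos hw), one_mul]
  unfold wsum zsum
  rw [sum_powerset_erase hx, sum_powerset_erase hx, Finset.mul_sum]
  refine Finset.sum_le_sum fun s hs => ?_
  rw [Finset.mem_powerset] at hs
  have hxs : x ∉ s := fun h => Finset.notMem_erase x F (hs h)
  have h1 := h s (hs.trans (Finset.erase_subset _ _)) hxs
  simp only
  rw [ind_true (by simpa using hxs), ind_false (by simp)]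
  linarith

end Insertion

/-- The event `p` depends on finitely many bits. -/
def LocalP {X : Type*} (p : Set X → Prop) : Prop := ∃ G : Finset X, ∀ ω, p ω ↔ p (ω ∩ ↑G)

section LocalP

variable {X : Type*} {p r : Set X → Prop}

lemma LocalP.isLocal (h : LocalP p) : IsLocal fun ω => ind (p ω) := by
  obtain ⟨G, hG⟩ := h
  exact ⟨G, fun ω => ind_congr (hG ω)⟩

lemma LocalP.congr (h : LocalP p) (h' : ∀ ω, r ω ↔ p ω) : LocalP r := by
  obtain ⟨G, hG⟩ := h
  exact ⟨G, fun ω => by rw [h', h', ← hG]⟩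

lemma LocalP.map2 (hp : LocalP p) (hr : LocalP r) (k : Prop → Prop → Prop) :
    LocalP fun ω => k (p ω) (r ω) := by
  obtain ⟨G, hG⟩ := hp
  obtain ⟨H, hH⟩ := hr
  refine ⟨G ∪ H, fun ω => ?_⟩
  have h1 : p ω ↔ p (ω ∩ ↑(G ∪ H)) := by
    rw [hG ω, hG (ω ∩ ↑(G ∪ H)), Set.inter_assoc, Set.inter_eq_right.2 (by simp : (G : Set X) ⊆ ↑(G ∪ H))]
  have h2 : r ω ↔ r (ω ∩ ↑(G ∪ H)) := by
    rw [hH ω, hH (ω ∩ ↑(G ∪ H)), Set.inter_assoc, Set.inter_eq_right.2 (by simp : (H : Set X) ⊆ ↑(G ∪ H))]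
  simp only
  rw [← propext h1, ← propext h2]

lemma LocalP.and (hp : LocalP p) (hr : LocalP r) : LocalP fun ω => p ω ∧ r ω := hp.map2 hr And

lemma LocalP.or (hp : LocalP p) (hr : LocalP r) : LocalP fun ω => p ω ∨ r ω := hp.map2 hr Or

lemma LocalP.not (hp : LocalP p) : LocalP fun ω => ¬p ω := hp.map2 hp fun a _ => ¬a

lemma localP_const (a : Prop) : LocalP fun _ : Set X => a := ⟨∅, fun _ => Iff.rfl⟩

lemma localP_mem (x : X) : LocalP fun ω => x ∈ ω := ⟨{x}, fun ω => by simp⟩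

lemma localP_subset (A : Finset X) : LocalP fun ω => (A : Set X) ⊆ ω := ⟨A, fun ω => by simp⟩

lemma LocalP.exists_finset {ι : Type*} (s : Finset ι) {p : ι → Set X → Prop}
    (h : ∀ i ∈ s, LocalP (p i)) : LocalP fun ω => ∃ i ∈ s, p i ω := by
  induction s using Finset.induction_on with
  | empty => exact (localP_const False).congr (by simp)
  | insert i s hi ih =>
    exact ((h i (by simp)).or (ih fun j hj => h j (by simp [hj]))).congr (by simp)

lemma LocalP.forall_finset {ι : Type*} (s : Finset ι) {p : ι → Set X → Prop}
    (h : ∀ i ∈ s, LocalP (p i)) : LocalP fun ω => ∀ i ∈ s, p i ω :=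
  (LocalP.exists_finset s fun i hi => (h i hi).not).not.congr fun ω => by simp

lemma IsLocal.preimage {f : Set X → ℝ} (hf : IsLocal f) (e : X ≃ X) :
    IsLocal fun ω => f (e ⁻¹' ω) := by
  obtain ⟨G, hG⟩ := hf
  refine ⟨G.map e.toEmbedding, fun ω => ?_⟩
  simp only
  rw [hG (e ⁻¹' ω), hG (e ⁻¹' _)]
  congr 1
  ext x
  simp

lemma LocalP.preimage (hp : LocalP p) (e : X ≃ X) : LocalP fun ω => p (e ⁻¹' ω) := by
  obtain ⟨G, hG⟩ := hp
  refine ⟨G.map e.toEmbedding, fun ω => ?_⟩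
  have : e ⁻¹' (ω ∩ ↑(G.map e.toEmbedding)) ∩ ↑G = e ⁻¹' ω ∩ ↑G := by ext x; simp
  simp only
  rw [hG (e ⁻¹' ω), hG (e ⁻¹' (ω ∩ _)), this]

lemma IsLocal.compl_preimage {f : Set X → ℝ} (hf : IsLocal f) (d : X → X) :
    IsLocal fun ω => f {x | d x ∉ ω} := by
  obtain ⟨G, hG⟩ := hf
  refine ⟨G.image d, fun ω => ?_⟩
  simp only
  rw [hG {x | d x ∉ ω}, hG {x | d x ∉ ω ∩ _}]
  congr 1
  ext x
  simp only [Set.mem_inter_iff, Set.mem_ofPred_eq, Finset.coe_image, Finset.mem_coe, Set.mem_image]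
  grind

lemma LocalP.compl_preimage (hp : LocalP p) (d : X → X) : LocalP fun ω => p {x | d x ∉ ω} := by
  obtain ⟨G, hG⟩ := hp
  refine ⟨G.image d, fun ω => ?_⟩
  have : {x | d x ∉ ω} ∩ ↑G = {x | d x ∉ ω ∩ ↑(G.image d)} ∩ ↑G := by
    ext x
    simp only [Set.mem_inter_iff, Set.mem_ofPred_eq, Finset.coe_image, Finset.mem_coe, Set.mem_image]
    grind
  simp only
  rw [hG {x | d x ∉ ω}, this, ← hG]

lemma LocalP.union (hp : LocalP p) (N : Set X) : LocalP fun ω => p (ω ∪ N) := by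
  obtain ⟨G, hG⟩ := hp
  refine ⟨G, fun ω => ?_⟩
  simp only
  rw [hG (ω ∪ N), hG (ω ∩ ↑G ∪ N), Set.union_inter_distrib_right, Set.union_inter_distrib_right,
    Set.inter_assoc, Set.inter_self]

end LocalP

/-- A sequence of positively associated finite-volume measures with finite energy whose
finite-dimensional distributions converge. -/
structure Model (X : Type*) [DecidableEq X] where
  F : ℕ → Finset X
  w : ℕ → Finset X → ℝ
  pos : ∀ L s, 0 < w L s
  edge : ∀ L, EdgeLe (F L) (w L) (w L)
  exh : ∀ G : Finset X, ∃ L₀, ∀ L ≥ L₀, G ⊆ F L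
  κ : ℝ
  κ_pos : 0 < κ
  energy_up : ∀ L, ∀ x ∈ F L, ∀ s ⊆ F L, x ∉ s → w L (insert x s) ≤ κ * w L s
  energy_dn : ∀ L, ∀ x ∈ F L, ∀ s ⊆ F L, x ∉ s → w L s ≤ κ * w L (insert x s)
  conv : ∀ A : Finset X, ∃ m, Tendsto (fun L => ex (F L) (w L) (cyl A)) atTop (nhds m)

namespace Model

variable {X : Type*} [DecidableEq X] (M : Model X)

/-- The infinite-volume expectation. -/
noncomputable def ev (f : Set X → ℝ) : ℝ := limUnder atTop fun L => ex (M.F L) (M.w L) f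

/-- The infinite-volume probability. -/
noncomputable def P (p : Set X → Prop) : ℝ := M.ev fun ω => ind (p ω)

/-- The infinite-volume covariance. -/
noncomputable def cov (f g : Set X → ℝ) : ℝ := M.ev (fun ω => f ω * g ω) - M.ev f * M.ev g

variable {f g : Set X → ℝ} {p r : Set X → Prop}

lemma tendsto (hf : IsLocal f) :
    Tendsto (fun L => ex (M.F L) (M.w L) f) atTop (nhds (M.ev f)) := by
  suffices h : ∃ m, Tendsto (fun L => ex (M.F L) (M.w L) f) atTop (nhds m) from
    tendsto_nhds_limUnder h
  refine local_induction (P := fun f => ∃ m, Tendsto (fun L => ex (M.F L) (M.w L) f) atTop (nhds m))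
    M.conv ?_ ?_ hf
  · rintro f g ⟨a, ha⟩ ⟨b, hb⟩
    refine ⟨a + b, ?_⟩
    simp only [ex_add]
    exact ha.add hb
  · rintro c f ⟨a, ha⟩
    refine ⟨c * a, ?_⟩
    simp only [ex_smul]
    exact ha.const_mul c

lemma ev_eq {a : ℝ} (h : Tendsto (fun L => ex (M.F L) (M.w L) f) atTop (nhds a)) : M.ev f = a :=
  h.limUnder_eq

lemma ev_add (hf : IsLocal f) (hg : IsLocal g) :
    M.ev (fun ω => f ω + g ω) = M.ev f + M.ev g := by
  apply M.ev_eq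
  simp only [ex_add]
  exact (M.tendsto hf).add (M.tendsto hg)

lemma ev_smul (c : ℝ) (hf : IsLocal f) : M.ev (fun ω => c * f ω) = c * M.ev f := by
  apply M.ev_eq
  simp only [ex_smul]
  exact (M.tendsto hf).const_mul c

lemma ev_sub (hf : IsLocal f) (hg : IsLocal g) :
    M.ev (fun ω => f ω - g ω) = M.ev f - M.ev g := by
  apply M.ev_eq
  simp only [ex_sub]
  exact (M.tendsto hf).sub (M.tendsto hg)

lemma ev_const (c : ℝ) : M.ev (fun _ => c) = c := by
  apply M.ev_eq
  simp only [ex_const (M.pos _)]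
  exact tendsto_const_nhds

lemma ev_sum {ι : Type*} (s : Finset ι) {f : ι → Set X → ℝ} (h : ∀ i ∈ s, IsLocal (f i)) :
    M.ev (fun ω => ∑ i ∈ s, f i ω) = ∑ i ∈ s, M.ev (f i) := by
  induction s using Finset.induction_on with
  | empty => simpa using M.ev_const 0
  | insert i s hi ih =>
    simp only [Finset.sum_insert hi]
    rw [M.ev_add (h i (by simp)) (IsLocal.sum fun j hj => h j (by simp [hj])),
      ih fun j hj => h j (by simp [hj])]

lemma ev_mono (hf : IsLocal f) (hg : IsLocal g) (h : ∀ ω, f ω ≤ g ω) : M.ev f ≤ M.ev g :=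
  le_of_tendsto_of_tendsto' (M.tendsto hf) (M.tendsto hg) fun L => ex_mono (M.pos L) fun _ _ => h _

lemma ev_fkg (hf : IsLocal f) (hg : IsLocal g) (mf : Monotone f) (mg : Monotone g) :
    M.ev f * M.ev g ≤ M.ev fun ω => f ω * g ω :=
  le_of_tendsto_of_tendsto' ((M.tendsto hf).mul (M.tendsto hg)) (M.tendsto (hf.mul hg))
    fun L => fkg (M.pos L) (M.edge L) mf mg

lemma ev_fkg_anti (hf : IsLocal f) (hg : IsLocal g) (mf : Antitone f) (mg : Antitone g) :
    M.ev f * M.ev g ≤ M.ev fun ω => f ω * g ω :=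
  le_of_tendsto_of_tendsto' ((M.tendsto hf).mul (M.tendsto hg)) (M.tendsto (hf.mul hg))
    fun L => fkg_anti (M.pos L) (M.edge L) mf mg

lemma P_mono (hp : LocalP p) (hr : LocalP r) (h : ∀ ω, p ω → r ω) : M.P p ≤ M.P r :=
  M.ev_mono hp.isLocal hr.isLocal fun ω => ind_mono (h ω)

lemma P_congr (h : ∀ ω, p ω ↔ r ω) : M.P p = M.P r := by
  rw [funext fun ω => propext (h ω)]

lemma P_nonneg (hp : LocalP p) : 0 ≤ M.P p := by
  rw [← M.ev_const 0]
  exact M.ev_mono (isLocal_const 0) hp.isLocal fun _ => ind_nonneg _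

lemma P_le_one (hp : LocalP p) : M.P p ≤ 1 := by
  rw [← M.ev_const 1]
  exact M.ev_mono hp.isLocal (isLocal_const 1) fun _ => ind_le_one _

lemma P_not (hp : LocalP p) : M.P (fun ω => ¬p ω) = 1 - M.P p := by
  rw [P, funext fun ω => ind_not (p ω), M.ev_sub (isLocal_const 1) hp.isLocal, M.ev_const]
  rfl

lemma P_or_le (hp : LocalP p) (hr : LocalP r) : M.P (fun ω => p ω ∨ r ω) ≤ M.P p + M.P r := by
  rw [P, P, P, ← M.ev_add hp.isLocal hr.isLocal]
  exact M.ev_mono (hp.or hr).isLocal (hp.isLocal.add hr.isLocal) fun _ => ind_or_le _ _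

lemma P_mul_le_anti (hp : LocalP p) (hr : LocalP r) (mp : ∀ ω ω', ω ⊆ ω' → p ω' → p ω)
    (mr : ∀ ω ω', ω ⊆ ω' → r ω' → r ω) : M.P p * M.P r ≤ M.P fun ω => p ω ∧ r ω := by
  have := M.ev_fkg_anti hp.isLocal hr.isLocal (fun _ _ h => ind_mono (mp _ _ h))
    fun _ _ h => ind_mono (mr _ _ h)
  simp only [← ind_and] at this
  exact this

/-- A lower bound for the probability that a bit is off. -/
noncomputable def c₀ : ℝ := (1 + M.κ)⁻¹

lemma c₀_pos : 0 < M.c₀ := inv_pos.2 (by linarith [M.κ_pos])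

lemma c₀_le_one : M.c₀ ≤ 1 := inv_le_one_of_one_le₀ (by linarith [M.κ_pos])

lemma c₀_le_off (x : X) : M.c₀ ≤ M.P fun ω => x ∉ ω := by
  refine ge_of_tendsto (M.tendsto (localP_mem x).not.isLocal) ?_
  obtain ⟨L₀, hL₀⟩ := M.exh {x}
  filter_upwards [eventually_ge_atTop L₀] with L hL
  have hx : x ∈ M.F L := by simpa using hL₀ L hL
  have := ex_off_ge (M.pos L) hx (M.energy_up L x hx)
  rw [c₀, inv_le_iff_one_le_mul₀' (by linarith [M.κ_pos])]
  exact this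

lemma c₀_pow_le_off (N : Finset X) : M.c₀ ^ N.card ≤ M.P fun ω => ∀ x ∈ N, x ∉ ω := by
  induction N using Finset.induction_on with
  | empty =>
    have : (fun _ : Set X => ind True) = fun _ => (1 : ℝ) := by funext; exact ind_true trivial
    simp [P, this, M.ev_const]
  | insert x N hx ih =>
    have h1 := M.P_mul_le_anti (localP_mem x).not
      (LocalP.forall_finset N fun i _ => (localP_mem i).not)
      (fun _ _ h h' h'' => h' (h h'')) (fun _ _ h h' i hi h'' => h' i hi (h h''))
    have h3 : M.P (fun ω => ∀ j ∈ insert x N, j ∉ ω) = M.P fun ω => x ∉ ω ∧ ∀ j ∈ N, j ∉ ω :=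
      M.P_congr (by simp)
    rw [Finset.card_insert_of_notMem hx, pow_succ', h3]
    exact (mul_le_mul (M.c₀_le_off x) ih (pow_nonneg M.c₀_pos.le _)
      (M.P_nonneg (localP_mem x).not)).trans h1

lemma P_insert_le (hp : LocalP p) (N : Finset X) :
    M.P (fun ω => p (ω ∪ ↑N)) ≤ (1 + M.κ) ^ N.card * M.P fun ω => p ω ∧ ↑N ⊆ ω := by
  induction N using Finset.induction_on generalizing p with
  | empty => simp
  | insert x N hx ih =>
    have h1 : M.P (fun ω => p (insert x ω ∪ ↑N)) ≤
        (1 + M.κ) * M.P fun ω => p (ω ∪ ↑N) ∧ x ∈ ω := by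
      have l1 : LocalP fun ω => p (insert x ω ∪ ↑N) := by
        refine (hp.union ↑(insert x N)).congr fun ω => ?_
        rw [Finset.coe_insert, Set.union_insert, Set.insert_union]
      have l2 := (hp.union ↑N).and (localP_mem x)
      refine le_of_tendsto_of_tendsto (M.tendsto l1.isLocal)
        ((M.tendsto l2.isLocal).const_mul _) ?_
      obtain ⟨L₀, hL₀⟩ := M.exh {x}
      filter_upwards [eventually_ge_atTop L₀] with L hL
      have hxL : x ∈ M.F L := by simpa using hL₀ L hL
      have := ex_insert_le (M.pos L) hxL (M.energy_dn L x hxL) (f := fun ω => ind (p (ω ∪ ↑N)))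
        (fun _ => ind_nonneg _)
      simpa only [ind_and] using this
    have h2 := ih (p := fun ω => p ω ∧ x ∈ ω) (hp.and (localP_mem x))
    have e1 : M.P (fun ω => p (ω ∪ ↑(insert x N))) = M.P fun ω => p (insert x ω ∪ ↑N) :=
      M.P_congr fun ω => by rw [Finset.coe_insert, Set.union_insert, Set.insert_union]
    have e2 : M.P (fun ω => p ω ∧ ↑(insert x N) ⊆ ω) = M.P fun ω => (p ω ∧ x ∈ ω) ∧ ↑N ⊆ ω :=
      M.P_congr fun ω => by rw [Finset.coe_insert, Set.insert_subset_iff, and_assoc]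
    have h3 : M.P (fun ω => p (ω ∪ ↑N) ∧ x ∈ ω) ≤ M.P fun ω => p (ω ∪ ↑N) ∧ x ∈ ω ∪ ↑N :=
      M.P_mono ((hp.union _).and (localP_mem x))
        ((hp.and (localP_mem x)).union _) fun ω h => ⟨h.1, Or.inl h.2⟩
    have hκ : 0 ≤ 1 + M.κ := by linarith [M.κ_pos]
    rw [e1, e2, Finset.card_insert_of_notMem hx, pow_succ', mul_assoc]
    exact h1.trans (mul_le_mul_of_nonneg_left (h3.trans h2) hκ)

/-! #### Covariances -/

lemma cov_comm (f g : Set X → ℝ) : M.cov f g = M.cov g f := by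
  unfold cov
  rw [mul_comm, funext fun ω => mul_comm (f ω) (g ω)]

lemma cov_sub_left {h : Set X → ℝ} (hf : IsLocal f) (hg : IsLocal g) (hh : IsLocal h) :
    M.cov (fun ω => f ω - g ω) h = M.cov f h - M.cov g h := by
  unfold cov
  rw [funext fun ω => sub_mul (f ω) (g ω) (h ω), M.ev_sub (hf.mul hh) (hg.mul hh), M.ev_sub hf hg]
  ring

lemma cov_sum_left {ι : Type*} (s : Finset ι) {f : ι → Set X → ℝ} (hf : ∀ i ∈ s, IsLocal (f i))
    (hg : IsLocal g) : M.cov (fun ω => ∑ i ∈ s, f i ω) g = ∑ i ∈ s, M.cov (f i) g := by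
  unfold cov
  rw [funext fun ω => Finset.sum_mul s (fun i => f i ω) (g ω),
    M.ev_sum s (f := fun i ω => f i ω * g ω) fun i hi => (hf i hi).mul hg, M.ev_sum s hf, Finset.sum_mul,
    Finset.sum_sub_distrib]

lemma cov_sum_right {ι : Type*} (s : Finset ι) {f : ι → Set X → ℝ} (hf : ∀ i ∈ s, IsLocal (f i))
    (hg : IsLocal g) : M.cov g (fun ω => ∑ i ∈ s, f i ω) = ∑ i ∈ s, M.cov g (f i) := by
  rw [cov_comm, M.cov_sum_left s hf hg]
  exact Finset.sum_congr rfl fun i _ => M.cov_comm _ _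

lemma cov_nonneg (hf : IsLocal f) (hg : IsLocal g) (mf : Monotone f) (mg : Monotone g) :
    0 ≤ M.cov f g := sub_nonneg.2 (M.ev_fkg hf hg mf mg)

lemma monotone_count_sub {G : Finset X} (hG : ∀ ω, p ω ↔ p (ω ∩ ↑G)) :
    Monotone fun ω => ∑ x ∈ G, ind (x ∈ ω) - ind (p ω) := by
  intro s t hst
  simp only
  have hle : ∑ x ∈ G, ind (x ∈ s) ≤ ∑ x ∈ G, ind (x ∈ t) :=
    Finset.sum_le_sum fun x _ => ind_mono fun h => hst h
  by_cases h : s ∩ ↑G = t ∩ ↑G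
  · have : ind (p s) = ind (p t) := ind_congr (by rw [hG s, hG t, h])
    linarith
  · obtain ⟨x, hx, hxs⟩ : ∃ x ∈ t ∩ ↑G, x ∉ s ∩ ↑G := by
      by_contra hc
      push Not at hc
      exact h (Set.Subset.antisymm (Set.inter_subset_inter_left _ hst) hc)
    have hxs' : x ∉ s := fun h => hxs ⟨h, hx.2⟩
    have hlt : ∑ x ∈ G, ind (x ∈ s) + 1 ≤ ∑ x ∈ G, ind (x ∈ t) := by
      rw [← Finset.add_sum_erase G _ hx.2, ← Finset.add_sum_erase G _ hx.2, ind_false hxs',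
        ind_true hx.1]
      have : ∑ x ∈ G.erase x, ind (x ∈ s) ≤ ∑ x ∈ G.erase x, ind (x ∈ t) :=
        Finset.sum_le_sum fun x _ => ind_mono fun h => hst h
      linarith
    linarith [ind_nonneg (p s), ind_le_one (p t)]

/-- Newman's covariance inequality for increasing events. -/
lemma cov_le_sum {G H : Finset X} (mp : ∀ ω ω', ω ⊆ ω' → p ω → p ω')
    (hG : ∀ ω, p ω ↔ p (ω ∩ ↑G)) (hH : ∀ ω, r ω ↔ r (ω ∩ ↑H)) :
    M.cov (fun ω => ind (p ω)) (fun ω => ind (r ω)) ≤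
      ∑ x ∈ G, ∑ y ∈ H, M.cov (fun ω => ind (x ∈ ω)) (fun ω => ind (y ∈ ω)) := by
  have lp : LocalP p := ⟨G, hG⟩
  have lr : LocalP r := ⟨H, hH⟩
  have lm : ∀ x : X, IsLocal fun ω : Set X => ind (x ∈ ω) := fun x => (localP_mem x).isLocal
  have lG : IsLocal fun ω : Set X => ∑ x ∈ G, ind (x ∈ ω) := IsLocal.sum fun x _ => lm x
  have lH : IsLocal fun ω : Set X => ∑ x ∈ H, ind (x ∈ ω) := IsLocal.sum fun x _ => lm x
  have mH : Monotone fun ω : Set X => ∑ x ∈ H, ind (x ∈ ω) := fun s t hst =>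
    Finset.sum_le_sum fun x _ => ind_mono fun h => hst h
  have h1 := M.cov_nonneg (lH.sub lr.isLocal) lp.isLocal (monotone_count_sub hH)
    fun _ _ h => ind_mono (mp _ _ h)
  have h2 := M.cov_nonneg (lG.sub lp.isLocal) lH (monotone_count_sub hG) mH
  rw [M.cov_sub_left lH lr.isLocal lp.isLocal] at h1
  rw [M.cov_sub_left lG lp.isLocal lH] at h2
  have e : M.cov (fun ω => ∑ x ∈ G, ind (x ∈ ω)) (fun ω => ∑ y ∈ H, ind (y ∈ ω)) =
      ∑ x ∈ G, ∑ y ∈ H, M.cov (fun ω => ind (x ∈ ω)) (fun ω => ind (y ∈ ω)) := by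
    rw [M.cov_sum_left G (fun x _ => lm x) lH]
    exact Finset.sum_congr rfl fun x _ => M.cov_sum_right H (fun y _ => lm y) (lm x)
  rw [M.cov_comm _ (fun ω => ind (p ω)), M.cov_comm _ (fun ω => ind (p ω))] at h1
  linarith

/-- Invariance of the infinite-volume measure under a permutation of the bits. -/
def Inv (e : X ≃ X) : Prop := ∀ A : Finset X, M.ev (cyl (A.map e.toEmbedding)) = M.ev (cyl A)

lemma ev_preimage {e : X ≃ X} (he : M.Inv e) (hf : IsLocal f) :
    M.ev (fun ω => f (e ⁻¹' ω)) = M.ev f := by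
  suffices h : IsLocal f ∧ M.ev (fun ω => f (e ⁻¹' ω)) = M.ev f from h.2
  refine local_induction (P := fun f => IsLocal f ∧ M.ev (fun ω => f (e ⁻¹' ω)) = M.ev f)
    ?_ ?_ ?_ hf
  · refine fun A => ⟨cyl_local A, ?_⟩
    rw [← he A]
    congr 1
    funext ω
    refine ind_congr ?_
    simp [Set.image_subset_iff]
  · rintro f g ⟨lf, hf⟩ ⟨lg, hg⟩
    refine ⟨lf.add lg, ?_⟩
    rw [M.ev_add lf lg, ← hf, ← hg]
    exact M.ev_add (lf.preimage e) (lg.preimage e)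
  · rintro c f ⟨lf, hf⟩
    refine ⟨lf.smul c, ?_⟩
    rw [M.ev_smul c lf, ← hf]
    exact M.ev_smul c (lf.preimage e)

lemma P_preimage {e : X ≃ X} (he : M.Inv e) (hp : LocalP p) :
    M.P (fun ω => p (e ⁻¹' ω)) = M.P p := by
  unfold P
  exact M.ev_preimage (f := fun ω => ind (p ω)) he hp.isLocal

end Model

/-! ### Non-coexistence for planar self-dual percolation models -/

/-- The column of the sites `(0, y)` with `|y| ≤ m`. -/
def col (m : ℕ) : Set Site := {u | u.1 = 0 ∧ -(m : ℤ) ≤ u.2 ∧ u.2 ≤ m}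

/-- A translation invariant planar percolation model that is dominated by its dual. -/
structure Perc (X : Type*) [DecidableEq X] extends Model X where
  sh : Site → X ≃ X
  iv : X ≃ X
  sh_add : ∀ z z' x, sh (z + z') x = sh z (sh z' x)
  inv_sh : ∀ z, toModel.Inv (sh z)
  inv_iv : toModel.Inv iv
  adj : Set X → Site → Site → Prop
  adj_symm : ∀ ω u v, adj ω u v → adj ω v u
  adj_mono : ∀ ω ω' u v, ω ⊆ ω' → adj ω u v → adj ω' u v
  adj_range : ∀ ω u v, adj ω u v →
    (v.1 ≤ u.1 + 1 ∧ u.1 ≤ v.1 + 1) ∧ (v.2 ≤ u.2 + 1 ∧ u.2 ≤ v.2 + 1)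
  loc : Site → Site → Finset X
  adj_loc : ∀ ω u v, adj ω u v → adj (ω ∩ ↑(loc u v)) u v
  adj_sh : ∀ z ω u v, adj (sh z ⁻¹' ω) u v ↔ adj ω (u + z) (v + z)
  adj_iv : ∀ ω u v, adj (iv ⁻¹' ω) u v ↔ adj ω (-u) (-v)
  dm : X → X
  ev_dual : ∀ f, IsLocal f → Monotone f →
    toModel.ev f ≤ toModel.ev fun ω => f {x | dm x ∉ ω}
  sR : ℤ → X
  sL : ℤ → X
  iv_sR : ∀ y, iv (sR y) = sL (-y)
  decay : ∀ x y, ∀ ε > 0, ∀ᶠ n : ℕ in atTop,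
    toModel.cov (fun ω => ind (x ∈ ω)) (fun ω => ind (sh (0, n) y ∈ ω)) ≤ ε
  ends : ℕ → Finset X
  ends_card : ∀ m, (ends m).card ≤ 4
  exit : ∀ ω (m : ℕ), ∀ u ∈ col m, ∀ v ∉ col m, adj ω u v →
    (∃ y ∈ Finset.Icc (-(m : ℤ)) m, v = (1, y) ∧ sR y ∈ ω) ∨
    (∃ y ∈ Finset.Icc (-(m : ℤ)) m, v = (-1, y) ∧ sL y ∈ ω) ∨ ∃ b ∈ ends m, b ∈ ω
  ins : ℕ → Finset X
  ins_conn : ∀ ω (m : ℕ), ↑(ins m) ⊆ ω → ∀ u ∈ col m, ∀ v ∈ col m, CR (adj ω) (col m) u v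
  ins_adj : ∀ ω (m : ℕ), ↑(ins m) ⊆ ω → ∀ y ∈ Finset.Icc (-(m : ℤ)) m, sR y ∈ ω → adj ω (0, y) (1, y)
  ins_out : ∀ ω (m : ℕ), ∀ u ∉ col m, ∀ v ∉ col m, adj (ω ∪ ↑(ins m)) u v → adj ω u v
  planar : ∀ ω (m M : ℕ) (y₁ w₁ y₂ w₂ : ℤ) (v₁ v₂ : Site), m < M → -(m : ℤ) ≤ y₁ → y₁ < w₁ →
    w₁ < y₂ → y₂ < w₂ → w₂ ≤ m → sR y₁ ∈ ω → sR y₂ ∈ ω →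
    CR (adj ω) (↑(box M) \ col m) (1, y₁) (1, y₂) → dm (sR w₁) ∉ ω → dm (sR w₂) ∉ ω →
    v₁ ∉ box M → v₂ ∉ box M → CR (adj {x | dm x ∉ ω}) (col m)ᶜ (1, w₁) v₁ →
    CR (adj {x | dm x ∉ ω}) (col m)ᶜ (1, w₂) v₂ → False

section SecondMoment

variable {X : Type*} [DecidableEq X] (M : Model X)

/-- The second moment bound. -/
lemma Model.second_moment (k : ℕ) {A : ℕ → Set X → Prop} {θ δ : ℝ} (hA : ∀ i, LocalP (A i))
    (hθ : ∀ i, M.P (A i) = θ) (hδ : 0 ≤ δ)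
    (hc : ∀ i j, i ≠ j → M.cov (fun ω => ind (A i ω)) (fun ω => ind (A j ω)) ≤ δ) :
    M.P (fun ω => ∀ i ∈ Finset.range k, ¬A i ω) * (k * θ) ^ 2 ≤ k + k ^ 2 * δ := by
  set f : Set X → ℝ := fun ω => ∑ i ∈ Finset.range k, ind (A i ω) with hf
  have lf : IsLocal f := IsLocal.sum fun i _ => (hA i).isLocal
  have ef : M.ev f = k * θ := by
    rw [hf, M.ev_sum _ fun i _ => (hA i).isLocal]
    have : ∀ i ∈ Finset.range k, M.ev (fun ω => ind (A i ω)) = θ := fun i _ => hθ i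
    rw [Finset.sum_congr rfl this]
    simp
  have cf : M.cov f f ≤ k + k ^ 2 * δ := by
    rw [hf, M.cov_sum_left _ (fun i _ => (hA i).isLocal) lf]
    have hi : ∀ i ∈ Finset.range k, M.cov (fun ω => ind (A i ω)) f ≤ 1 + k * δ := by
      intro i hi
      rw [hf, M.cov_sum_right _ (fun i _ => (hA i).isLocal) (hA i).isLocal,
        ← Finset.add_sum_erase _ _ hi]
      have h1 : M.cov (fun ω => ind (A i ω)) (fun ω => ind (A i ω)) ≤ 1 := by
        have e : (fun ω => ind (A i ω) * ind (A i ω)) = fun ω => ind (A i ω) := by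
          funext ω; rw [← ind_and, and_self]
        unfold Model.cov
        rw [e]
        have : M.ev (fun ω => ind (A i ω)) ≤ 1 := M.P_le_one (hA i)
        nlinarith [mul_self_nonneg (M.ev fun ω => ind (A i ω))]
      have h2 : ∑ j ∈ (Finset.range k).erase i, M.cov (fun ω => ind (A i ω)) (fun ω => ind (A j ω)) ≤
          ((Finset.range k).erase i).card • δ :=
        Finset.sum_le_card_nsmul _ _ _ fun j hj => hc i j (Finset.ne_of_mem_erase hj).symm
      have h3 : (((Finset.range k).erase i).card : ℝ) ≤ k := by
        exact_mod_cast (Finset.card_erase_le).trans (by simp)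
      rw [nsmul_eq_mul] at h2
      have := mul_le_mul_of_nonneg_right h3 hδ
      linarith
    have := Finset.sum_le_card_nsmul _ _ _ hi
    rw [Finset.card_range, nsmul_eq_mul] at this
    linarith
  have e2 : M.ev (fun ω => f ω * f ω - (2 * (k * θ) * f ω - (k * θ) ^ 2)) = M.cov f f := by
    rw [M.ev_sub (lf.mul lf) ((lf.smul _).sub (isLocal_const _)),
      M.ev_sub (lf.smul _) (isLocal_const _), M.ev_smul _ lf, M.ev_const, Model.cov, ef]
    ring
  have lN : LocalP fun ω => ∀ i ∈ Finset.range k, ¬A i ω :=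
    LocalP.forall_finset _ fun i _ => (hA i).not
  have h3 : M.ev (fun ω => (k * θ) ^ 2 * ind (∀ i ∈ Finset.range k, ¬A i ω)) ≤ M.cov f f := by
    rw [← e2]
    refine M.ev_mono (lN.isLocal.smul _)
      ((lf.mul lf).sub ((lf.smul _).sub (isLocal_const _))) fun ω => ?_
    by_cases h : ∀ i ∈ Finset.range k, ¬A i ω
    · have : f ω = 0 := Finset.sum_eq_zero fun i hi => ind_false (h i hi)
      rw [ind_true h, this]
      linarith
    · rw [ind_false h]
      nlinarith [sq_nonneg (f ω - k * θ)]
  rw [M.ev_smul _ lN.isLocal] at h3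
  rw [mul_comm]
  exact h3.trans cf

end SecondMoment

namespace Perc

variable {X : Type*} [DecidableEq X] (Q : Perc X)

lemma cr_mono {ω ω' : Set X} (h : ω ⊆ ω') {R : Set Site} {u v : Site} (hc : CR (Q.adj ω) R u v) :
    CR (Q.adj ω') R u v := hc.mono' (fun _ _ _ _ => Q.adj_mono _ _ _ _ h) subset_rfl

lemma cr_local {R : Set Site} (hR : R.Finite) :
    ∃ G : Finset X, ∀ ω u v, CR (Q.adj ω) R u v ↔ CR (Q.adj (ω ∩ ↑G)) R u v := by
  refine ⟨(hR.toFinset ×ˢ hR.toFinset).biUnion fun p => Q.loc p.1 p.2, fun ω u v => ⟨fun h => ?_,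
    Q.cr_mono Set.inter_subset_left⟩⟩
  refine h.mono' (fun a ha b hb hab => Q.adj_mono _ _ _ _ ?_ (Q.adj_loc _ _ _ hab)) subset_rfl
  refine Set.inter_subset_inter_right _ ?_
  intro x hx
  simp only [Finset.coe_biUnion, Set.mem_iUnion]
  exact ⟨(a, b), by simp [ha, hb], hx⟩

lemma localP_cr {R : Set Site} (hR : R.Finite) (u v : Site) :
    LocalP fun ω => CR (Q.adj ω) R u v := by
  obtain ⟨G, hG⟩ := Q.cr_local hR
  exact ⟨G, fun ω => hG ω u v⟩

/-- The site `u` is connected inside `R` to the outside of the box of size `K`. -/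
def reach (K : ℕ) (R : Set Site) (u : Site) (ω : Set X) : Prop :=
  ∃ v, v ∉ box K ∧ CR (Q.adj ω) R u v

lemma reach_mono {K : ℕ} {R : Set Site} {u : Site} {ω ω' : Set X} (h : ω ⊆ ω')
    (hr : Q.reach K R u ω) : Q.reach K R u ω' := by
  obtain ⟨v, hv, hc⟩ := hr
  exact ⟨v, hv, Q.cr_mono h hc⟩

lemma localP_reach (K : ℕ) {R : Set Site} (hR : R.Finite) (u : Site) :
    LocalP (Q.reach K R u) := by
  obtain ⟨G, hG⟩ := Q.cr_local hR
  exact ⟨G, fun ω => by unfold reach; simp only [hG ω]⟩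

lemma cr_shift {z : Site} {ω : Set X} {R R' : Set Site} {u v : Site}
    (h : CR (Q.adj (Q.sh z ⁻¹' ω)) R u v) (hR : ∀ a ∈ R, a + z ∈ R') :
    CR (Q.adj ω) R' (u + z) (v + z) :=
  h.map (· + z) (fun a b hab => (Q.adj_sh z ω a b).1 hab) hR

lemma cr_unshift {z : Site} {ω : Set X} {R R' : Set Site} {u v : Site}
    (h : CR (Q.adj ω) R' (u + z) (v + z)) (hR : ∀ a, a + z ∈ R' → a ∈ R) :
    CR (Q.adj (Q.sh z ⁻¹' ω)) R u v := by
  have := h.map (s := Q.adj (Q.sh z ⁻¹' ω)) (R' := R) (· - z)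
    (fun a b hab => (Q.adj_sh z ω _ _).2 (by simpa using hab)) (fun a ha => hR _ (by simpa using ha))
  simpa using this

lemma cr_uninv {ω : Set X} {R R' : Set Site} {u v : Site}
    (h : CR (Q.adj ω) R' (-u) (-v)) (hR : ∀ a, -a ∈ R' → a ∈ R) :
    CR (Q.adj (Q.iv ⁻¹' ω)) R u v := by
  have := h.map (s := Q.adj (Q.iv ⁻¹' ω)) (R' := R) (- ·)
    (fun a b hab => (Q.adj_iv ω _ _).2 (by simpa using hab)) (fun a ha => hR _ (by simpa using ha))
  simpa using this

lemma adj_box {ω : Set X} {u v : Site} {K : ℕ} (h : Q.adj ω u v) (hu : u ∈ box K) :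
    v ∈ box (K + 1) := by
  have := Q.adj_range _ _ _ h
  rw [mem_box] at hu ⊢
  push_cast
  omega

lemma reach_trunc {ω : Set X} {R : Set Site} {u v : Site} {K : ℕ} (hu : u ∈ box K) (hv : v ∉ box K)
    (h : CR (Q.adj ω) R u v) : Q.reach K (R ∩ ↑(box (K + 1))) u ω := by
  obtain ⟨a, ha, b, hb, hab, haR, hbR, hc⟩ := h.first_exit (A := ↑(box K)) hu hv
  have hsub : ((box K : Finset Site) : Set Site) ⊆ ↑(box (K + 1)) := fun x hx => by
    simp only [Finset.mem_coe, mem_box] at hx ⊢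
    push_cast
    omega
  exact ⟨b, hb, (hc.mono_set (Set.inter_subset_inter_right _ hsub)).trans
    (CR.single hab ⟨haR, hsub ha⟩ ⟨hbR, Q.adj_box hab ha⟩)⟩

/-- The probability that the origin is connected to the outside of the box of size `K`. -/
noncomputable def θ (K : ℕ) : ℝ := Q.P (Q.reach K ↑(box (K + 1)) 0)

lemma localP_reach_box (K : ℕ) (u : Site) : LocalP (Q.reach K ↑(box (K + 1)) u) :=
  Q.localP_reach K (Finset.finite_toSet _) u

lemma reach_box_anti {K K' : ℕ} (h : K ≤ K') {ω : Set X} (hr : Q.reach K' ↑(box (K' + 1)) 0 ω) :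
    Q.reach K ↑(box (K + 1)) 0 ω := by
  obtain ⟨v, hv, hc⟩ := hr
  obtain ⟨v', hv', hc'⟩ := Q.reach_trunc (K := K) (mem_box.2 (by simp)) (fun h' => hv (by
    rw [mem_box] at h' ⊢; omega)) hc
  exact ⟨v', hv', hc'.mono_set Set.inter_subset_right⟩

lemma θ_anti : Antitone Q.θ := fun _ _ h =>
  Q.P_mono (Q.localP_reach_box _ _) (Q.localP_reach_box _ _) fun _ => Q.reach_box_anti h

/-- The column is connected to the outside of the box of size `K`. -/
def hit (m K : ℕ) (ω : Set X) : Prop := ∃ u ∈ col m, Q.reach K ↑(box (K + 1)) u ω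

lemma localP_hit (m K : ℕ) : LocalP (Q.hit m K) := by
  obtain ⟨G, hG⟩ := Q.cr_local (R := ↑(box (K + 1))) (Finset.finite_toSet _)
  exact ⟨G, fun ω => by unfold hit reach; simp only [hG ω]⟩

lemma cov_preimage {p r : Set X → Prop} {e : X ≃ X} (he : Q.Inv e) (hp : LocalP p)
    (hr : LocalP r) : Q.cov (fun ω => ind (p (e ⁻¹' ω))) (fun ω => ind (r (e ⁻¹' ω))) =
      Q.cov (fun ω => ind (p ω)) (fun ω => ind (r ω)) := by
  unfold Model.cov
  rw [Q.ev_preimage he hp.isLocal, Q.ev_preimage he hr.isLocal,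
    Q.ev_preimage (f := fun ω => ind (p ω) * ind (r ω)) he (hp.isLocal.mul hr.isLocal)]

lemma sh_preimage (z z' : Site) (ω : Set X) :
    Q.sh (z + z') ⁻¹' ω = Q.sh z' ⁻¹' (Q.sh z ⁻¹' ω) := by
  ext x
  simp [Q.sh_add]

/-- Covariances of far away translates of an increasing event are small. -/
lemma exists_cov_le {p : Set X → Prop} (hp : LocalP p) (mp : ∀ ω ω', ω ⊆ ω' → p ω → p ω') {ε : ℝ}
    (hε : 0 < ε) : ∃ n : ℕ, ∀ i j : ℕ, i ≠ j →
      Q.cov (fun ω => ind (p (Q.sh (0, ((i * n : ℕ) : ℤ)) ⁻¹' ω)))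
        (fun ω => ind (p (Q.sh (0, ((j * n : ℕ) : ℤ)) ⁻¹' ω))) ≤ ε := by
  obtain ⟨G, hG⟩ := hp
  have hp : LocalP p := ⟨G, hG⟩
  have hcard : (0 : ℝ) < G.card * G.card + 1 := by linarith [mul_self_nonneg (G.card : ℝ)]
  set ε' := ε / (G.card * G.card + 1) with hε'
  have hpos : 0 < ε' := div_pos hε hcard
  have hev : ∀ᶠ n : ℕ in atTop, ∀ x ∈ G, ∀ y ∈ G,
      Q.cov (fun ω => ind (x ∈ ω)) (fun ω => ind (Q.sh (0, n) y ∈ ω)) ≤ ε' := by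
    rw [Filter.eventually_all_finset]
    intro x _
    rw [Filter.eventually_all_finset]
    exact fun y _ => Q.decay x y ε' hpos
  obtain ⟨n₀, hn₀⟩ := eventually_atTop.1 hev
  have far : ∀ n ≥ n₀, Q.cov (fun ω => ind (p ω)) (fun ω => ind (p (Q.sh (0, (n : ℤ)) ⁻¹' ω))) ≤ ε := by
    intro n hn
    have hG' : ∀ ω, p (Q.sh (0, (n : ℤ)) ⁻¹' ω) ↔
        p (Q.sh (0, (n : ℤ)) ⁻¹' (ω ∩ ↑(G.map (Q.sh (0, (n : ℤ))).toEmbedding))) := by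
      intro ω
      have : Q.sh (0, (n : ℤ)) ⁻¹' (ω ∩ ↑(G.map (Q.sh (0, (n : ℤ))).toEmbedding)) ∩ ↑G =
        Q.sh (0, (n : ℤ)) ⁻¹' ω ∩ ↑G := by ext x; simp
      rw [hG (_ ⁻¹' ω), hG (_ ⁻¹' (ω ∩ _)), this]
    refine (Q.cov_le_sum mp hG (r := fun ω => p (Q.sh (0, (n : ℤ)) ⁻¹' ω)) hG').trans ?_
    have h1 : ∀ x ∈ G, ∑ y ∈ G.map (Q.sh (0, (n : ℤ))).toEmbedding,
        Q.cov (fun ω => ind (x ∈ ω)) (fun ω => ind (y ∈ ω)) ≤ G.card • ε' := by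
      intro x hx
      rw [Finset.sum_map]
      exact Finset.sum_le_card_nsmul _ _ _ fun y hy => hn₀ n hn x hx y hy
    refine (Finset.sum_le_card_nsmul _ _ _ h1).trans ?_
    rw [nsmul_eq_mul, nsmul_eq_mul, hε', ← mul_assoc, ← mul_div_assoc,
      div_le_iff₀ hcard]
    nlinarith
  have lt : ∀ i j : ℕ, i < j →
      Q.cov (fun ω => ind (p (Q.sh (0, ((i * (n₀ + 1) : ℕ) : ℤ)) ⁻¹' ω)))
        (fun ω => ind (p (Q.sh (0, ((j * (n₀ + 1) : ℕ) : ℤ)) ⁻¹' ω))) ≤ ε := by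
    intro i j hij
    have e : ((0, ((j * (n₀ + 1) : ℕ) : ℤ)) : Site) =
        (0, ((i * (n₀ + 1) : ℕ) : ℤ)) + (0, (((j - i) * (n₀ + 1) : ℕ) : ℤ)) := by
      ext
      · simp
      · push_cast [Nat.cast_sub hij.le]; simp only [Prod.snd_add]; ring
    rw [e]
    simp only [Q.sh_preimage (0, ((i * (n₀ + 1) : ℕ) : ℤ))]
    rw [Q.cov_preimage (r := fun ω => p (Q.sh (0, (((j - i) * (n₀ + 1) : ℕ) : ℤ)) ⁻¹' ω))
      (Q.inv_sh _) hp (hp.preimage _)]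
    refine far _ ?_
    have : 1 ≤ j - i := by omega
    nlinarith
  refine ⟨n₀ + 1, fun i j hij => ?_⟩
  rcases lt_or_gt_of_ne hij with h | h
  · exact lt i j h
  · rw [Q.cov_comm]; exact lt j i h

/-- If the origin percolates, then a long column is very likely connected far away. -/
lemma exists_hit {p ε : ℝ} (hp : 0 < p) (hε : 0 < ε) (hle : ∀ K, p ≤ Q.θ K)
    (hlim : ∀ δ > 0, ∃ K, Q.θ K ≤ p + δ) :
    ∃ m : ℕ, ∀ K, m ≤ K → Q.P (fun ω => ¬Q.hit m K ω) ≤ ε := by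
  have hp1 : p ≤ 1 := (hle 0).trans (Q.P_le_one (Q.localP_reach_box 0 0))
  set δ := ε * p ^ 2 / 2 with hδ
  have hδ0 : 0 < δ := by positivity
  obtain ⟨K₀, hK₀⟩ := hlim (δ / 4) (by positivity)
  have mono : ∀ K (ω ω' : Set X), ω ⊆ ω' → Q.reach K ↑(box (K + 1)) 0 ω →
    Q.reach K ↑(box (K + 1)) 0 ω' := fun K ω ω' h => Q.reach_mono h
  obtain ⟨n, hn⟩ := Q.exists_cov_le (Q.localP_reach_box K₀ 0) (mono K₀) (half_pos hδ0)
  obtain ⟨k, hk⟩ := exists_nat_ge (1 / δ)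
  have hk0 : (0 : ℝ) < k := lt_of_lt_of_le (by positivity) hk
  set m := k * n + K₀ with hm
  refine ⟨m, fun K hK => ?_⟩
  set A : ℕ → Set X → Prop := fun i ω =>
    Q.reach (K + m) ↑(box (K + m + 1)) 0 (Q.sh (0, ((i * n : ℕ) : ℤ)) ⁻¹' ω) with hA
  set A₀ : ℕ → Set X → Prop := fun i ω =>
    Q.reach K₀ ↑(box (K₀ + 1)) 0 (Q.sh (0, ((i * n : ℕ) : ℤ)) ⁻¹' ω) with hA₀
  have lA : ∀ i, LocalP (A i) := fun i => (Q.localP_reach_box (K + m) 0).preimage _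
  have lA₀ : ∀ i, LocalP (A₀ i) := fun i => (Q.localP_reach_box K₀ 0).preimage _
  have pA : ∀ i, Q.P (A i) = Q.θ (K + m) := fun i =>
    Q.P_preimage (Q.inv_sh _) (Q.localP_reach_box (K + m) 0)
  have pA₀ : ∀ i, Q.P (A₀ i) = Q.θ K₀ := fun i =>
    Q.P_preimage (Q.inv_sh _) (Q.localP_reach_box K₀ 0)
  have sub : ∀ i ω, A i ω → A₀ i ω := fun i ω => Q.reach_box_anti (by omega)
  have hθ0 := hle (K + m)
  have hθ1 : Q.θ (K + m) ≤ Q.θ K₀ := Q.θ_anti (by omega)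
  have hθ2 : Q.θ K₀ ≤ 1 := Q.P_le_one (Q.localP_reach_box K₀ 0)
  have cA : ∀ i j, i ≠ j → Q.cov (fun ω => ind (A i ω)) (fun ω => ind (A j ω)) ≤ δ := by
    intro i j hij
    have h0 := hn i j hij
    change Q.cov (fun ω => ind (A₀ i ω)) (fun ω => ind (A₀ j ω)) ≤ δ / 2 at h0
    have h1 : Q.ev (fun ω => ind (A i ω) * ind (A j ω)) ≤
        Q.ev (fun ω => ind (A₀ i ω) * ind (A₀ j ω)) :=
      Q.ev_mono ((lA i).isLocal.mul (lA j).isLocal) ((lA₀ i).isLocal.mul (lA₀ j).isLocal)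
        fun ω => mul_le_mul (ind_mono (sub i ω)) (ind_mono (sub j ω)) (ind_nonneg _) (ind_nonneg _)
    unfold Model.cov at h0 ⊢
    have e1 : Q.ev (fun ω => ind (A i ω)) = Q.θ (K + m) := pA i
    have e2 : Q.ev (fun ω => ind (A j ω)) = Q.θ (K + m) := pA j
    have e3 : Q.ev (fun ω => ind (A₀ i ω)) = Q.θ K₀ := pA₀ i
    have e4 : Q.ev (fun ω => ind (A₀ j ω)) = Q.θ K₀ := pA₀ j
    rw [e1, e2]
    rw [e3, e4] at h0
    have : Q.θ K₀ * Q.θ K₀ - Q.θ (K + m) * Q.θ (K + m) ≤ 2 * (Q.θ K₀ - Q.θ (K + m)) := by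
      nlinarith
    linarith
  have sm := Q.second_moment k lA pA hδ0.le cA
  have lN : LocalP fun ω => ∀ i ∈ Finset.range k, ¬A i ω :=
    LocalP.forall_finset _ fun i _ => (lA i).not
  have hN : Q.P (fun ω => ¬Q.hit m K ω) ≤ Q.P fun ω => ∀ i ∈ Finset.range k, ¬A i ω := by
    refine Q.P_mono (Q.localP_hit m K).not lN fun ω hω i hi hAi => hω ?_
    obtain ⟨v, hv, hc⟩ := hAi
    have hc' := Q.cr_shift (R' := Set.univ) hc fun _ _ => trivial
    rw [zero_add] at hc'
    rw [Finset.mem_range] at hi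
    have hin : i * n ≤ m := (Nat.mul_le_mul_right n hi.le).trans (by omega)
    generalize i * n = t at hin hc'
    refine ⟨(0, (t : ℤ)), ⟨rfl, by simp only; omega, by simp only; omega⟩, ?_⟩
    have hout : v + (0, (t : ℤ)) ∉ box K := fun hb => hv (by
      rw [mem_box] at hb ⊢
      simp only [Prod.fst_add, Prod.snd_add] at hb
      push_cast
      omega)
    have hin' : ((0, (t : ℤ)) : Site) ∈ box K :=
      mem_box.2 ⟨⟨by simp, by simp⟩, by simp only; omega, by simp only; omega⟩
    obtain ⟨v', hv', hc''⟩ := Q.reach_trunc hin' hout hc'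
    exact ⟨v', hv', hc''.mono_set Set.inter_subset_right⟩
  refine hN.trans ?_
  have hpN := Q.P_nonneg lN
  set x := Q.P fun ω => ∀ i ∈ Finset.range k, ¬A i ω
  have h1 : x * (k * p) ^ 2 ≤ x * (k * Q.θ (K + m)) ^ 2 := by gcongr
  have h2 : (k : ℝ) ≤ k ^ 2 * δ := by
    rw [div_le_iff₀ hδ0] at hk
    nlinarith
  have h3 : x * (k * p) ^ 2 ≤ ε * (k * p) ^ 2 := by
    have : ε * (k * p) ^ 2 = 2 * (k ^ 2 * δ) := by rw [hδ]; ring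
    linarith
  exact le_of_mul_le_mul_right h3 (by positivity)

end Perc

/-- The greedy selection of a short initial interval. -/
lemma exists_greedy {D : ℤ → ℤ → ℝ} {η c t : ℝ} (hη0 : 0 < η) (hη1 : η < 1) (hc0 : 0 < c)
    (hc1 : c ≤ 1) (ht : t ≤ 1) (hnn : ∀ a b, 0 ≤ D a b)
    (hempty : ∀ a b, b < a → D a b = 1)
    (hsplit : ∀ a b d, a ≤ d → d ≤ b → D a (d - 1) * c * D (d + 1) b ≤ D a b) {a b : ℤ}
    (h : D a b ≤ t * (η * c)) : ∃ d, a ≤ d ∧ d ≤ b ∧ D a d ≤ η ∧ D (d + 1) b ≤ t := by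
  have hab' : D a b ≤ η := by
    have : t * (η * c) ≤ 1 * (η * 1) := by gcongr
    linarith
  have hab : a ≤ b := by
    by_contra hlt
    rw [hempty a b (by omega)] at hab'
    linarith
  have hne : ((Finset.Icc a b).filter fun d => D a d ≤ η).Nonempty := ⟨b, by simp [hab, hab']⟩
  obtain ⟨d, hd, hmin⟩ := Finset.exists_min_image _ id hne
  simp only [Finset.mem_filter, Finset.mem_Icc, id] at hd hmin
  refine ⟨d, hd.1.1, hd.1.2, hd.2, ?_⟩
  have hlow : η ≤ D a (d - 1) := by
    rcases eq_or_lt_of_le hd.1.1 with h1 | h1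
    · rw [hempty a (d - 1) (by omega)]; exact hη1.le
    · by_contra hlt
      have := hmin (d - 1) ⟨⟨by omega, by omega⟩, by linarith⟩
      omega
  have h1 : η * c * D (d + 1) b ≤ t * (η * c) :=
    (mul_le_mul_of_nonneg_right (mul_le_mul_of_nonneg_right hlow hc0.le) (hnn _ _)).trans
      ((hsplit a b d hd.1.1 hd.1.2).trans h)
  rw [mul_comm t] at h1
  exact le_of_mul_le_mul_left h1 (by positivity)

lemma card_box (M : ℕ) : (box M).card = (2 * M + 1) ^ 2 := by
  rw [box, Finset.card_product, Int.card_Icc, sq]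
  congr 1 <;> omega

lemma card_box_sdiff (n : ℕ) : (box (n + 1) \ box n).card = 8 * (n + 1) := by
  rw [Finset.card_sdiff_of_subset, card_box, card_box]
  · zify [show (2 * n + 1) ^ 2 ≤ (2 * (n + 1) + 1) ^ 2 by gcongr; omega]
    ring
  · intro x
    simp only [mem_box]
    push_cast
    omega

namespace Perc

variable {X : Type*} [DecidableEq X] (Q : Perc X)

/-- An arm from the right side of the column to the outside of the box of size `K`. -/
def armR (m K : ℕ) (y : ℤ) (ω : Set X) : Prop :=
  Q.sR y ∈ ω ∧ Q.reach K (↑(box (K + 1)) \ col m) (1, y) ω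

/-- An arm from the left side of the column to the outside of the box of size `K`. -/
def armL (m K : ℕ) (y : ℤ) (ω : Set X) : Prop :=
  Q.sL y ∈ ω ∧ Q.reach K (↑(box (K + 1)) \ col m) (-1, y) ω

variable {m K : ℕ}

lemma armR_mono {y : ℤ} {ω ω' : Set X} (h : ω ⊆ ω') (ha : Q.armR m K y ω) : Q.armR m K y ω' :=
  ⟨h ha.1, Q.reach_mono h ha.2⟩

lemma localP_armR (m K : ℕ) (y : ℤ) : LocalP (Q.armR m K y) :=
  (localP_mem _).and (Q.localP_reach K ((Finset.finite_toSet _).subset Set.sdiff_subset) _)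

lemma neg_mem_region {a : Site} (ha : -a ∈ (↑(box (K + 1)) \ col m : Set Site)) :
    a ∈ (↑(box (K + 1)) \ col m : Set Site) := by
  simp only [Set.mem_sdiff, Finset.mem_coe, mem_box, col, Set.mem_ofPred_eq, Prod.fst_neg,
    Prod.snd_neg] at ha ⊢
  push_cast at ha ⊢
  omega

lemma armR_of_armL {y : ℤ} {ω : Set X} (h : Q.armL m K (-y) ω) : Q.armR m K y (Q.iv ⁻¹' ω) := by
  obtain ⟨h1, v, hv, hc⟩ := h
  refine ⟨by rw [Set.mem_preimage, Q.iv_sR]; exact h1, -v, ?_, ?_⟩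
  · rw [mem_box] at hv ⊢
    simp only [Prod.fst_neg, Prod.snd_neg]
    omega
  · refine Q.cr_uninv (R' := ↑(box (K + 1)) \ col m) ?_ fun a => neg_mem_region
    simpa using hc

/-- The probability that there is no right arm starting in `J`. -/
noncomputable def noArm (m K : ℕ) (J : Finset ℤ) : ℝ := Q.P fun ω => ∀ y ∈ J, ¬Q.armR m K y ω

lemma localP_noArm (m K : ℕ) (J : Finset ℤ) : LocalP fun ω => ∀ y ∈ J, ¬Q.armR m K y ω :=
  LocalP.forall_finset J fun y _ => (Q.localP_armR m K y).not

lemma noArm_mul_le (J J' : Finset ℤ) :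
    Q.noArm m K J * Q.noArm m K J' ≤ Q.noArm m K (J ∪ J') := by
  refine (Q.P_mul_le_anti (Q.localP_noArm m K J) (Q.localP_noArm m K J')
    (fun _ _ h h' y hy ha => h' y hy (Q.armR_mono h ha))
    (fun _ _ h h' y hy ha => h' y hy (Q.armR_mono h ha))).trans (le_of_eq ?_)
  exact Q.P_congr fun ω => by simp only [Finset.mem_union]; grind

lemma le_noArm_singleton (y : ℤ) : Q.c₀ ≤ Q.noArm m K {y} :=
  (Q.c₀_le_off (Q.sR y)).trans (Q.P_mono (localP_mem _).not (Q.localP_noArm m K {y})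
    fun ω h y' hy' ha => h (by rw [← Finset.mem_singleton.1 hy']; exact ha.1))

lemma noArm_empty : Q.noArm m K ∅ = 1 := by
  have : (fun _ : Set X => ind True) = fun _ => (1 : ℝ) := by funext; exact ind_true trivial
  simp [noArm, Model.P, this, Q.ev_const]

/-- The dual configuration is at least as connected as the primal one. -/
lemma noArm_dual_le (J : Finset ℤ) :
    Q.P (fun ω => ∀ y ∈ J, ¬Q.armR m K y {x | Q.dm x ∉ ω}) ≤ Q.noArm m K J := by
  have l := Q.localP_noArm m K J
  have h := Q.ev_dual (fun ω => ind (¬∀ y ∈ J, ¬Q.armR m K y ω)) l.not.isLocal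
    fun _ _ h => ind_mono fun h1 h2 => h1 fun y hy ha => h2 y hy (Q.armR_mono h ha)
  have h1 := Q.P_not l
  have h2 := Q.P_not (l.compl_preimage Q.dm)
  change Q.P (fun ω => ¬∀ y ∈ J, ¬Q.armR m K y ω) ≤
    Q.P (fun ω => ¬∀ y ∈ J, ¬Q.armR m K y {x | Q.dm x ∉ ω}) at h
  rw [h1, h2] at h
  unfold noArm
  linarith

lemma arm_of_hit (hK : m ≤ K) {ω : Set X} (h : Q.hit m K ω) :
    (∃ y ∈ Finset.Icc (-(m : ℤ)) m, Q.armR m K y ω) ∨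
    (∃ y ∈ Finset.Icc (-(m : ℤ)) m, Q.armL m K y ω) ∨ ∃ b ∈ Q.ends m, b ∈ ω := by
  obtain ⟨u, hu, v, hv, hc⟩ := h
  have hv' : v ∉ col m := fun hc => hv (by
    rw [mem_box]
    simp only [col, Set.mem_ofPred_eq] at hc
    omega)
  obtain ⟨a, ha, b, hb, hab, -, hcb⟩ := hc.last_exit hu hv'
  rcases Q.exit ω m a ha b hb hab with ⟨y, hy, rfl, hs⟩ | ⟨y, hy, rfl, hs⟩ | h
  · exact Or.inl ⟨y, hy, hs, v, hv, hcb⟩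
  · exact Or.inr (Or.inl ⟨y, hy, hs, v, hv, hcb⟩)
  · exact Or.inr (Or.inr h)

lemma noArm_sq_le (hK : m ≤ K) :
    Q.noArm m K (Finset.Icc (-(m : ℤ)) m) ^ 2 * Q.c₀ ^ 4 ≤ Q.P fun ω => ¬Q.hit m K ω := by
  set I := Finset.Icc (-(m : ℤ)) m with hI
  have lR := Q.localP_noArm m K I
  have lR' := lR.preimage Q.iv
  have lE : LocalP fun ω => ∀ x ∈ Q.ends m, x ∉ ω :=
    LocalP.forall_finset _ fun i _ => (localP_mem i).not
  have h1 := Q.P_mul_le_anti lR lR' (fun _ _ h h' y hy ha => h' y hy (Q.armR_mono h ha))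
    (fun _ _ h h' y hy ha => h' y hy (Q.armR_mono (Set.preimage_mono h) ha))
  have h2 := Q.P_mul_le_anti (lR.and lR') lE
    (fun _ _ h h' => ⟨fun y hy ha => h'.1 y hy (Q.armR_mono h ha),
      fun y hy ha => h'.2 y hy (Q.armR_mono (Set.preimage_mono h) ha)⟩)
    (fun _ _ h h' i hi h'' => h' i hi (h h''))
  have h3 : Q.P (fun ω => ((∀ y ∈ I, ¬Q.armR m K y ω) ∧ ∀ y ∈ I, ¬Q.armR m K y (Q.iv ⁻¹' ω)) ∧
      ∀ x ∈ Q.ends m, x ∉ ω) ≤ Q.P fun ω => ¬Q.hit m K ω := by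
    refine Q.P_mono ((lR.and lR').and lE) (Q.localP_hit m K).not fun ω hω hh => ?_
    rcases Q.arm_of_hit hK hh with ⟨y, hy, ha⟩ | ⟨y, hy, ha⟩ | ⟨b, hb, hb'⟩
    · exact hω.1.1 y hy ha
    · refine hω.1.2 (-y) ?_ (Q.armR_of_armL (by rwa [neg_neg]))
      rw [Finset.mem_Icc] at hy ⊢
      omega
    · exact hω.2 b hb hb'
  rw [Q.P_preimage Q.inv_iv lR] at h1
  have h4 := Q.c₀_pow_le_off (Q.ends m)
  have h5 : Q.c₀ ^ 4 ≤ Q.c₀ ^ (Q.ends m).card :=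
    pow_le_pow_of_le_one Q.c₀_pos.le Q.c₀_le_one (Q.ends_card m)
  refine le_trans ?_ (h2.trans h3)
  rw [sq]
  exact mul_le_mul h1 (h5.trans h4) (by have := Q.c₀_pos; positivity) (Q.P_nonneg (lR.and lR'))

/-- Three right arms in pairwise distinct clusters. -/
def three (m K : ℕ) (ω : Set X) : Prop :=
  ∃ y ∈ Fintype.piFinset fun _ : Fin 3 => Finset.Icc (-(m : ℤ)) m,
    ∀ i ∈ Finset.univ, Q.armR m K (y i) ω ∧
      ∀ j ∈ Finset.univ, i ≠ j → ¬CR (Q.adj ω) (↑(box K) \ col m) (1, y i) (1, y j)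

lemma localP_three (m K : ℕ) : LocalP (Q.three m K) := by
  refine LocalP.exists_finset _ fun y _ => LocalP.forall_finset _ fun i _ =>
    (Q.localP_armR m K _).and (LocalP.forall_finset _ fun j _ => ?_)
  by_cases hij : i = j
  · exact (localP_const True).congr (by simp [hij])
  · have h := (Q.localP_cr (R := ↑(box K) \ col m)
      ((Finset.finite_toSet (box K)).subset Set.sdiff_subset) (1, y i) (1, y j)).not
    exact h.congr (by simp [hij])

lemma three_of_arms (hK : m < K) {ω : Set X} {y₁ w₁ y₂ w₂ y₃ w₃ : ℤ} (h0 : -(m : ℤ) ≤ y₁)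
    (h1 : y₁ < w₁) (h2 : w₁ < y₂) (h3 : y₂ < w₂) (h4 : w₂ < y₃) (h5 : y₃ < w₃) (h6 : w₃ ≤ m)
    (a1 : Q.armR m K y₁ ω) (a2 : Q.armR m K y₂ ω) (a3 : Q.armR m K y₃ ω)
    (d1 : Q.armR m K w₁ {x | Q.dm x ∉ ω}) (d2 : Q.armR m K w₂ {x | Q.dm x ∉ ω})
    (d3 : Q.armR m K w₃ {x | Q.dm x ∉ ω}) : Q.three m K ω := by
  have sep : ∀ y w y' w' : ℤ, -(m : ℤ) ≤ y → y < w → w < y' → y' < w' → w' ≤ m →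
      Q.armR m K y ω → Q.armR m K y' ω → Q.armR m K w {x | Q.dm x ∉ ω} →
      Q.armR m K w' {x | Q.dm x ∉ ω} →
      ¬CR (Q.adj ω) (↑(box K) \ col m) (1, y) (1, y') := by
    rintro y w y' w' b0 b1 b2 b3 b4 ha ha' ⟨hd, v, hv, hc⟩ ⟨hd', v', hv', hc'⟩ hcr
    exact Q.planar ω m K y w y' w' v v' hK b0 b1 b2 b3 b4 ha.1 ha'.1 hcr hd hd' hv hv'
      (hc.mono_set fun x hx => hx.2) (hc'.mono_set fun x hx => hx.2)
  have s12 := sep y₁ w₁ y₂ w₂ h0 h1 h2 h3 (by omega) a1 a2 d1 d2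
  have s23 := sep y₂ w₂ y₃ w₃ (by omega) h3 h4 h5 h6 a2 a3 d2 d3
  have s13 := sep y₁ w₁ y₃ w₃ h0 h1 (by omega) h5 h6 a1 a3 d1 d3
  have sy : ∀ {u v : Site}, CR (Q.adj ω) (↑(box K) \ col m) u v →
      CR (Q.adj ω) (↑(box K) \ col m) v u := fun h => h.symm (Q.adj_symm ω)
  refine ⟨![y₁, y₂, y₃], ?_, ?_⟩
  · rw [Fintype.mem_piFinset]
    intro i
    fin_cases i <;> simp <;> omega
  · intro i _
    refine ⟨by fin_cases i <;> assumption, fun j _ hij => ?_⟩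
    fin_cases i <;> fin_cases j <;> first
      | exact absurd rfl hij
      | exact s12
      | exact s23
      | exact s13
      | exact fun h => s12 (sy h)
      | exact fun h => s23 (sy h)
      | exact fun h => s13 (sy h)

lemma half_le_three (hK : m < K)
    (h : Q.noArm m K (Finset.Icc (-(m : ℤ)) m) ≤ (1 / 12 * Q.c₀) ^ 6) :
    1 / 2 ≤ Q.P (Q.three m K) := by
  have hc0 := Q.c₀_pos
  have hc1 := Q.c₀_le_one
  set s := 1 / 12 * Q.c₀ with hs
  have hs0 : 0 ≤ s := by positivity
  have hs1 : s ≤ 1 := by linarith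
  have greedy : ∀ (n : ℕ) (a b : ℤ), Q.noArm m K (Finset.Icc a b) ≤ s ^ (n + 1) →
      ∃ d, a ≤ d ∧ d ≤ b ∧ Q.noArm m K (Finset.Icc a d) ≤ 1 / 12 ∧
        Q.noArm m K (Finset.Icc (d + 1) b) ≤ s ^ n := by
    intro n a b hab
    refine exists_greedy (D := fun a b => Q.noArm m K (Finset.Icc a b)) (by norm_num) (by norm_num)
      hc0 hc1 (pow_le_one₀ hs0 hs1)
      (fun a b => Q.P_nonneg (Q.localP_noArm m K _))
      (fun a b hab => by rw [Finset.Icc_eq_empty (by omega), Q.noArm_empty]) ?_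
      (by rw [← hs, ← pow_succ]; exact hab)
    intro a b d had hdb
    have e : Finset.Icc a b = Finset.Icc a (d - 1) ∪ {d} ∪ Finset.Icc (d + 1) b := by
      ext x; simp only [Finset.mem_union, Finset.mem_Icc, Finset.mem_singleton]; omega
    rw [e]
    refine le_trans ?_ (Q.noArm_mul_le _ _)
    refine mul_le_mul_of_nonneg_right (le_trans ?_ (Q.noArm_mul_le _ _))
      (Q.P_nonneg (Q.localP_noArm m K _))
    exact mul_le_mul_of_nonneg_left (Q.le_noArm_singleton d) (Q.P_nonneg (Q.localP_noArm m K _))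
  obtain ⟨d₁, p1, q1, e1, r1⟩ := greedy 5 _ _ h
  obtain ⟨d₂, p2, q2, e2, r2⟩ := greedy 4 _ _ r1
  obtain ⟨d₃, p3, q3, e3, r3⟩ := greedy 3 _ _ r2
  obtain ⟨d₄, p4, q4, e4, r4⟩ := greedy 2 _ _ r3
  obtain ⟨d₅, p5, q5, e5, r5⟩ := greedy 1 _ _ r4
  obtain ⟨d₆, p6, q6, e6, -⟩ := greedy 0 _ _ r5
  have l := Q.localP_noArm m K
  have l' := fun J => (l J).compl_preimage Q.dm
  have f2 := (Q.noArm_dual_le (Finset.Icc (d₁ + 1) d₂)).trans e2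
  have f4 := (Q.noArm_dual_le (Finset.Icc (d₃ + 1) d₄)).trans e4
  have f6 := (Q.noArm_dual_le (Finset.Icc (d₅ + 1) d₆)).trans e6
  have u1 := Q.P_or_le (l (Finset.Icc (-(m : ℤ)) d₁)) (l' (Finset.Icc (d₁ + 1) d₂))
  have u2 := Q.P_or_le (l (Finset.Icc (d₂ + 1) d₃)) (l' (Finset.Icc (d₃ + 1) d₄))
  have u3 := Q.P_or_le (l (Finset.Icc (d₄ + 1) d₅)) (l' (Finset.Icc (d₅ + 1) d₆))
  have l1 := (l (Finset.Icc (-(m : ℤ)) d₁)).or (l' (Finset.Icc (d₁ + 1) d₂))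
  have l2 := (l (Finset.Icc (d₂ + 1) d₃)).or (l' (Finset.Icc (d₃ + 1) d₄))
  have l3 := (l (Finset.Icc (d₄ + 1) d₅)).or (l' (Finset.Icc (d₅ + 1) d₆))
  have u4 := Q.P_or_le l1 l2
  have u5 := Q.P_or_le (l1.or l2) l3
  have hT : Q.P (fun ω => ¬Q.three m K ω) ≤ _ :=
    Q.P_mono (Q.localP_three m K).not ((l1.or l2).or l3) fun ω hω => by
      by_contra hno
      push Not at hno
      obtain ⟨⟨⟨⟨y₁, hy₁, a1⟩, w₁, hw₁, b1⟩, ⟨y₂, hy₂, a2⟩, w₂, hw₂, b2⟩, ⟨y₃, hy₃, a3⟩,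
        w₃, hw₃, b3⟩ := hno
      rw [Finset.mem_Icc] at hy₁ hw₁ hy₂ hw₂ hy₃ hw₃
      exact hω (Q.three_of_arms hK hy₁.1 (by omega) (by omega) (by omega) (by omega) (by omega)
        (by omega) a1 a2 a3 b1 b2 b3)
  rw [Q.P_not (Q.localP_three m K)] at hT
  unfold noArm at e1 e3 e5
  linarith

/-- A trifurcation at the column. -/
def tri (m K : ℕ) (ω : Set X) : Prop := Q.three m K ω ∧ ↑(Q.ins m) ⊆ ω

lemma localP_tri (m K : ℕ) : LocalP (Q.tri m K) := (Q.localP_three m K).and (localP_subset _)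

lemma three_union_ins {ω : Set X} (h : Q.three m K ω) : Q.three m K (ω ∪ ↑(Q.ins m)) := by
  obtain ⟨y, hy, h⟩ := h
  refine ⟨y, hy, fun i hi => ⟨Q.armR_mono Set.subset_union_left (h i hi).1, fun j hj hij hc => ?_⟩⟩
  exact (h i hi).2 j hj hij
    (hc.mono' (fun a ha b hb => Q.ins_out ω m a ha.2 b hb.2) subset_rfl)

lemma le_P_tri (h : 1 / 2 ≤ Q.P (Q.three m K)) :
    1 / 2 ≤ (1 + Q.κ) ^ (Q.ins m).card * Q.P (Q.tri m K) :=
  h.trans ((Q.P_mono (Q.localP_three m K) ((Q.localP_three m K).union _)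
    fun _ => Q.three_union_ins).trans (Q.P_insert_le (Q.localP_three m K) (Q.ins m)))

lemma trifurcation_of_tri {n : ℕ} (hKn : K = 2 * (n + 1)) {ω : Set X} {z : Site}
    (hz : (0 ≤ z.1 ∧ z.1 + 1 ≤ n) ∧ (0 ≤ z.2 ∧ z.2 + m ≤ n)) (h : Q.tri m K (Q.sh z ⁻¹' ω)) :
    Trifurcation (Q.adj ω) ↑(box (n + 1)) (box (n + 1) \ box n) {u | u - z ∈ col m} := by
  obtain ⟨⟨y, hy, hy'⟩, hins⟩ := h
  rw [Fintype.mem_piFinset] at hy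
  refine ⟨⟨z, by simp [col]⟩, fun u hu => ?_, fun u hu v hv => ?_, fun i => (1, y i) + z,
    fun i => ⟨?_, ⟨(0, y i) + z, ?_, ?_⟩, ?_⟩, fun i j hij hc => ?_⟩
  · simp only [col, Set.mem_ofPred_eq, Prod.fst_sub, Prod.snd_sub, Finset.mem_coe, mem_box] at hu ⊢
    push_cast
    omega
  · have := Q.cr_shift (R' := {u | u - z ∈ col m}) (Q.ins_conn _ m hins (u - z) hu (v - z) hv)
      fun a ha => by simpa using ha
    simpa using this
  · have := Finset.mem_Icc.1 (hy i)
    simp only [col, Set.mem_sdiff, Set.mem_ofPred_eq, Prod.fst_sub, Prod.snd_sub, Prod.fst_add,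
      Prod.snd_add, Finset.mem_coe, mem_box]
    push_cast
    omega
  · have := Finset.mem_Icc.1 (hy i)
    change (0, y i) + z - z ∈ col m
    rw [add_sub_cancel_right]
    exact ⟨rfl, this⟩
  · exact (Q.adj_sh z ω _ _).1 (Q.ins_adj _ m hins (y i) (hy i) (hy' i (by simp)).1.1)
  · obtain ⟨v, hv, hc⟩ := (hy' i (by simp)).1.2
    have hc' := Q.cr_shift (R' := {u | u - z ∈ col m}ᶜ) hc fun a ha => by simpa using ha.2
    have hb := Finset.mem_Icc.1 (hy i)
    obtain ⟨a, ha, b, hb, hab, -, -, hca⟩ := hc'.first_exit (A := ↑(box (n + 1)))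
      (by
        simp only [Prod.fst_add, Prod.snd_add, Finset.mem_coe, mem_box]
        push_cast
        omega)
      (by
        simp only [Prod.fst_add, Prod.snd_add, Finset.mem_coe, mem_box] at hv ⊢
        push_cast at hv ⊢
        omega)
    refine ⟨a, ?_, hca.mono_set fun x hx => ⟨hx.2, hx.1⟩⟩
    rw [Finset.mem_sdiff]
    exact ⟨ha, fun ha' => hb (Q.adj_box hab ha')⟩
  · refine (hy' i (by simp)).2 j (by simp) hij (Q.cr_unshift hc fun a ha => ?_)
    simp only [col, Set.mem_sdiff, Set.mem_ofPred_eq, Prod.fst_sub, Prod.snd_sub, Prod.fst_add,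
      Prod.snd_add, Finset.mem_coe, mem_box, add_sub_cancel_right] at ha ⊢
    push_cast at ha ⊢
    omega

/-- **Non-coexistence**: the origin does not percolate. -/
theorem tendsto_θ : Tendsto Q.θ atTop (nhds 0) := by
  have hbdd : BddBelow (Set.range Q.θ) :=
    ⟨0, by rintro _ ⟨K, rfl⟩; exact Q.P_nonneg (Q.localP_reach_box K 0)⟩
  have hlim := tendsto_atTop_ciInf Q.θ_anti hbdd
  set p := ⨅ K, Q.θ K with hp
  have hle : ∀ K, p ≤ Q.θ K := fun K => ciInf_le hbdd K
  have hp0 : 0 ≤ p := le_ciInf fun K => Q.P_nonneg (Q.localP_reach_box K 0)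
  rcases hp0.eq_or_lt with h0 | h0
  · rwa [← h0] at hlim
  exfalso
  have hc0 := Q.c₀_pos
  set s := (1 / 12 * Q.c₀) ^ 6 with hs
  have hs0 : 0 < s := by positivity
  obtain ⟨m, hm⟩ := Q.exists_hit h0 (ε := s ^ 2 * Q.c₀ ^ 4) (by positivity) hle fun δ hδ =>
    ((hlim.eventually (gt_mem_nhds (by linarith : p < p + δ))).exists).imp fun K h => h.le
  have hthree : ∀ K, m < K → 1 / 2 ≤ Q.P (Q.three m K) := by
    intro K hK
    refine Q.half_le_three hK (abs_le_of_sq_le_sq' ?_ hs0.le).2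
    exact le_of_mul_le_mul_right ((Q.noArm_sq_le hK.le).trans (hm K hK.le)) (by positivity)
  have hκ : (0 : ℝ) < (1 + Q.κ) ^ (Q.ins m).card := pow_pos (by linarith [Q.κ_pos]) _
  set C := (1 + Q.κ) ^ (Q.ins m).card with hC
  obtain ⟨k, hk⟩ := exists_nat_gt (32 * (m + 1) * C)
  have hk0 : 0 < k := by
    have : (0 : ℝ) < k := lt_of_le_of_lt (by positivity) hk
    exact_mod_cast this
  obtain ⟨n, hn⟩ : ∃ n, n + 1 = (2 * m + 2) * k := ⟨(2 * m + 2) * k - 1, by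
    have : 0 < (2 * m + 2) * k := by positivity
    omega⟩
  set K := 2 * (n + 1) with hK
  have hmK : m < K := by nlinarith
  set z : ℕ × ℕ → Site := fun p => ((p.1 : ℤ), ((p.2 * (2 * m + 1) : ℕ) : ℤ)) with hz
  set grid := Finset.range k ×ˢ Finset.range k with hgrid
  have hcount : ∀ ω, ∑ p ∈ grid, ind (Q.tri m K (Q.sh (z p) ⁻¹' ω)) ≤ 8 * (n + 1) := by
    intro ω
    have e : ∑ p ∈ grid, ind (Q.tri m K (Q.sh (z p) ⁻¹' ω)) =
        ((grid.filter fun p => Q.tri m K (Q.sh (z p) ⁻¹' ω)).card : ℝ) := by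
      rw [Finset.card_filter]
      push_cast
      rfl
    rw [e]
    have := card_trifurcation_le (r := Q.adj ω) (R := ↑(box (n + 1))) (Y := box (n + 1) \ box n)
      (Q.adj_symm ω) (grid.filter fun p => Q.tri m K (Q.sh (z p) ⁻¹' ω))
      (fun p => {u | u - z p ∈ col m}) ?_ ?_
    · rw [card_box_sdiff] at this
      exact_mod_cast this
    · intro p hp
      simp only [hgrid, Finset.mem_filter, Finset.mem_product, Finset.mem_range] at hp
      refine Q.trifurcation_of_tri hK ?_ hp.2
      have h1 : p.2 * (2 * m + 1) + m ≤ n := by nlinarith [hp.1.2]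
      have h2 : p.1 + 1 ≤ n := by nlinarith [hp.1.1]
      simp only [hz]
      omega
    · intro p _ p' _ hne
      rw [Set.disjoint_left]
      intro u hu hu'
      simp only [hz, col, Set.mem_ofPred_eq, Prod.fst_sub, Prod.snd_sub] at hu hu'
      refine hne (Prod.ext (by omega) ?_)
      obtain ⟨-, h1, h2⟩ := hu
      obtain ⟨-, h3, h4⟩ := hu'
      push_cast at h1 h2 h3 h4
      have h5 : (p.2 : ℤ) < p'.2 + 1 := by nlinarith
      have h6 : (p'.2 : ℤ) < p.2 + 1 := by nlinarith
      omega
  have l : ∀ p, IsLocal fun ω => ind (Q.tri m K (Q.sh (z p) ⁻¹' ω)) := fun p =>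
    ((Q.localP_tri m K).preimage _).isLocal
  have hsum : Q.ev (fun ω => ∑ p ∈ grid, ind (Q.tri m K (Q.sh (z p) ⁻¹' ω))) =
      k * k * Q.P (Q.tri m K) := by
    rw [Q.ev_sum grid fun p _ => l p]
    have : ∀ p ∈ grid, Q.ev (fun ω => ind (Q.tri m K (Q.sh (z p) ⁻¹' ω))) = Q.P (Q.tri m K) :=
      fun p _ => Q.P_preimage (Q.inv_sh (z p)) (Q.localP_tri m K)
    rw [Finset.sum_congr rfl this, Finset.sum_const, hgrid, Finset.card_product, Finset.card_range,
      nsmul_eq_mul]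
    push_cast
    ring
  have hfin : (k : ℝ) * k * Q.P (Q.tri m K) ≤ 8 * (n + 1) := by
    rw [← hsum, ← Q.ev_const (8 * (n + 1))]
    exact Q.ev_mono (IsLocal.sum fun p _ => l p) (isLocal_const _) hcount
  have htri := Q.le_P_tri (hthree K hmK)
  have hn' : ((n : ℝ) + 1) = (2 * m + 2) * k := by exact_mod_cast hn
  rw [hn'] at hfin
  have hkr : (0 : ℝ) < k := by exact_mod_cast hk0
  have h1 : (k : ℝ) * Q.P (Q.tri m K) ≤ 8 * (2 * m + 2) := by
    refine le_of_mul_le_mul_left ?_ hkr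
    linarith
  have h2 : (k : ℝ) * (1 / 2) ≤ C * (8 * (2 * m + 2)) :=
    calc (k : ℝ) * (1 / 2) ≤ k * (C * Q.P (Q.tri m K)) := by gcongr
      _ = C * (k * Q.P (Q.tri m K)) := by ring
      _ ≤ _ := by gcongr
  linarith

end Perc

/-! ### Random-cluster weights -/

/-- The edges with both endpoints in `B`. -/
noncomputable def edgesIn (B : Finset Site) : Finset Edge :=
  (B ×ˢ Finset.univ).filter fun e => tgt e ∈ B

lemma mem_edgesIn {B : Finset Site} {e : Edge} : e ∈ edgesIn B ↔ src e ∈ B ∧ tgt e ∈ B := by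
  simp [edgesIn, src]

lemma edgesIn_mono {B B' : Finset Site} (h : B ⊆ B') : edgesIn B ⊆ edgesIn B' := by
  intro e
  rw [mem_edgesIn, mem_edgesIn]
  exact fun he => ⟨h he.1, h he.2⟩

lemma box_mono {L L' : ℕ} (h : L ≤ L') : box L ⊆ box L' := by
  intro x
  rw [mem_box, mem_box]
  omega

/-- The random-cluster weight with edge weight `p`, cluster weight `c` and wired cluster
weight `d`. -/
noncomputable def wt (p c d : ℝ) (C : Set Site) (ω : Finset Edge) : ℝ :=
  p ^ ω.card / (c ^ rk ∅ ω * d ^ rk C ω)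

/-- The factor gained by opening an edge. -/
noncomputable def fac (p c d : ℝ) (C : Set Site) (ω : Set Edge) (e : Edge) : ℝ :=
  p / (c ^ dr ∅ ω e * d ^ dr C ω e)

section Weights

variable {p c d p' c' d' : ℝ} {C C' : Set Site}

lemma wt_pos (hp : 0 < p) (hc : 0 < c) (hd : 0 < d) (ω : Finset Edge) : 0 < wt p c d C ω := by
  unfold wt; positivity

lemma wt_insert {ω : Finset Edge} {e : Edge} (he : e ∉ ω) :
    wt p c d C (insert e ω) = wt p c d C ω * fac p c d C ω e := by
  unfold wt fac
  rw [Finset.card_insert_of_notMem he, rk_insert, rk_insert, pow_succ, pow_add, pow_add,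
    div_mul_div_comm]
  congr 1
  ring

lemma fac_mono (hp : 0 < p) (hc : 1 ≤ c) (hd : 1 ≤ d) {ω η : Set Edge} (h : ω ⊆ η) (e : Edge) :
    fac p c d C ω e ≤ fac p c d C η e := by
  unfold fac
  have h1 := dr_anti (subset_refl (∅ : Set Site)) h e
  have h2 := dr_anti (subset_refl C) h e
  gcongr

lemma edgeLe_of_ratio {α : Type*} [DecidableEq α] {F : Finset α} {w₁ w₂ : Finset α → ℝ}
    (hw₁ : ∀ s, 0 < w₁ s) (hw₂ : ∀ s, 0 < w₂ s)
    (h : ∀ s t e, s ⊆ t → t ⊆ F → e ∈ F → e ∉ t →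
      ∃ a, w₁ (insert e s) ≤ a * w₁ s ∧ a * w₂ t ≤ w₂ (insert e t)) : EdgeLe F w₁ w₂ := by
  intro s t e hst htF heF het
  obtain ⟨a, h1, h2⟩ := h s t e hst htF heF het
  calc _ ≤ a * w₁ s * w₂ t := mul_le_mul_of_nonneg_right h1 (hw₂ t).le
    _ = w₁ s * (a * w₂ t) := by ring
    _ ≤ _ := mul_le_mul_of_nonneg_left h2 (hw₁ s).le

lemma edgeLe_wt (hp : 0 < p) (hc : 1 ≤ c) (hd : 1 ≤ d) (F : Finset Edge) :
    EdgeLe F (wt p c d C) (wt p c d C) := by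
  refine edgeLe_of_ratio (fun s => wt_pos hp (by linarith) (by linarith) s)
    (fun s => wt_pos hp (by linarith) (by linarith) s) fun s t e hst _ _ het =>
    ⟨fac p c d C s e, ?_, ?_⟩
  · rw [wt_insert (fun h => het (hst h)), mul_comm]
  · rw [wt_insert het, mul_comm]
    exact mul_le_mul_of_nonneg_left (fac_mono hp hc hd (by exact_mod_cast hst) e)
      (wt_pos hp (by linarith) (by linarith) t).le

end Weights

/-- The dual of a configuration. -/
def dual (ω : Set Edge) : Set Edge := {e | dl e ∉ ω}

lemma dual_anti {ω ω' : Set Edge} (h : ω ⊆ ω') : dual ω' ⊆ dual ω := fun _ he he' => he (h he')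

/-- The law of the dual configuration. -/
lemma ex_dual (T : Finset Edge) (w : Finset Edge → ℝ) {f : Set Edge → ℝ} (hf : DepOn ↑T f) :
    ex (T.map dl.toEmbedding) w (fun ω => f (dual ω)) =
      ex T (fun s => w ((T \ s).map dl.toEmbedding)) f := by
  refine ex_bij (F := T) (fun s => (T \ s).map dl.toEmbedding) (fun t => T \ t.map dl.symm.toEmbedding)
    1 one_pos ?_ ?_ ?_ ?_ ?_ ?_
  · exact fun s _ => Finset.map_subset_map.2 Finset.sdiff_subset
  · exact fun t _ => Finset.sdiff_subset
  · intro s hs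
    ext e
    simp only [Finset.mem_sdiff, Finset.mem_map_equiv, Equiv.symm_symm, Equiv.symm_apply_apply]
    have := @hs e
    tauto
  · intro t ht
    ext e
    have := @ht e
    simp only [Finset.mem_sdiff, Finset.mem_map_equiv, Equiv.symm_symm,
      Equiv.apply_symm_apply] at this ⊢
    tauto
  · intro s _; rw [one_mul]
  · intro s hs
    rw [hf]
    congr 1
    ext e
    have := @hs e
    simp only [dual, Set.mem_inter_iff, Set.mem_ofPred_eq, Finset.mem_coe, Finset.mem_map_equiv,
      Finset.mem_sdiff, Equiv.symm_apply_apply] at this ⊢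
    tauto

/-! ### Lattice symmetries -/

/-- The edge permutation `g` is induced by the site permutation `τ`. -/
def LatSym (g : Edge ≃ Edge) (τ : Site ≃ Site) : Prop :=
  ∀ e, (src (g e) = τ (src e) ∧ tgt (g e) = τ (tgt e)) ∨
    (src (g e) = τ (tgt e) ∧ tgt (g e) = τ (src e))

section LatSym

variable {g : Edge ≃ Edge} {τ : Site ≃ Site} {C : Set Site}

lemma latSym_shE (z : Site) : LatSym (shE z) (Equiv.addRight z) :=
  fun e => Or.inl ⟨src_shE z e, tgt_shE z e⟩

lemma latSym_ivE : LatSym ivE (Equiv.neg Site) := fun e => Or.inr ⟨src_ivE e, tgt_ivE e⟩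

lemma LatSym.symm (h : LatSym g τ) : LatSym g.symm τ.symm := by
  intro e
  have := h (g.symm e)
  rw [g.apply_symm_apply] at this
  rcases this with ⟨h1, h2⟩ | ⟨h1, h2⟩
  · exact Or.inl ⟨by rw [h1, τ.symm_apply_apply], by rw [h2, τ.symm_apply_apply]⟩
  · exact Or.inr ⟨by rw [h2, τ.symm_apply_apply], by rw [h1, τ.symm_apply_apply]⟩

lemma LatSym.cn_map (h : LatSym g τ) {ω : Set Edge} {u v : Site} (hc : Cn C ω u v) :
    Cn (τ '' C) (g '' ω) (τ u) (τ v) := by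
  have key : ∀ a b, Cn (τ '' C) (g '' ω) (τ a) (τ b) →
      (Cn (τ '' C) (g '' ω) (τ u) (τ a)) = (Cn (τ '' C) (g '' ω) (τ u) (τ b)) := fun a b hab =>
    propext ⟨fun h => h.trans hab, fun h => h.trans hab.symm⟩
  have := hc.eq_of (f := fun y => Cn (τ '' C) (g '' ω) (τ u) (τ y))
    (fun e he => key _ _ (by
      have hh : Cn (τ '' C) (g '' ω) (src (g e)) (tgt (g e)) := .of_edge (Set.mem_image_of_mem g he)
      rcases h e with ⟨h1, h2⟩ | ⟨h1, h2⟩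
      · rwa [h1, h2] at hh
      · rw [h1, h2] at hh; exact hh.symm))
    fun a ha b hb => key _ _ (.of_wired (Set.mem_image_of_mem τ ha) (Set.mem_image_of_mem τ hb))
  exact (Eq.mp this) (.refl _)

lemma LatSym.rk_map_le (h : LatSym g τ) (ω : Finset Edge) :
    rk (τ '' C) (ω.map g.toEmbedding) ≤ rk C ω := by
  induction ω using Finset.induction_on with
  | empty => simp [rk_empty]
  | insert e ω _ ih =>
    rw [Finset.map_insert, rk_insert, rk_insert]
    refine add_le_add ih ?_
    unfold dr
    by_cases hc : Cn C ω (src e) (tgt e)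
    · have := h.cn_map hc
      rw [Finset.coe_map, if_pos]
      · exact Nat.zero_le _
      · change Cn (τ '' C) (g '' ω) (src (g e)) (tgt (g e))
        rcases h e with ⟨h1, h2⟩ | ⟨h1, h2⟩
        · rwa [h1, h2]
        · rw [h1, h2]; exact this.symm
    · rw [if_neg hc]
      split_ifs <;> simp

lemma LatSym.rk_map (h : LatSym g τ) (ω : Finset Edge) :
    rk (τ '' C) (ω.map g.toEmbedding) = rk C ω := by
  refine le_antisymm (h.rk_map_le ω) ?_
  have := h.symm.rk_map_le (C := τ '' C) (ω.map g.toEmbedding)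
  rw [Finset.map_map] at this
  have e : g.toEmbedding.trans g.symm.toEmbedding = Function.Embedding.refl _ := by
    ext1 x; simp
  rwa [e, Finset.map_refl, Equiv.symm_image_image] at this

lemma LatSym.wt_map (h : LatSym g τ) (p c d : ℝ) (ω : Finset Edge) :
    wt p c d (τ '' C) (ω.map g.toEmbedding) = wt p c d C ω := by
  unfold wt
  have := h.rk_map (C := ∅) ω
  rw [Set.image_empty] at this
  rw [h.rk_map, this, Finset.card_map]

lemma LatSym.edgesIn_map (h : LatSym g τ) (B : Finset Site) :
    (edgesIn B).map g.toEmbedding = edgesIn (B.map τ.toEmbedding) := by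
  ext e
  have := h (g.symm e)
  rw [g.apply_symm_apply] at this
  simp only [Finset.mem_map_equiv, mem_edgesIn]
  rcases this with ⟨h1, h2⟩ | ⟨h1, h2⟩ <;> rw [h1, h2] <;> simp [and_comm]

end LatSym

lemma ex_map {α : Type*} [DecidableEq α] (g : α ≃ α) {F : Finset α} {w w' : Finset α → ℝ}
    (hw : ∀ s ⊆ F, w' (s.map g.toEmbedding) = w s) {f f' : Set α → ℝ}
    (hf : ∀ s : Finset α, f' (g '' ↑s) = f ↑s) :
    ex (F.map g.toEmbedding) w' f' = ex F w f := by
  refine ex_bij (F := F) (fun s => s.map g.toEmbedding) (fun t => t.map g.symm.toEmbedding)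
    1 one_pos ?_ ?_ ?_ ?_ ?_ ?_
  · exact fun s hs => Finset.map_subset_map.2 hs
  · intro t ht x hx
    have := ht (Finset.mem_map_equiv.1 hx)
    simpa using this
  · intro s _; ext; simp
  · intro s _; ext; simp
  · intro s hs; rw [hw s hs, one_mul]
  · intro s _
    rw [Finset.coe_map]
    exact hf s

lemma cyl_map {α : Type*} [DecidableEq α] (g : α ≃ α) (A : Finset α) (s : Set α) :
    cyl (A.map g.toEmbedding) (g '' s) = cyl A s := by
  refine ind_congr ?_
  rw [Finset.coe_map]
  exact Set.image_subset_image_iff g.injective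

namespace Model

variable {X : Type*} [DecidableEq X] (M : Model X)

lemma inv_of {g : X ≃ X} (h : ∃ k, ∀ A, ∃ L₀, ∀ L ≥ L₀, ex (M.F L) (M.w L) (cyl A) ≤
      ex (M.F (L + k)) (M.w (L + k)) (cyl (A.map g.toEmbedding)))
    (h' : ∃ k, ∀ A, ∃ L₀, ∀ L ≥ L₀, ex (M.F L) (M.w L) (cyl A) ≤
      ex (M.F (L + k)) (M.w (L + k)) (cyl (A.map g.symm.toEmbedding))) : M.Inv g := by
  have key : ∀ g : X ≃ X, (∃ k, ∀ A, ∃ L₀, ∀ L ≥ L₀, ex (M.F L) (M.w L) (cyl A) ≤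
      ex (M.F (L + k)) (M.w (L + k)) (cyl (A.map g.toEmbedding))) → ∀ A,
      M.ev (cyl A) ≤ M.ev (cyl (A.map g.toEmbedding)) := by
    rintro g ⟨k, h⟩ A
    obtain ⟨L₀, hL⟩ := h A
    refine le_of_tendsto_of_tendsto (M.tendsto (cyl_local A))
      ((tendsto_add_atTop_iff_nat k).2 (M.tendsto (cyl_local (A.map g.toEmbedding)))) ?_
    filter_upwards [eventually_ge_atTop L₀] with L hL' using hL L hL'
  intro A
  refine le_antisymm ?_ (key g h A)
  have := key g.symm h' (A.map g.toEmbedding)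
  rw [Finset.map_map] at this
  have e : g.toEmbedding.trans g.symm.toEmbedding = Function.Embedding.refl _ := by
    ext1 x; simp
  rwa [e, Finset.map_refl] at this

end Model

lemma exists_box_map_shift (z : Site) :
    ∃ k, ∀ L, (box L).map (Equiv.addRight z).toEmbedding ⊆ box (L + k) := by
  refine ⟨z.1.natAbs + z.2.natAbs, fun L x hx => ?_⟩
  rw [Finset.mem_map_equiv, mem_box] at hx
  rw [mem_box]
  simp only [Equiv.addRight_symm, Equiv.coe_addRight, Prod.fst_add, Prod.snd_add, Prod.fst_neg,
    Prod.snd_neg] at hx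
  rw [Nat.cast_add, Nat.cast_add]
  omega

lemma box_map_neg (L : ℕ) : (box L).map (Equiv.neg Site).toEmbedding = box L := by
  ext x
  rw [Finset.mem_map_equiv, mem_box, mem_box]
  simp only [Equiv.neg_symm, Equiv.neg_apply, Prod.fst_neg, Prod.snd_neg]
  omega

lemma shE_symm (z : Site) : (shE z).symm = shE (-z) := by
  ext1 e
  rw [Equiv.symm_apply_eq]
  simp [shE_apply]

lemma ivE_symm : ivE.symm = ivE := rfl

/-! ### Cycles separating dual arms -/

lemma box_col {m M : ℕ} (h : m < M) {y : ℤ} (h1 : -(m : ℤ) ≤ y) (h2 : y ≤ m) :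
    ((0, y) : Site) ∈ box M ∧ ((1, y) : Site) ∈ box M := by
  simp only [mem_box]
  omega

/-- A chain joining two right neighbours of the column is completed to a cycle along the column,
and this cycle separates the column sites above and below `y₂`. -/
lemma exists_cycle {m M : ℕ} (hM : m < M) {y₁ w₁ y₂ w₂ : ℤ} (h0 : -(m : ℤ) ≤ y₁) (h1 : y₁ < w₁)
    (h2 : w₁ < y₂) (h3 : y₂ < w₂) (h4 : w₂ ≤ m) {γ : Chain1} (hb : bd γ = pr (1, y₁) (1, y₂))
    (hbox : ∀ e, γ e ≠ 0 → src e ∈ box M ∧ tgt e ∈ box M)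
    (hcol : ∀ y, -(m : ℤ) ≤ y → y ≤ m → γ ((0, y), false) = 0) :
    ∃ z, bd z = 0 ∧ (∀ e, z e ≠ 0 → src e ∈ box M ∧ tgt e ∈ box M) ∧
      (∀ e, z e ≠ 0 → γ e ≠ 0 ∨ e = ((0, y₁), false) ∨ e = ((0, y₂), false) ∨
        (src e ∈ col m ∧ tgt e ∈ col m)) ∧
      ht (0, w₁ - 1) z ≠ ht (0, w₂ - 1) z := by
  have hcn : Cn ∅ {e : Edge | e.2 = true ∧ src e ∈ col m ∧ tgt e ∈ col m} (0, y₁) (0, y₂) := by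
    refine Int.leInduction (motive := fun b _ => b ≤ m →
      Cn ∅ {e : Edge | e.2 = true ∧ src e ∈ col m ∧ tgt e ∈ col m} (0, y₁) (0, b))
      (fun _ => .refl _) ?_ y₂ (by omega) (by omega)
    intro b hb ih hbm
    refine (ih (by omega)).trans (.of_edge (e := ((0, b), true)) ?_)
    have b1 : -(m : ℤ) ≤ b := by omega
    have b2 : b ≤ m := by omega
    have b3 : -(m : ℤ) ≤ b + 1 := by omega
    exact ⟨rfl, ⟨rfl, b1, b2⟩, rfl, b3, hbm⟩
  obtain ⟨κ, hκ, hκb⟩ := hcn.exists_chain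
  set a₁ : Edge := ((0, y₁), false) with ha₁
  set a₂ : Edge := ((0, y₂), false) with ha₂
  set z := γ + κ + (Finsupp.single a₁ 1 + Finsupp.single a₂ 1) with hz
  have hz0 : bd z = 0 := by
    rw [hz, map_add, map_add, map_add, bd_single, bd_single, hb, hκb, bdE, bdE, ha₁, ha₂, src_mk,
      src_mk, tgt_h, tgt_h, zero_add, pr_comm (0, y₂), add_comm (pr (1, y₁) _)]
    have e1 : pr ((0, y₁) : Site) (0, y₂) + pr (1, y₁) (1, y₂) + (pr (0, y₁) (1, y₁) +
        pr (1, y₂) (0, y₂)) = pr (0, y₁) (0, y₂) + (pr (0, y₁) (1, y₁) + pr (1, y₁) (1, y₂) +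
        pr (1, y₂) (0, y₂)) := by abel
    rw [e1, pr_add, pr_add]
    ext x
    exact zmod2_add_self _
  have hzr : ∀ e, z e ≠ 0 → γ e ≠ 0 ∨ e = a₁ ∨ e = a₂ ∨
      (e.2 = true ∧ src e ∈ col m ∧ tgt e ∈ col m) := by
    intro e he
    by_contra hno
    push Not at hno
    obtain ⟨n1, n2, n3, n4⟩ := hno
    apply he
    have : κ e = 0 := by
      by_contra hne
      have := hκ e hne
      exact n4 this.1 this.2.1 this.2.2
    rw [hz]
    simp [n1, this, Finsupp.single_eq_of_ne n2, Finsupp.single_eq_of_ne n3]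
  have hflat : ∀ y, -(m : ℤ) ≤ y → y ≤ m → y ≠ y₁ → y ≠ y₂ → z ((0, y), false) = 0 := by
    intro y hy hy' n1 n2
    by_contra hne
    rcases hzr _ hne with h | h | h | h
    · exact h (hcol y hy hy')
    · exact n1 (congrArg (fun e : Edge => e.1.2) h)
    · exact n2 (congrArg (fun e : Edge => e.1.2) h)
    · exact Bool.false_ne_true h.1
  have hjump : z a₂ = 1 := by
    have e1 : γ a₂ = 0 := hcol y₂ (by omega) (by omega)
    have e2 : κ a₂ = 0 := by
      by_contra hne
      exact Bool.false_ne_true (hκ _ hne).1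
    have e3 : a₂ ≠ a₁ := fun h => by
      have : y₂ = y₁ := congrArg (fun e : Edge => e.1.2) h
      omega
    rw [hz]
    simp [e1, e2, Finsupp.single_eq_of_ne e3]
  have hconst : ∀ a b : ℤ, -(m : ℤ) ≤ a + 1 → a ≤ b → b ≤ m →
      (∀ y, a < y → y ≤ b → y ≠ y₁ ∧ y ≠ y₂) → ht (0, a) z = ht (0, b) z := by
    intro a b ha hab
    refine Int.leInduction (motive := fun b _ => b ≤ m →
      (∀ y, a < y → y ≤ b → y ≠ y₁ ∧ y ≠ y₂) → ht (0, a) z = ht (0, b) z)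
      (fun _ _ => rfl) ?_ b hab
    intro b hab ih hbm hy
    rw [ih (by omega) fun y h h' => hy y h (by omega)]
    have := ht_col 0 (b + 1) z
    rw [hflat (b + 1) (by omega) hbm (hy _ (by omega) le_rfl).1 (hy _ (by omega) le_rfl).2,
      add_sub_cancel_right] at this
    exact CharTwo.add_eq_zero.1 this
  refine ⟨z, hz0, fun e he => ?_, fun e he => ?_, fun heq => ?_⟩
  · rcases hzr e he with h | h | h | ⟨-, h, h'⟩
    · exact hbox e h
    · rw [h, ha₁, src_mk, tgt_h, zero_add]
      exact box_col hM (by omega) (by omega)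
    · rw [h, ha₂, src_mk, tgt_h, zero_add]
      exact box_col hM (by omega) (by omega)
    · simp only [col, Set.mem_ofPred_eq] at h h'
      simp only [mem_box]
      omega
  · rcases hzr e he with h | h | h | h
    · exact Or.inl h
    · exact Or.inr (Or.inl h)
    · exact Or.inr (Or.inr (Or.inl h))
    · exact Or.inr (Or.inr (Or.inr h.2))
  · rw [hconst (w₁ - 1) (y₂ - 1) (by omega) (by omega) (by omega) (fun y _ _ => by omega),
      ← hconst y₂ (w₂ - 1) (by omega) (by omega) (by omega) (fun y _ _ => by omega)] at heq
    have := ht_col 0 y₂ z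
    rw [heq, zmod2_add_self] at this
    rw [hjump] at this
    exact zero_ne_one this

/-- Heights outside of a box, at the lower left face. -/
lemma ht_sub_eq_zero {z : Chain1} (hz : bd z = 0) {M : ℕ}
    (hM : ∀ e, z e ≠ 0 → src e ∈ box M ∧ tgt e ∈ box M) {x y : ℤ} (hx : (x, y) ∉ box M) :
    ht (x - 1, y - 1) z = 0 := by
  have h0 := fun {x : Site} => ht_eq_zero hz (fun e he => (hM e he).1) (x := x)
  by_cases h1 : ((x - 1, y - 1) : Site) ∈ box M
  · have hv : ∀ e, (src e ∉ box M ∨ tgt e ∉ box M) → z e = 0 := fun e he => by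
      by_contra hne
      exact he.elim (fun h => h (hM e hne).1) fun h => h (hM e hne).2
    have a1 := ht_col (x - 1) y z
    by_cases h2 : ((x - 1, y) : Site) ∈ box M
    · rw [hv ((x - 1, y), false) (Or.inr (by rw [tgt_h, sub_add_cancel]; exact hx))] at a1
      have a2 := ht_row x y z
      rw [hv ((x, y), true) (Or.inl hx), hz, map_zero, add_zero, h0 hx, add_zero] at a2
      rwa [a2, add_zero] at a1
    · rw [hv ((x - 1, y), false) (Or.inl h2), h0 h2, add_zero] at a1
      exact a1
  · exact h0 h1

/-- A function that is invariant along the steps is constant along connections. -/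
lemma CR.eq_of {V β : Type*} {r : V → V → Prop} {R : Set V} {u v : V} (h : CR r R u v) {f : V → β}
    (hf : ∀ a ∈ R, ∀ b ∈ R, r a b → f a = f b) : f u = f v := by
  induction h with
  | refl => rfl
  | tail _ hbc ih => exact ih.trans (hf _ hbc.2.1 _ hbc.2.2 hbc.1)

lemma CR.cn {ω : Set Edge} {r : Site → Site → Prop} {R : Set Site} {u v : Site} (h : CR r R u v)
    (hr : ∀ a ∈ R, ∀ b ∈ R, r a b → Cn ∅ ω a b) : Cn ∅ ω u v := by
  induction h with
  | refl => exact .refl _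
  | tail _ hbc ih => exact ih.trans (hr _ hbc.2.1 _ hbc.2.2 hbc.1)

/-! ### The self-dual random-cluster model with free boundary conditions -/

/-- Adjacency through an open edge. -/
def adjE (ω : Set Edge) (u v : Site) : Prop :=
  ∃ e ∈ ω, (src e = u ∧ tgt e = v) ∨ (src e = v ∧ tgt e = u)

lemma planar_adjE (ω : Set Edge) (m M : ℕ) (y₁ w₁ y₂ w₂ : ℤ) (v₁ v₂ : Site) (hM : m < M)
    (h0 : -(m : ℤ) ≤ y₁) (h1 : y₁ < w₁) (h2 : w₁ < y₂) (h3 : y₂ < w₂) (h4 : w₂ ≤ m)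
    (hy₁ : ((0, y₁), false) ∈ ω) (hy₂ : ((0, y₂), false) ∈ ω)
    (hc : CR (adjE ω) (↑(box M) \ col m) (1, y₁) (1, y₂)) (hv₁ : v₁ ∉ box M) (hv₂ : v₂ ∉ box M)
    (hc₁ : CR (adjE (dual ω)) (col m)ᶜ (1, w₁) v₁)
    (hc₂ : CR (adjE (dual ω)) (col m)ᶜ (1, w₂) v₂) : False := by
  have hcn : Cn ∅ {e | e ∈ ω ∧ src e ∈ (↑(box M) \ col m : Set Site) ∧
      tgt e ∈ (↑(box M) \ col m : Set Site)} (1, y₁) (1, y₂) := by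
    refine hc.cn fun a ha b hb hab => ?_
    obtain ⟨e, he, ⟨rfl, rfl⟩ | ⟨rfl, rfl⟩⟩ := hab
    · exact .of_edge ⟨he, ha, hb⟩
    · exact (Cn.of_edge (by exact ⟨he, hb, ha⟩)).symm
  obtain ⟨γ, hγ, hb⟩ := hcn.exists_chain
  obtain ⟨z, hz, hzM, hzr, hne⟩ := exists_cycle hM h0 h1 h2 h3 h4 hb
    (fun e he => ⟨(hγ e he).2.1.1, (hγ e he).2.2.1⟩) (fun y hy hy' => by
      by_contra hn
      exact (hγ _ hn).2.1.2 ⟨rfl, hy, hy'⟩)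
  have key : ∀ (w : ℤ) (v : Site), v ∉ box M → CR (adjE (dual ω)) (col m)ᶜ (1, w) v →
      ht (0, w - 1) z = 0 := by
    intro w v hv hcr
    have hstep : ∀ e ∈ dual ω, src e ∉ col m → tgt e ∉ col m →
        ht (src e - (1, 1)) z = ht (tgt e - (1, 1)) z := by
      intro e he hs ht'
      have h0 : z (dl e) = 0 := by
        by_contra hn
        rcases hzr _ hn with h | h | h | h
        · exact he (hγ _ h).1
        · exact he (by rw [h]; exact hy₁)
        · exact he (by rw [h]; exact hy₂)
        · obtain ⟨⟨x, y⟩, _ | _⟩ := e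
          · rw [dl_h, src_mk, tgt_v, sub_add_cancel] at h
            exact hs h.2
          · rw [dl_v, src_mk, tgt_h, sub_add_cancel] at h
            exact hs h.2
      have := ht_eq_of_zero hz h0
      have e1 : dl (dl e) = shE (-(1, 1)) e := by
        have := dl_symm_eq (dl e)
        rw [dl.symm_apply_apply, ← Equiv.symm_apply_eq, shE_symm] at this
        exact this.symm
      rw [e1, src_shE, tgt_shE] at this
      rwa [sub_eq_add_neg, sub_eq_add_neg]
    have := hcr.eq_of (f := fun x => ht (x - (1, 1)) z) fun a ha b hb hab => by
      obtain ⟨e, he, ⟨rfl, rfl⟩ | ⟨rfl, rfl⟩⟩ := hab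
      · exact hstep e he ha hb
      · exact (hstep e he hb ha).symm
    have e0 : ((1, w) : Site) - (1, 1) = (0, w - 1) := rfl
    rw [e0] at this
    rw [this]
    exact ht_sub_eq_zero hz hzM hv
  exact hne ((key w₁ v₁ hv₁ hc₁).trans (key w₂ v₂ hv₂ hc₂).symm)

lemma cr_col {r : Site → Site → Prop} (hr : ∀ a b, r a b → r b a) {m : ℕ}
    (h : ∀ y : ℤ, -(m : ℤ) ≤ y → y < m → r (0, y) (0, y + 1)) {u v : Site} (hu : u ∈ col m)
    (hv : v ∈ col m) : CR r (col m) u v := by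
  have key : ∀ y : ℤ, -(m : ℤ) ≤ y → y ≤ m → CR r (col m) (0, -(m : ℤ)) (0, y) := by
    intro y hy
    refine Int.leInduction (motive := fun y _ => y ≤ m → CR r (col m) (0, -(m : ℤ)) (0, y))
      (fun _ => CR.refl _) ?_ y hy
    intro y hy ih hym
    refine (ih (by omega)).trans (CR.single (h y hy (by omega)) ?_ ?_)
    · have : y ≤ m := by omega
      exact ⟨rfl, hy, this⟩
    · have : -(m : ℤ) ≤ y + 1 := by omega
      exact ⟨rfl, this, hym⟩
  obtain ⟨u1, u2⟩ := u
  obtain ⟨v1, v2⟩ := v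
  obtain ⟨hu0, hu⟩ := hu
  obtain ⟨hv0, hv⟩ := hv
  simp only at hu0 hv0
  subst hu0 hv0
  exact ((key u2 hu.1 hu.2).symm hr).trans (key v2 hv.1 hv.2)

section AdjE

lemma adjE_symm (ω : Set Edge) (u v : Site) (h : adjE ω u v) : adjE ω v u := by
  obtain ⟨e, he, h⟩ := h
  exact ⟨e, he, h.symm⟩

lemma adjE_mono (ω ω' : Set Edge) (u v : Site) (h : ω ⊆ ω') (ha : adjE ω u v) : adjE ω' u v := by
  obtain ⟨e, he, ha⟩ := ha
  exact ⟨e, h he, ha⟩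

lemma adjE_range (ω : Set Edge) (u v : Site) (h : adjE ω u v) :
    (v.1 ≤ u.1 + 1 ∧ u.1 ≤ v.1 + 1) ∧ (v.2 ≤ u.2 + 1 ∧ u.2 ≤ v.2 + 1) := by
  obtain ⟨⟨⟨x, y⟩, _ | _⟩, he, ⟨rfl, rfl⟩ | ⟨rfl, rfl⟩⟩ := h <;>
    simp only [src_mk, tgt_h, tgt_v] <;> omega

/-- The edges that can join `u` and `v`. -/
def locE (u v : Site) : Finset Edge := {(u, false), (u, true), (v, false), (v, true)}

lemma adjE_loc (ω : Set Edge) (u v : Site) (h : adjE ω u v) : adjE (ω ∩ ↑(locE u v)) u v := by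
  obtain ⟨e, he, h⟩ := h
  refine ⟨e, ⟨he, ?_⟩, h⟩
  obtain ⟨x, _ | _⟩ := e <;> rcases h with ⟨h, -⟩ | ⟨h, -⟩ <;> rw [src_mk] at h <;> subst h <;>
    simp [locE]

lemma adjE_sh (z : Site) (ω : Set Edge) (u v : Site) :
    adjE (shE z ⁻¹' ω) u v ↔ adjE ω (u + z) (v + z) := by
  constructor
  · rintro ⟨e, he, h⟩
    refine ⟨shE z e, he, ?_⟩
    rw [src_shE, tgt_shE, add_left_inj, add_left_inj, add_left_inj, add_left_inj]
    exact h
  · rintro ⟨e, he, h⟩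
    obtain ⟨e, rfl⟩ := (shE z).surjective e
    rw [src_shE, tgt_shE, add_left_inj, add_left_inj, add_left_inj, add_left_inj] at h
    exact ⟨e, he, h⟩

lemma adjE_iv (ω : Set Edge) (u v : Site) : adjE (ivE ⁻¹' ω) u v ↔ adjE ω (-u) (-v) := by
  constructor
  · rintro ⟨e, he, h⟩
    refine ⟨ivE e, he, ?_⟩
    rw [src_ivE, tgt_ivE, neg_inj, neg_inj, neg_inj, neg_inj]
    exact h.symm.imp And.symm And.symm
  · rintro ⟨e, he, h⟩
    obtain ⟨e, rfl⟩ := ivE.surjective e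
    rw [src_ivE, tgt_ivE, neg_inj, neg_inj, neg_inj, neg_inj] at h
    exact ⟨e, he, h.symm.imp And.symm And.symm⟩

lemma adjE_exit (ω : Set Edge) (m : ℕ) (u : Site) (hu : u ∈ col m) (v : Site) (hv : v ∉ col m)
    (h : adjE ω u v) :
    (∃ y ∈ Finset.Icc (-(m : ℤ)) m, v = (1, y) ∧ (((0, y), false) : Edge) ∈ ω) ∨
    (∃ y ∈ Finset.Icc (-(m : ℤ)) m, v = (-1, y) ∧ (((-1, y), false) : Edge) ∈ ω) ∨
    ∃ b ∈ ({((0, (m : ℤ)), true), ((0, -(m : ℤ) - 1), true)} : Finset Edge), b ∈ ω := by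
  obtain ⟨⟨⟨x, y⟩, _ | _⟩, he, ⟨rfl, rfl⟩ | ⟨rfl, rfl⟩⟩ := h <;>
    simp only [src_mk, tgt_h, tgt_v, col, Set.mem_ofPred_eq] at hu hv ⊢
  · obtain rfl : x = 0 := hu.1
    exact Or.inl ⟨y, Finset.mem_Icc.2 hu.2, rfl, he⟩
  · obtain rfl : x = -1 := by omega
    exact Or.inr (Or.inl ⟨y, Finset.mem_Icc.2 hu.2, rfl, he⟩)
  · obtain rfl : x = 0 := hu.1
    obtain rfl : y = m := by omega
    exact Or.inr (Or.inr ⟨_, by simp, he⟩)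
  · obtain rfl : x = 0 := hu.1
    obtain rfl : y = -(m : ℤ) - 1 := by omega
    exact Or.inr (Or.inr ⟨_, by simp, he⟩)

/-- The edges touching the column. -/
noncomputable def insE (m : ℕ) : Finset Edge :=
  (edgesIn (box (m + 1))).filter fun e => src e ∈ col m ∨ tgt e ∈ col m

lemma mem_insE {m : ℕ} {e : Edge} : e ∈ insE m ↔ src e ∈ col m ∨ tgt e ∈ col m := by
  rw [insE, Finset.mem_filter, mem_edgesIn, and_iff_right_iff_imp]
  obtain ⟨⟨x, y⟩, _ | _⟩ := e <;>
    simp only [src_mk, tgt_h, tgt_v, col, Set.mem_ofPred_eq, mem_box] <;> push_cast <;> omega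

end AdjE

section FK

variable {q : ℝ}

/-- The weight of the self-dual random-cluster model. -/
noncomputable def fkw (q : ℝ) : Finset Edge → ℝ := wt √q q 1 ∅

lemma fkw_pos (hq : 1 ≤ q) (s : Finset Edge) : 0 < fkw q s :=
  wt_pos (Real.sqrt_pos.2 (by linarith)) (by linarith) one_pos s

lemma edgeLe_fkw (hq : 1 ≤ q) (F : Finset Edge) : EdgeLe F (fkw q) (fkw q) :=
  edgeLe_wt (Real.sqrt_pos.2 (by linarith)) hq le_rfl F

lemma fac_le_sqrt (hq : 1 ≤ q) (ω : Set Edge) (e : Edge) : fac √q q 1 ∅ ω e ≤ √q := by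
  unfold fac
  rw [one_pow, mul_one]
  exact div_le_self (Real.sqrt_nonneg q) (one_le_pow₀ hq)

lemma one_le_sqrt_mul_fac (hq : 1 ≤ q) (ω : Set Edge) (e : Edge) :
    1 ≤ √q * fac √q q 1 ∅ ω e := by
  unfold fac
  rw [one_pow, mul_one, ← mul_div_assoc, Real.mul_self_sqrt (by linarith), le_div_iff₀ (by positivity),
    one_mul]
  calc q ^ dr ∅ ω e ≤ q ^ 1 := pow_le_pow_right₀ hq (dr_le_one _ _ _)
    _ = q := pow_one q

lemma sum_edge_finite (G : Finset Edge) : ∃ L₀, ∀ L ≥ L₀, G ⊆ edgesIn (box L) := by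
  induction G using Finset.induction_on with
  | empty => exact ⟨0, fun L _ => by simp⟩
  | insert e G _ ih =>
    obtain ⟨L₀, h⟩ := ih
    refine ⟨max L₀ (e.1.1.natAbs + e.1.2.natAbs + 1), fun L hL => Finset.insert_subset ?_
      (h L (le_of_max_le_left hL))⟩
    have hL' := le_of_max_le_right hL
    rw [mem_edgesIn]
    obtain ⟨⟨x, y⟩, _ | _⟩ := e <;> simp only [src_mk, tgt_h, tgt_v, mem_box] at hL' ⊢ <;> omega

lemma tendsto_of_mono_le_one {a : ℕ → ℝ} (h : Monotone a) (h1 : ∀ n, a n ≤ 1) :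
    ∃ m, Tendsto a atTop (nhds m) :=
  ⟨_, tendsto_atTop_ciSup h ⟨1, by rintro _ ⟨n, rfl⟩; exact h1 n⟩⟩

lemma monotone_ex_fkw (hq : 1 ≤ q) {f : Set Edge → ℝ} (hf : Monotone f) :
    Monotone fun L => ex (edgesIn (box L)) (fkw q) f := fun _ _ h =>
  ex_domain_mono (fkw_pos hq) (edgeLe_fkw hq _) (edgesIn_mono (box_mono h)) hf

/-- The self-dual random-cluster model on boxes with free boundary conditions. -/
noncomputable def fkModel (q : ℝ) (hq : 1 ≤ q) : Model Edge where
  F L := edgesIn (box L)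
  w _ := fkw q
  pos _ := fkw_pos hq
  edge _ := edgeLe_fkw hq _
  exh := sum_edge_finite
  κ := √q
  κ_pos := Real.sqrt_pos.2 (by linarith)
  energy_up L e _ s _ he := by
    rw [fkw, wt_insert he, mul_comm]
    exact mul_le_mul_of_nonneg_right (fac_le_sqrt hq _ _) (fkw_pos hq s).le
  energy_dn L e _ s _ he := by
    rw [fkw, wt_insert he, mul_comm (wt _ _ _ _ _), ← mul_assoc]
    exact le_mul_of_one_le_left (fkw_pos hq s).le (one_le_sqrt_mul_fac hq _ _)
  conv A := tendsto_of_mono_le_one (monotone_ex_fkw hq (cyl_mono A))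
    fun _ => ex_le_one (fkw_pos hq) fun _ => ind_le_one _

lemma fkModel_inv_of (hq : 1 ≤ q) {g : Edge ≃ Edge} {τ : Site ≃ Site} (h : LatSym g τ)
    {k : ℕ} (hk : ∀ L, (box L).map τ.toEmbedding ⊆ box (L + k)) (A : Finset Edge) (L : ℕ) :
    ex (edgesIn (box L)) (fkw q) (cyl A) ≤
      ex (edgesIn (box (L + k))) (fkw q) (cyl (A.map g.toEmbedding)) := by
  rw [← ex_map g (w := fkw q) (w' := fkw q) (fun s _ => ?_) fun s => cyl_map g A s, h.edgesIn_map]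
  · exact ex_domain_mono (fkw_pos hq) (edgeLe_fkw hq _) (edgesIn_mono (hk L)) (cyl_mono _)
  · have := h.wt_map (C := ∅) √q q 1 s
    rwa [Set.image_empty] at this

lemma fkModel_inv_sh (hq : 1 ≤ q) (z : Site) : (fkModel q hq).Inv (shE z) := by
  obtain ⟨k, hk⟩ := exists_box_map_shift z
  obtain ⟨k', hk'⟩ := exists_box_map_shift (-z)
  refine Model.inv_of _ ⟨k, fun A => ⟨0, fun L _ => ?_⟩⟩ ⟨k', fun A => ⟨0, fun L _ => ?_⟩⟩
  · exact fkModel_inv_of hq (latSym_shE z) hk A L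
  · rw [shE_symm]
    exact fkModel_inv_of hq (latSym_shE (-z)) hk' A L

lemma fkModel_inv_iv (hq : 1 ≤ q) : (fkModel q hq).Inv ivE := by
  have hk : ∀ L, (box L).map (Equiv.neg Site).toEmbedding ⊆ box (L + 0) := fun L => by
    rw [box_map_neg, add_zero]
  refine Model.inv_of _ ⟨0, fun A => ⟨0, fun L _ => ?_⟩⟩ ⟨0, fun A => ⟨0, fun L _ => ?_⟩⟩
  · exact fkModel_inv_of hq latSym_ivE hk A L
  · rw [ivE_symm]
    exact fkModel_inv_of hq latSym_ivE hk A L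

/-- An edge and its dual are not both pivotal in a useless way. -/
lemma one_le_dr_add_dr {ω η : Set Edge} {e : Edge} (he : e ∉ ω)
    (hη : ∀ e' ∈ η, ∃ e'', e'' ∉ ω ∧ e'' ≠ e ∧ dl e'' = e') :
    1 ≤ dr ∅ ω e + dr ∅ η (dl e) := by
  unfold dr
  split_ifs with h1 h2
  · exact absurd (h2.mono subset_rfl fun e' he' => by
      obtain ⟨e'', a, b, c⟩ := hη e' he'
      exact ⟨e'', ⟨a, b⟩, c⟩) (not_cn_and_cn_dual he h1)
  all_goals simp

lemma map_dl_sdiff {T t : Finset Edge} {e : Edge} (heT : e ∈ T) (het : e ∉ t) :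
    (T \ t).map dl.toEmbedding = insert (dl e) ((T \ insert e t).map dl.toEmbedding) := by
  have : T \ t = insert e (T \ insert e t) := by
    ext a
    by_cases h : a = e
    · simp [h, heT, het]
    · simp [h]
  rw [this, Finset.map_insert]
  rfl

lemma dl_notMem_map_sdiff (T t : Finset Edge) (e : Edge) :
    dl e ∉ (T \ insert e t).map dl.toEmbedding := by
  rw [Finset.mem_map_equiv, Equiv.symm_apply_apply]
  simp

lemma edgeLe_fkw_dual (hq : 1 ≤ q) (T : Finset Edge) :
    EdgeLe T (fkw q) fun s => fkw q ((T \ s).map dl.toEmbedding) := by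
  refine edgeLe_of_ratio (fkw_pos hq) (fun s => fkw_pos hq _) fun s t e hst htT heT het =>
    ⟨fac √q q 1 ∅ s e, ?_, ?_⟩
  · rw [fkw, wt_insert (fun h => het (hst h)), mul_comm]
  · rw [map_dl_sdiff heT het, fkw, wt_insert (dl_notMem_map_sdiff T t e), mul_comm (wt _ _ _ _ _), ← mul_assoc]
    refine mul_le_of_le_one_left (wt_pos (Real.sqrt_pos.2 (by linarith)) (by linarith) one_pos _).le ?_
    unfold fac
    rw [one_pow, one_pow, mul_one, mul_one, div_mul_div_comm, Real.mul_self_sqrt (by linarith),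
      ← pow_add, div_le_one (by positivity)]
    calc q = q ^ 1 := (pow_one q).symm
      _ ≤ _ := pow_le_pow_right₀ hq (one_le_dr_add_dr (fun h => het (hst h)) fun e' he' => by
        rw [Finset.mem_coe, Finset.mem_map] at he'
        obtain ⟨e'', h1, h2⟩ := he'
        rw [Finset.mem_sdiff, Finset.mem_insert, not_or] at h1
        exact ⟨e'', fun h => h1.2.2 (hst h), h1.2.1, h2⟩)

lemma edgesIn_subset_dual (L : ℕ) :
    edgesIn (box L) ⊆ (edgesIn (box (L + 1))).map dl.symm.toEmbedding := by
  intro e he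
  rw [Finset.mem_map_equiv, Equiv.symm_symm]
  rw [mem_edgesIn] at he ⊢
  obtain ⟨⟨x, y⟩, _ | _⟩ := e <;>
    simp only [dl_h, dl_v, src_mk, tgt_h, tgt_v, mem_box] at he ⊢ <;> push_cast <;> omega

lemma fkModel_ev_dual (hq : 1 ≤ q) (f : Set Edge → ℝ) (lf : IsLocal f) (hf : Monotone f) :
    (fkModel q hq).ev f ≤ (fkModel q hq).ev fun ω => f {x | dl x ∉ ω} := by
  obtain ⟨G, hG⟩ := lf
  obtain ⟨L₀, hL₀⟩ := sum_edge_finite G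
  refine le_of_tendsto_of_tendsto ((fkModel q hq).tendsto ⟨G, hG⟩)
    ((tendsto_add_atTop_iff_nat 1).2 ((fkModel q hq).tendsto (IsLocal.compl_preimage ⟨G, hG⟩ dl))) ?_
  filter_upwards [eventually_ge_atTop L₀] with L hL
  set T := (edgesIn (box (L + 1))).map dl.symm.toEmbedding with hT
  have hTd : edgesIn (box (L + 1)) = T.map dl.toEmbedding := by
    rw [hT, Finset.map_map]
    ext; simp
  change ex (edgesIn (box L)) (fkw q) f ≤ ex (edgesIn (box (L + 1))) (fkw q) fun ω => f (dual ω)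
  rw [hTd, ex_dual T (fkw q) (hG.mono (by exact_mod_cast (hL₀ L hL).trans (edgesIn_subset_dual L)))]
  exact (ex_domain_mono (fkw_pos hq) (edgeLe_fkw hq _) (edgesIn_subset_dual L) hf).trans
    (holley (fkw_pos hq) (fun s => fkw_pos hq _) (edgeLe_fkw_dual hq T) hf)

lemma fkModel_decay (hq : 1 ≤ q) (x y : Edge) (ε : ℝ) (hε : 0 < ε) : ∀ᶠ n : ℕ in atTop,
    (fkModel q hq).cov (fun ω => ind (x ∈ ω)) (fun ω => ind (shE (0, n) y ∈ ω)) ≤ ε := by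
  set M := fkModel q hq with hM
  have lx : ∀ x : Edge, IsLocal fun ω : Set Edge => ind (x ∈ ω) := fun x => (localP_mem x).isLocal
  have mx : ∀ x : Edge, Monotone fun ω : Set Edge => ind (x ∈ ω) :=
    fun x _ _ h => ind_mono fun hx => h hx
  obtain ⟨K, hK⟩ := ((M.tendsto (lx x)).eventually (lt_mem_nhds (by linarith :
    M.ev (fun ω => ind (x ∈ ω)) - ε < _))).exists
  filter_upwards [eventually_gt_atTop (K + y.1.2.natAbs)] with n hn
  set e := shE (0, (n : ℤ)) y with he
  have heK : e ∉ edgesIn (box K) := by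
    rw [mem_edgesIn, he, src_shE, mem_box, src]
    simp only [Prod.snd_add]
    omega
  have key : ex (edgesIn (box K)) (fkw q) (fun ω => ind (x ∈ ω)) * M.ev (fun ω => 1 - ind (e ∈ ω)) ≤
      M.ev fun ω => ind (x ∈ ω) * (1 - ind (e ∈ ω)) := by
    have l1 := (isLocal_const 1).sub (lx e)
    refine le_of_tendsto_of_tendsto ((M.tendsto l1).const_mul _) (M.tendsto ((lx x).mul l1)) ?_
    filter_upwards [eventually_ge_atTop K] with L hL
    refine ex_markov (fkw_pos hq) (edgeLe_fkw hq _) (edgesIn_mono (box_mono hL)) (mx x)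
      (g := fun ω => 1 - ind (e ∈ ω)) (fun s => by have := ind_le_one (e ∈ s); linarith) fun s => ?_
    rw [ind_congr (p := e ∈ s \ ↑(edgesIn (box K))) (r := e ∈ s)]
    simp [heK]
  have e1 : M.ev (fun ω => 1 - ind (e ∈ ω)) = 1 - M.ev fun ω => ind (e ∈ ω) := by
    rw [M.ev_sub (isLocal_const 1) (lx e), M.ev_const]
  have e2 : M.ev (fun ω => ind (x ∈ ω) * (1 - ind (e ∈ ω))) =
      M.ev (fun ω => ind (x ∈ ω)) - M.ev fun ω => ind (x ∈ ω) * ind (e ∈ ω) := by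
    rw [← M.ev_sub (lx x) ((lx x).mul (lx e))]
    congr 1
    funext ω
    ring
  have h0 : 0 ≤ M.ev fun ω => ind (e ∈ ω) := M.P_nonneg (localP_mem e)
  have h1 : M.ev (fun ω => ind (e ∈ ω)) ≤ 1 := M.P_le_one (localP_mem e)
  rw [e1, e2] at key
  change M.ev (fun ω => ind (x ∈ ω)) - ε < ex (edgesIn (box K)) (fkw q) fun ω => ind (x ∈ ω) at hK
  unfold Model.cov
  nlinarith

/-- The random-cluster model as a planar percolation model. -/
noncomputable def fkPerc (q : ℝ) (hq : 1 ≤ q) : Perc Edge where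
  toModel := fkModel q hq
  sh := shE
  iv := ivE
  sh_add z z' x := by
    rw [shE_apply, shE_apply, shE_apply]
    simp only [Prod.mk.injEq, and_true]
    abel
  inv_sh := fkModel_inv_sh hq
  inv_iv := fkModel_inv_iv hq
  adj := adjE
  adj_symm := adjE_symm
  adj_mono := adjE_mono
  adj_range := adjE_range
  loc := locE
  adj_loc := adjE_loc
  adj_sh := adjE_sh
  adj_iv := adjE_iv
  dm := dl
  ev_dual := fkModel_ev_dual hq
  sR y := ((0, y), false)
  sL y := ((-1, y), false)
  iv_sR y := by simp [ivE]
  decay := fkModel_decay hq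
  ends m := {((0, (m : ℤ)), true), ((0, -(m : ℤ) - 1), true)}
  ends_card m := Finset.card_le_two.trans (by norm_num)
  exit := adjE_exit
  ins := insE
  ins_conn ω m h u hu v hv := by
    refine cr_col (adjE_symm ω) (fun y h1 h2 => ?_) hu hv
    refine ⟨((0, y), true), h (mem_insE.2 (Or.inl ⟨rfl, h1, h2.le⟩)), Or.inl ⟨rfl, rfl⟩⟩
  ins_adj ω m h y hy hs := ⟨((0, y), false), hs, Or.inl ⟨rfl, by rw [tgt_h, zero_add]⟩⟩
  ins_out ω m u hu v hv h := by
    obtain ⟨e, he, h⟩ := h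
    refine ⟨e, he.resolve_right fun hi => ?_, h⟩
    rw [Finset.mem_coe, mem_insE] at hi
    rcases h with ⟨rfl, rfl⟩ | ⟨rfl, rfl⟩
    · exact hi.elim hu hv
    · exact hi.elim hv hu
  planar ω m M y₁ w₁ y₂ w₂ v₁ v₂ hM h0 h1 h2 h3 h4 hy₁ hy₂ hc _ _ hv₁ hv₂ hc₁ hc₂ :=
    planar_adjE ω m M y₁ w₁ y₂ w₂ v₁ v₂ hM h0 h1 h2 h3 h4 hy₁ hy₂ hc hv₁ hv₂ hc₁ hc₂

end FK

/-! ### Random-cluster configurations with clusters marked by fair coins -/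

section Rank

/-- The rank is additive over vertex-disjoint sets of edges. -/
lemma rk_union {R : Set Site} {ω₁ ω₂ : Finset Edge} (h₁ : ∀ e ∈ ω₁, src e ∉ R ∧ tgt e ∉ R)
    (h₂ : ∀ e ∈ ω₂, src e ∈ R ∧ tgt e ∈ R) : rk ∅ (ω₁ ∪ ω₂) = rk ∅ ω₁ + rk ∅ ω₂ := by
  induction ω₂ using Finset.induction_on with
  | empty => rw [Finset.union_empty, rk_empty, add_zero]
  | insert e ω he ih =>
    have h₂' : ∀ e ∈ ω, src e ∈ R ∧ tgt e ∈ R := fun e' h => h₂ e' (Finset.mem_insert_of_mem h)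
    have hs := (h₂ e (Finset.mem_insert_self _ _)).1
    rw [Finset.union_insert, rk_insert, rk_insert, ih h₂', add_assoc]
    congr 2
    unfold dr
    refine if_congr ⟨fun h => ?_, fun h => h.mono subset_rfl (by simp)⟩ rfl rfl
    have := h.eq_of (f := fun y => (y ∈ R ∧ Cn ∅ ω (src e) y)) (fun e' he' => ?_) (by simp)
    · exact (this.mp ⟨hs, .refl _⟩).2
    · rcases Finset.mem_union.1 he' with he' | he'
      · exact propext ⟨fun h => absurd h.1 (h₁ e' he').1, fun h => absurd h.1 (h₁ e' he').2⟩
      · exact propext ⟨fun h => ⟨(h₂' e' he').2, h.2.trans (.of_edge he')⟩,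
          fun h => ⟨(h₂' e' he').1, h.2.trans (Cn.of_edge (by exact he')).symm⟩⟩

/-- Wiring sites away from the edges does not change the rank. -/
lemma rk_wired_compl {A B : Finset Site} {ω : Finset Edge} (hω : ω ⊆ edgesIn B) :
    rk ((↑(B \ A) : Set Site)ᶜ) ω = rk ↑A ω := by
  refine rk_congr fun η hη e he => ⟨fun h => ?_, fun h => h.mono (fun a ha => ?_) subset_rfl⟩
  · have hB : ∀ e' ∈ η, src e' ∈ B ∧ tgt e' ∈ B := fun e' he' => mem_edgesIn.1 (hω (hη he'))
    have heB := mem_edgesIn.1 (hω he)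
    have := h.eq_of (f := fun y => (y ∈ B ∧ Cn ↑A η (src e) y) ∨
      (y ∉ B ∧ ∃ a ∈ A, Cn ↑A η (src e) a)) (fun e' he' => ?_) (fun a ha b hb => ?_)
    · exact ((this.mp (Or.inl ⟨heB.1, .refl _⟩)).resolve_right fun h => h.1 heB.2).2
    · have hc : Cn (↑A) (↑η) (src e') (tgt e') := .of_edge he'
      have := hB e' he'
      simp only [this, true_and, not_true, false_and, or_false]
      exact propext ⟨fun h => h.trans hc, fun h => h.trans hc.symm⟩
    · have key : ∀ a ∈ ((↑(B \ A) : Set Site)ᶜ), ((a ∈ B ∧ Cn ↑A η (src e) a) ∨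
          (a ∉ B ∧ ∃ a ∈ A, Cn ↑A η (src e) a)) = ∃ a ∈ A, Cn ↑A η (src e) a := by
        intro a ha
        by_cases haB : a ∈ B
        · have haA : a ∈ A := by
            by_contra h
            exact ha (by simp [haB, h])
          simp only [haB, true_and, not_true, false_and, or_false]
          exact propext ⟨fun h => ⟨a, haA, h⟩,
            fun ⟨b, hb, h⟩ => h.trans (.of_wired (by exact hb) (by exact haA))⟩
        · simp [haB]
      rw [key a ha, key b hb]
  · simp only [Finset.coe_sdiff, Set.mem_compl_iff, Set.mem_sdiff, not_and, not_not]
    exact fun _ => ha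

end Rank

section Marking

variable {q : ℝ}

/-- The weight of the random-cluster configurations of the sites with a given mark. -/
noncomputable def bw (q : ℝ) : Finset Edge → ℝ := wt √q (q / 2) 1 ∅

/-- The partition function of the sites with a given mark. -/
noncomputable def part (q : ℝ) (B : Finset Site) : ℝ := zsum (edgesIn B) (bw q)

/-- No open edge of `ω` leaves `S`. -/
def compat (S : Set Site) (ω : Set Edge) : Prop := ∀ e ∈ ω, (src e ∈ S ↔ tgt e ∈ S)

lemma bw_pos (hq : 2 ≤ q) (s : Finset Edge) : 0 < bw q s :=
  wt_pos (Real.sqrt_pos.2 (by linarith)) (by linarith) one_pos s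

lemma edgeLe_bw (hq : 2 ≤ q) (F : Finset Edge) : EdgeLe F (bw q) (bw q) :=
  edgeLe_wt (Real.sqrt_pos.2 (by linarith)) (by linarith) le_rfl F

lemma fkw_eq_bw (ω : Finset Edge) : fkw q ω = bw q ω / 2 ^ rk ∅ ω := by
  unfold fkw bw wt
  rw [one_pow, mul_one, mul_one, div_div, ← mul_pow, div_mul_cancel₀ _ two_ne_zero]

lemma bw_union {R : Set Site} {ω₁ ω₂ : Finset Edge} (h₁ : ∀ e ∈ ω₁, src e ∉ R ∧ tgt e ∉ R)
    (h₂ : ∀ e ∈ ω₂, src e ∈ R ∧ tgt e ∈ R) : bw q (ω₁ ∪ ω₂) = bw q ω₁ * bw q ω₂ := by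
  have hd : Disjoint ω₁ ω₂ := Finset.disjoint_left.2 fun e h h' => (h₁ e h).1 (h₂ e h').1
  unfold bw wt
  rw [rk_union h₁ h₂, Finset.card_union_of_disjoint hd, pow_add, pow_add, one_pow, one_pow, one_pow]
  simp only [mul_one]
  rw [div_mul_div_comm]

lemma bw_union_le (hq : 2 ≤ q) (s η : Finset Edge) : bw q (s ∪ η) ≤ √q ^ η.card * bw q s := by
  induction η using Finset.induction_on with
  | empty => simp
  | insert e η he ih =>
    have h1 : 1 ≤ √q := Real.one_le_sqrt.2 (by linarith)
    rw [Finset.union_insert, Finset.card_insert_of_notMem he, pow_succ]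
    have h2 : √q ^ η.card * bw q s ≤ √q ^ η.card * √q * bw q s :=
      mul_le_mul_of_nonneg_right (le_mul_of_one_le_right (by positivity) h1) (bw_pos hq s).le
    by_cases h : e ∈ s ∪ η
    · rw [Finset.insert_eq_of_mem h]
      exact ih.trans h2
    · rw [bw, wt_insert h]
      have h3 : fac √q (q / 2) 1 ∅ (↑(s ∪ η)) e ≤ √q := by
        unfold fac
        rw [one_pow, mul_one]
        exact div_le_self (Real.sqrt_nonneg q) (one_le_pow₀ (by linarith))
      calc _ ≤ bw q (s ∪ η) * √q := mul_le_mul_of_nonneg_left h3 (bw_pos hq _).le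
        _ ≤ √q ^ η.card * bw q s * √q := mul_le_mul_of_nonneg_right ih (Real.sqrt_nonneg q)
        _ = _ := by rw [bw]; ring

lemma part_pos (hq : 2 ≤ q) (B : Finset Site) : 0 < part q B := zsum_pos (bw_pos hq)

lemma ex_subset_edgesIn {S T : Finset Site} (h : S ⊆ T) :
    ex (edgesIn T) (bw q) (fun s => ind (s ⊆ ↑(edgesIn S))) = part q S / part q T := by
  have := wsum_ind_subset (w := bw q) (edgesIn_mono h) fun _ => 1
  simp only [one_mul] at this
  rw [ex, this, wsum_one]
  rfl

lemma part_supermodular (hq : 2 ≤ q) {S T : Finset Site} (h : S ⊆ T) {x : Site} (hx : x ∉ T) :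
    part q (insert x S) * part q T ≤ part q S * part q (insert x T) := by
  have hm : Monotone fun s : Set Edge => 1 - ind (s ⊆ ↑(edgesIn T)) := fun s t hst =>
    sub_le_sub_left (ind_mono fun h => hst.trans h) 1
  have key := ex_domain_mono (bw_pos hq) (edgeLe_bw hq _) (edgesIn_mono (Finset.insert_subset_insert x h)) hm
  rw [ex_sub, ex_sub, ex_one (bw_pos hq), ex_one (bw_pos hq),
    ex_subset_edgesIn (Finset.subset_insert x T)] at key
  have e : ex (edgesIn (insert x S)) (bw q) (fun s => ind (s ⊆ ↑(edgesIn T))) =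
      ex (edgesIn (insert x S)) (bw q) (fun s => ind (s ⊆ ↑(edgesIn S))) := by
    refine ex_congr fun s hs => ind_congr ?_
    rw [Finset.coe_subset, Finset.coe_subset]
    refine ⟨fun hT e he => ?_, fun hS => hS.trans (edgesIn_mono h)⟩
    have h1 := mem_edgesIn.1 (hs he)
    have h2 := mem_edgesIn.1 (hT he)
    rw [Finset.mem_insert, Finset.mem_insert] at h1
    exact mem_edgesIn.2 ⟨h1.1.resolve_left fun h => hx (h ▸ h2.1),
      h1.2.resolve_left fun h => hx (h ▸ h2.2)⟩
  rw [e, ex_subset_edgesIn (Finset.subset_insert x S), sub_le_sub_iff_left,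
    div_le_div_iff₀ (part_pos hq _) (part_pos hq _)] at key
  linarith

lemma part_le_insert (hq : 2 ≤ q) (S : Finset Site) (x : Site) : part q S ≤ part q (insert x S) :=
  Finset.sum_le_sum_of_subset_of_nonneg
    (Finset.powerset_mono.2 (edgesIn_mono (Finset.subset_insert x S))) fun s _ _ => (bw_pos hq s).le

lemma part_insert_le (hq : 2 ≤ q) (S : Finset Site) (x : Site) :
    part q (insert x S) ≤ 16 * q ^ 2 * part q S := by
  have hsub := edgesIn_mono (Finset.subset_insert x S)
  have hcard : (edgesIn (insert x S) \ edgesIn S).card ≤ 4 := by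
    refine (Finset.card_le_card (t := {(x, false), (x, true), ((x.1 - 1, x.2), false),
      ((x.1, x.2 - 1), true)}) fun e he => ?_).trans Finset.card_le_four
    rw [Finset.mem_sdiff, mem_edgesIn, mem_edgesIn, Finset.mem_insert, Finset.mem_insert] at he
    have : src e = x ∨ tgt e = x := by
      by_contra hno
      push Not at hno
      exact he.2 ⟨he.1.1.resolve_left hno.1, he.1.2.resolve_left hno.2⟩
    obtain ⟨⟨a, b⟩, _ | _⟩ := e <;> rcases this with rfl | rfl <;> simp [src, tgt]
  have h1 : 1 ≤ √q := Real.one_le_sqrt.2 (by linarith)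
  have hpos := (part_pos hq S).le
  rw [part, zsum, sum_powerset_split hsub]
  calc _ ≤ ∑ η ∈ (edgesIn (insert x S) \ edgesIn S).powerset, √q ^ 4 * part q S := by
        refine Finset.sum_le_sum fun η hη => ?_
        rw [part, zsum, Finset.mul_sum]
        refine Finset.sum_le_sum fun s _ => (bw_union_le hq s η).trans ?_
        refine mul_le_mul_of_nonneg_right (pow_le_pow_right₀ h1 ?_) (bw_pos hq s).le
        exact (Finset.card_le_card (Finset.mem_powerset.1 hη)).trans hcard
    _ = 2 ^ (edgesIn (insert x S) \ edgesIn S).card * (q ^ 2 * part q S) := by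
        rw [Finset.sum_const, Finset.card_powerset, nsmul_eq_mul]
        have : √q ^ 4 = q ^ 2 := by
          rw [show (4 : ℕ) = 2 * 2 from rfl, pow_mul, Real.sq_sqrt (by linarith)]
        rw [this]
        push_cast
        ring
    _ ≤ 2 ^ 4 * (q ^ 2 * part q S) :=
        mul_le_mul_of_nonneg_right (pow_le_pow_right₀ one_le_two hcard) (by positivity)
    _ = _ := by ring

/-- Configurations compatible with `S` split into the two sides. -/
lemma sum_compat {S B : Finset Site} (hS : S ⊆ B) (g : Finset Edge → ℝ) :
    ∑ ω ∈ (edgesIn B).powerset, ind (compat S ω) * g ω =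
      ∑ ω₁ ∈ (edgesIn (B \ S)).powerset, ∑ ω₂ ∈ (edgesIn S).powerset, g (ω₁ ∪ ω₂) := by
  have hd : edgesIn (B \ S) ∪ edgesIn S ⊆ edgesIn B :=
    Finset.union_subset (edgesIn_mono Finset.sdiff_subset) (edgesIn_mono hS)
  have hdis : Disjoint (edgesIn (B \ S)) (edgesIn S) := Finset.disjoint_left.2 fun e h h' =>
    (Finset.mem_sdiff.1 (mem_edgesIn.1 h).1).2 (mem_edgesIn.1 h').1
  have hf : ∀ ω ∈ (edgesIn B).powerset, ind (compat S ω) * g ω =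
      if ω ⊆ edgesIn (B \ S) ∪ edgesIn S then g ω else 0 := by
    intro ω hω
    have : compat (↑S) (↑ω) ↔ ω ⊆ edgesIn (B \ S) ∪ edgesIn S := by
      refine forall₂_congr fun e he => ?_
      have := mem_edgesIn.1 (Finset.mem_powerset.1 hω he)
      rw [Finset.mem_union, mem_edgesIn, mem_edgesIn, Finset.mem_sdiff, Finset.mem_sdiff]
      simp only [this, Finset.mem_coe, true_and]
      tauto
    rw [ind_congr this]
    by_cases h : ω ⊆ edgesIn (B \ S) ∪ edgesIn S <;> simp [h, ind]
  rw [Finset.sum_congr rfl hf, ← Finset.sum_filter]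
  have hpow : (edgesIn B).powerset.filter (· ⊆ edgesIn (B \ S) ∪ edgesIn S) =
      (edgesIn (B \ S) ∪ edgesIn S).powerset := by
    ext ω
    rw [Finset.mem_filter, Finset.mem_powerset, Finset.mem_powerset]
    exact ⟨fun h => h.2, fun h => ⟨h.trans hd, h⟩⟩
  rw [hpow, sum_powerset_split (Finset.subset_union_right : edgesIn S ⊆ _) g,
    Finset.union_sdiff_cancel_right hdis]
  exact Finset.sum_congr rfl fun _ _ => Finset.sum_congr rfl fun _ _ => by rw [Finset.union_comm]

lemma sum_compat_bw {S B : Finset Site} (hS : S ⊆ B) :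
    ∑ ω ∈ (edgesIn B).powerset, ind (compat S ω) * bw q ω = part q S * part q (B \ S) := by
  rw [sum_compat hS, mul_comm, part, zsum, part, zsum, Finset.sum_mul_sum]
  refine Finset.sum_congr rfl fun ω₁ h₁ => Finset.sum_congr rfl fun ω₂ h₂ => ?_
  refine bw_union (R := ↑S) (fun e he => ?_) fun e he =>
    mem_edgesIn.1 (Finset.mem_powerset.1 h₂ he)
  have := mem_edgesIn.1 (Finset.mem_powerset.1 h₁ he)
  rw [Finset.mem_sdiff, Finset.mem_sdiff] at this
  exact ⟨this.1.2, this.2.2⟩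

/-- The number of markings that contain `A` and are compatible with `ω`. -/
lemma card_marks {A B : Finset Site} (hA : A ⊆ B) {ω : Finset Edge} (hω : ω ⊆ edgesIn B) :
    ∑ S ∈ B.powerset, ind (A ⊆ S) * ind (compat S ω) = 2 ^ (B \ A).card / 2 ^ rk ↑A ω := by
  have h2 : ∀ a : ZMod 2, a ≠ 0 → a = 1 := by decide
  let φ : {S : Finset Site // S ⊆ B ∧ A ⊆ S ∧ compat S ω} ≃ Cols (B \ A) (0 : ZMod 2) ω :=
    { toFun := fun S => ⟨fun x => if x ∈ B ∧ x ∉ S.1 then 1 else 0, fun x hx => by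
          refine if_neg ?_
          rintro ⟨h1, h2⟩
          exact hx (Finset.mem_sdiff.2 ⟨h1, fun h => h2 (S.2.2.1 h)⟩), fun e he => by
          have h1 := mem_edgesIn.1 (hω he)
          have h2 := S.2.2.2 e he
          simp only [h1, true_and]
          exact if_congr (not_congr h2) rfl rfl⟩
      invFun := fun σ => ⟨B.filter fun x => σ.1 x = 0, Finset.filter_subset _ _, fun x hx =>
          Finset.mem_filter.2 ⟨hA hx, σ.2.1 x (by simp [hx])⟩, fun e he => by
          have h1 := mem_edgesIn.1 (hω he)
          simp [h1, σ.2.2 e he]⟩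
      left_inv := fun S => by
        apply Subtype.ext
        ext x
        by_cases hx : x ∈ B
        · simp [hx]
        · simp [hx, show x ∉ S.1 from fun h => hx (S.2.1 h)]
      right_inv := fun σ => by
        apply Subtype.ext
        funext x
        by_cases hx : x ∈ B
        · by_cases h : σ.1 x = 0
          · simp [hx, h]
          · simp [hx, h2 _ h]
        · simp [hx, σ.2.1 x (by simp [hx])] }
  have hc := card_cols (B \ A) (0 : ZMod 2) ω
  rw [← Nat.card_congr φ, rk_wired_compl hω, ZMod.card] at hc
  rw [eq_div_iff (by positivity)]
  have : (∑ S ∈ B.powerset, ind (A ⊆ S) * ind (compat S ω)) =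
      Nat.card {S : Finset Site // S ⊆ B ∧ A ⊆ S ∧ compat S ω} := by
    rw [Nat.subtype_card (B.powerset.filter fun S => A ⊆ S ∧ compat S ω) fun S => by
      rw [Finset.mem_filter, Finset.mem_powerset], Finset.card_filter, Nat.cast_sum]
    refine Finset.sum_congr rfl fun S _ => ?_
    rw [← ind_and, ind]
    split_ifs <;> simp
  rw [this]
  exact_mod_cast hc

/-- Summing the joint weight of markings and configurations over the markings. -/
lemma sum_joint {A B : Finset Site} (hA : A ⊆ B) (g : Finset Edge → ℝ) :
    ∑ S ∈ B.powerset, ind (A ⊆ S) * ∑ ω ∈ (edgesIn B).powerset, ind (compat S ω) * g ω =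
      2 ^ (B \ A).card * ∑ ω ∈ (edgesIn B).powerset, g ω / 2 ^ rk ↑A ω := by
  simp_rw [Finset.mul_sum]
  rw [Finset.sum_comm]
  refine Finset.sum_congr rfl fun ω hω => ?_
  simp_rw [← mul_assoc]
  rw [← Finset.sum_mul, card_marks hA (Finset.mem_powerset.1 hω)]
  ring

end Marking

section Fuzzy

variable {q : ℝ}

/-- The weight of the set of sites with the first mark. -/
noncomputable def fzw (q : ℝ) (B S : Finset Site) : ℝ := part q S * part q (B \ S)

lemma fzw_pos (hq : 2 ≤ q) (B S : Finset Site) : 0 < fzw q B S :=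
  mul_pos (part_pos hq _) (part_pos hq _)

lemma sdiff_eq_insert {B T : Finset Site} {x : Site} (hx : x ∈ B) (hT : x ∉ T) :
    B \ T = insert x (B \ insert x T) := by
  ext a
  by_cases h : a = x
  · simp [h, hx, hT]
  · simp [h]

lemma edgeLe_fzw (hq : 2 ≤ q) (B : Finset Site) : EdgeLe B (fzw q B) (fzw q B) := by
  intro s t x hst _ hx hxt
  have h1 := part_supermodular hq hst hxt
  have h2 := part_supermodular hq (S := B \ insert x t) (T := B \ insert x s) (x := x)
    (Finset.sdiff_subset_sdiff subset_rfl (Finset.insert_subset_insert x hst)) (by simp)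
  rw [← sdiff_eq_insert hx hxt, ← sdiff_eq_insert hx (fun h => hxt (hst h))] at h2
  have := mul_le_mul h1 h2 (mul_pos (part_pos hq _) (part_pos hq _)).le
    (mul_pos (part_pos hq _) (part_pos hq _)).le
  unfold fzw
  nlinarith

lemma fzw_up (hq : 2 ≤ q) {B S : Finset Site} {x : Site} (hx : x ∈ B) (hS : x ∉ S) :
    fzw q B (insert x S) ≤ 16 * q ^ 2 * fzw q B S := by
  have h1 := part_insert_le hq S x
  have h2 := part_le_insert hq (B \ insert x S) x
  rw [← sdiff_eq_insert hx hS] at h2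
  calc _ ≤ 16 * q ^ 2 * part q S * part q (B \ S) :=
        mul_le_mul h1 h2 (part_pos hq _).le (mul_nonneg (by positivity) (part_pos hq _).le)
    _ = _ := by unfold fzw; ring

lemma fzw_dn (hq : 2 ≤ q) {B S : Finset Site} {x : Site} (hx : x ∈ B) (hS : x ∉ S) :
    fzw q B S ≤ 16 * q ^ 2 * fzw q B (insert x S) := by
  have h1 := part_le_insert hq S x
  have h2 := part_insert_le hq (B \ insert x S) x
  rw [← sdiff_eq_insert hx hS] at h2
  calc _ ≤ part q (insert x S) * (16 * q ^ 2 * part q (B \ insert x S)) :=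
        mul_le_mul h1 h2 (part_pos hq _).le (part_pos hq _).le
    _ = _ := by unfold fzw; ring

/-- The relative number of markings containing `A`. -/
noncomputable def marks (G : Finset Edge) (A : Finset Site) (ω : Set Edge) : ℝ :=
  2 ^ (rk ∅ (G.filter (· ∈ ω)) - rk ↑A (G.filter (· ∈ ω)))

lemma marks_mono (G : Finset Edge) (A : Finset Site) : Monotone (marks G A) := by
  intro ω η h
  refine pow_le_pow_right₀ one_le_two ?_
  have := rk_anti_wired (Set.empty_subset (A : Set Site)) (ω := G.filter (· ∈ ω))
    (η := G.filter (· ∈ η)) (fun e => by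
      rw [Finset.mem_filter, Finset.mem_filter]
      exact fun he => ⟨he.1, h he.2⟩)
  omega

lemma marks_coe {G ω : Finset Edge} (h : ω ⊆ G) (A : Finset Site) :
    marks G A ↑ω = 2 ^ rk ∅ ω / 2 ^ rk ↑A ω := by
  have e : ∀ inst : DecidablePred (· ∈ (ω : Set Edge)),
      @Finset.filter _ (· ∈ (ω : Set Edge)) inst G = ω := by
    intro inst
    ext e
    rw [Finset.mem_filter, Finset.mem_coe]
    exact ⟨fun he => he.2, fun he => ⟨h he, he⟩⟩
  rw [marks, e, pow_sub₀ _ two_ne_zero (rk_wired_le (Set.empty_subset _) ω), div_eq_mul_inv]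

/-- Marginals of the markings in terms of the random-cluster measure. -/
lemma ex_fzw_cyl {A B : Finset Site} (hA : A ⊆ B) {G : Finset Edge} (hG : edgesIn B ⊆ G) :
    ex B (fzw q B) (cyl A) = (2 ^ A.card)⁻¹ * ex (edgesIn B) (fkw q) (marks G A) := by
  have key : ∀ A ⊆ B, wsum B (fzw q B) (cyl A) =
      2 ^ (B \ A).card * wsum (edgesIn B) (fkw q) (marks G A) := by
    intro A hA
    have h := sum_joint hA (bw q)
    unfold wsum
    rw [Finset.sum_congr rfl fun ω hω => ?_, h]
    · congr 1
      refine Finset.sum_congr rfl fun ω hω => ?_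
      rw [marks_coe ((Finset.mem_powerset.1 hω).trans hG), fkw_eq_bw, div_mul_div_cancel₀ (by positivity)]
    · rw [sum_compat_bw (Finset.mem_powerset.1 hω), mul_comm, cyl]
      rw [ind_congr Finset.coe_subset]
      rfl
  have h0 := key ∅ (Finset.empty_subset B)
  have e1 : (cyl ∅ : Set Site → ℝ) = fun _ => 1 := by
    funext ω
    exact ind_true (by simp)
  have e2 : marks G ∅ = fun _ => 1 := by
    funext ω
    simp [marks]
  rw [e1, e2, wsum_one, wsum_one, Finset.sdiff_empty] at h0
  rw [ex, ex, key A hA, h0, ← Finset.card_sdiff_add_card_eq_card hA, pow_add]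
  have := (pow_pos (zero_lt_two' ℝ) (B \ A).card).ne'
  field_simp

lemma ex_fzw_cyl_map_le (hq : 2 ≤ q) {g : Edge ≃ Edge} {τ : Site ≃ Site} (h : LatSym g τ)
    {A B B' : Finset Site} (hA : A ⊆ B) (hB : B.map τ.toEmbedding ⊆ B') :
    ex B (fzw q B) (cyl A) ≤ ex B' (fzw q B') (cyl (A.map τ.toEmbedding)) := by
  set G := edgesIn B' with hG
  have hB2 : (edgesIn B).map g.toEmbedding ⊆ G := by
    rw [h.edgesIn_map]
    exact edgesIn_mono hB
  rw [ex_fzw_cyl hA (subset_refl _), ex_fzw_cyl ((Finset.map_subset_map.2 hA).trans hB) (subset_refl _),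
    Finset.card_map]
  refine mul_le_mul_of_nonneg_left ?_ (by positivity)
  have e : ex (edgesIn B) (fkw q) (marks (edgesIn B) A) =
      ex ((edgesIn B).map g.toEmbedding) (fkw q) (marks G (A.map τ.toEmbedding)) := by
    refine (ex_bij (F := edgesIn B) (fun s => s.map g.toEmbedding)
      (fun t => t.map g.symm.toEmbedding) 1 one_pos ?_ ?_ ?_ ?_ ?_ ?_).symm
    · exact fun s hs => Finset.map_subset_map.2 hs
    · intro t ht x hx
      rw [Finset.mem_map_equiv, Equiv.symm_symm] at hx
      have := ht hx
      rwa [Finset.mem_map_equiv, Equiv.symm_apply_apply] at this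
    · intro s _
      ext x
      simp
    · intro s _
      ext x
      simp
    · intro s _
      have := h.wt_map (C := ∅) √q q 1 s
      rw [Set.image_empty] at this
      rw [one_mul]
      exact this
    · intro s hs
      have h0 := h.rk_map (C := ∅) s
      rw [Set.image_empty] at h0
      rw [marks_coe ((Finset.map_subset_map.2 hs).trans hB2), marks_coe hs, h0, Finset.coe_map]
      congr 2
      exact h.rk_map s
  rw [e]
  exact ex_domain_mono (fkw_pos (by linarith)) (edgeLe_fkw (by linarith) _) hB2 (marks_mono _ _)

lemma sum_site_finite (A : Finset Site) : ∃ L₀, ∀ L ≥ L₀, A ⊆ box L := by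
  induction A using Finset.induction_on with
  | empty => exact ⟨0, fun L _ => by simp⟩
  | insert x A _ ih =>
    obtain ⟨L₀, h⟩ := ih
    refine ⟨max L₀ (x.1.natAbs + x.2.natAbs), fun L hL => Finset.insert_subset ?_
      (h L (le_of_max_le_left hL))⟩
    have hL' := le_of_max_le_right hL
    rw [mem_box]
    omega

lemma tendsto_of_eventually_mono {a : ℕ → ℝ} (n₀ : ℕ) (h : ∀ n ≥ n₀, a n ≤ a (n + 1))
    (h1 : ∀ n, a n ≤ 1) : ∃ m, Tendsto a atTop (nhds m) := by
  obtain ⟨m, hm⟩ := tendsto_of_mono_le_one (a := fun n => a (n + n₀))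
    (monotone_nat_of_le_succ fun n => by
      have := h (n + n₀) (by omega)
      rwa [show n + 1 + n₀ = n + n₀ + 1 by omega]) fun n => h1 _
  exact ⟨m, (tendsto_add_atTop_iff_nat n₀).1 hm⟩

/-- The marked sites as a model. -/
noncomputable def fzModel (q : ℝ) (hq : 2 ≤ q) : Model Site where
  F := box
  w L := fzw q (box L)
  pos L := fzw_pos hq _
  edge L := edgeLe_fzw hq _
  exh := sum_site_finite
  κ := 16 * q ^ 2
  κ_pos := by positivity
  energy_up L x hx s _ hs := fzw_up hq hx hs
  energy_dn L x hx s _ hs := fzw_dn hq hx hs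
  conv A := by
    obtain ⟨L₀, hL₀⟩ := sum_site_finite A
    refine tendsto_of_eventually_mono L₀ (fun L hL => ?_)
      fun _ => ex_le_one (fzw_pos hq _) fun _ => ind_le_one _
    have hid : LatSym (Equiv.refl Edge) (Equiv.refl Site) := fun e => Or.inl ⟨rfl, rfl⟩
    have := ex_fzw_cyl_map_le hq hid (hL₀ L hL) (B' := box (L + 1)) (by
      simpa using box_mono (Nat.le_succ L))
    simpa using this

lemma fzModel_inv_sh (hq : 2 ≤ q) (z : Site) : (fzModel q hq).Inv (Equiv.addRight z) := by
  obtain ⟨k, hk⟩ := exists_box_map_shift z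
  obtain ⟨k', hk'⟩ := exists_box_map_shift (-z)
  have h := fun A => sum_site_finite A
  choose L₀ hL₀ using h
  refine Model.inv_of _ ⟨k, fun A => ⟨L₀ A, fun L hL => ?_⟩⟩ ⟨k', fun A => ⟨L₀ A, fun L hL => ?_⟩⟩
  · exact ex_fzw_cyl_map_le hq (latSym_shE z) (hL₀ A L hL) (hk L)
  · rw [Equiv.addRight_symm]
    exact ex_fzw_cyl_map_le hq (latSym_shE (-z)) (hL₀ A L hL) (hk' L)

lemma fzModel_inv_iv (hq : 2 ≤ q) : (fzModel q hq).Inv (Equiv.neg Site) := by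
  have h := fun A => sum_site_finite A
  choose L₀ hL₀ using h
  have hk : ∀ L, (box L).map (Equiv.neg Site).toEmbedding ⊆ box (L + 0) := fun L => by
    rw [box_map_neg, add_zero]
  refine Model.inv_of _ ⟨0, fun A => ⟨L₀ A, fun L hL => ?_⟩⟩ ⟨0, fun A => ⟨L₀ A, fun L hL => ?_⟩⟩
  · exact ex_fzw_cyl_map_le hq latSym_ivE (hL₀ A L hL) (hk L)
  · rw [Equiv.neg_symm]
    exact ex_fzw_cyl_map_le hq latSym_ivE (hL₀ A L hL) (hk L)

lemma fzModel_ev_dual (hq : 2 ≤ q) (f : Set Site → ℝ) (lf : IsLocal f) :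
    (fzModel q hq).ev f ≤ (fzModel q hq).ev fun ω => f {x | id x ∉ ω} := by
  obtain ⟨G, hG⟩ := lf
  obtain ⟨L₀, hL₀⟩ := sum_site_finite G
  refine le_of_tendsto_of_tendsto ((fzModel q hq).tendsto ⟨G, hG⟩)
    ((fzModel q hq).tendsto (IsLocal.compl_preimage ⟨G, hG⟩ id)) ?_
  filter_upwards [eventually_ge_atTop L₀] with L hL
  refine le_of_eq ?_
  refine ex_bij (F := box L) (fun s => box L \ s) (fun s => box L \ s) 1 one_pos
    (fun s _ => Finset.sdiff_subset) (fun s _ => Finset.sdiff_subset)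
    (fun s hs => Finset.sdiff_sdiff_eq_self hs) (fun s hs => Finset.sdiff_sdiff_eq_self hs)
    (fun s hs => ?_) fun s _ => ?_
  · change fzw q (box L) (box L \ s) = 1 * fzw q (box L) s
    rw [fzw, fzw, Finset.sdiff_sdiff_eq_self hs, one_mul, mul_comm]
  · rw [hG, hG {x | id x ∉ (s : Set Site)}]
    congr 1
    ext x
    simp only [Set.mem_inter_iff, Finset.coe_sdiff, Set.mem_sdiff, Finset.mem_coe, Set.mem_ofPred_eq, id]
    exact ⟨fun h => ⟨h.1.2, h.2⟩, fun h => ⟨⟨hL₀ L hL h.2, h.1⟩, h.2⟩⟩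

end Fuzzy

section WiredPair

lemma Cn.of_wired_pair {ω : Set Edge} {x y u v : Site} (h : Cn {x, y} ω u v) :
    Cn ∅ ω u v ∨ (Cn ∅ ω u x ∧ Cn ∅ ω v y) ∨ (Cn ∅ ω u y ∧ Cn ∅ ω v x) := by
  have key : (fun a => Cn ∅ ω u a ∨ (Cn ∅ ω u x ∧ Cn ∅ ω a y) ∨ (Cn ∅ ω u y ∧ Cn ∅ ω a x)) u =
      (fun a => Cn ∅ ω u a ∨ (Cn ∅ ω u x ∧ Cn ∅ ω a y) ∨ (Cn ∅ ω u y ∧ Cn ∅ ω a x)) v := by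
    have step : ∀ a b z : Site, Cn ∅ ω a b → Cn ∅ ω a z = Cn ∅ ω b z := fun a b z hab =>
      propext ⟨fun h => hab.symm.trans h, fun h => hab.trans h⟩
    have step' : ∀ a b z : Site, Cn ∅ ω a b → Cn ∅ ω z a = Cn ∅ ω z b := fun a b z hab =>
      propext ⟨fun h => h.trans hab, fun h => h.trans hab.symm⟩
    refine h.eq_of (f := fun a => Cn ∅ ω u a ∨ (Cn ∅ ω u x ∧ Cn ∅ ω a y) ∨
      (Cn ∅ ω u y ∧ Cn ∅ ω a x)) (fun e he => ?_) fun a ha b hb => ?_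
    · have := Cn.of_edge (C := ∅) he
      rw [step _ _ x this, step _ _ y this, step' _ _ u this]
    · have h1 : ∀ a ∈ ({x, y} : Set Site),
          (Cn ∅ ω u a ∨ (Cn ∅ ω u x ∧ Cn ∅ ω a y) ∨ (Cn ∅ ω u y ∧ Cn ∅ ω a x)) ↔
          (Cn ∅ ω u x ∨ Cn ∅ ω u y) := by
        rintro a (rfl | rfl)
        · constructor
          · rintro (h | ⟨h, -⟩ | ⟨h, -⟩)
            exacts [Or.inl h, Or.inl h, Or.inr h]
          · rintro (h | h)
            exacts [Or.inl h, Or.inr (Or.inr ⟨h, .refl _⟩)]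
        · constructor
          · rintro (h | ⟨h, -⟩ | ⟨h, -⟩)
            exacts [Or.inr h, Or.inl h, Or.inr h]
          · rintro (h | h)
            exacts [Or.inr (Or.inl ⟨h, .refl _⟩), Or.inl h]
      exact propext ((h1 a ha).trans (h1 b hb).symm)
  exact key.mp (Or.inl (.refl _))

/-- Wiring two sites lowers the rank by at most one, and only if they are connected. -/
lemma rk_le_rk_pair (x y : Site) (ω : Finset Edge) :
    rk ∅ ω ≤ rk {x, y} ω + if Cn ∅ ↑ω x y then 1 else 0 := by
  induction ω using Finset.induction_on with
  | empty => rw [rk_empty]; omega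
  | insert e ω _ ih =>
    have hmono : Cn ∅ ↑ω x y → Cn ∅ ↑(insert e ω) x y := fun h =>
      h.mono subset_rfl (by rw [Finset.coe_insert]; exact Set.subset_insert _ _)
    by_cases h1 : Cn ∅ ↑ω (src e) (tgt e)
    · rw [rk_insert_of_cn h1, rk_insert_of_cn (h1.mono (Set.empty_subset _) subset_rfl)]
      split_ifs at ih ⊢ with a b
      exacts [ih, ih.trans (by omega), absurd (hmono ‹_›) a, ih]
    · rw [rk_insert_of_not_cn h1]
      by_cases h2 : Cn {x, y} ↑ω (src e) (tgt e)
      · rw [rk_insert_of_cn h2]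
        have hn : ¬Cn ∅ ↑ω x y := fun h => h1 (h2.of_forall (fun e he => .of_edge he) (by
          rintro a (rfl | rfl) b (rfl | rfl)
          exacts [.refl _, h, h.symm, .refl _]))
        have he : Cn ∅ ↑(insert e ω) (src e) (tgt e) := .of_edge (by simp)
        have hi : ∀ {a b}, Cn ∅ ↑ω a b → Cn ∅ ↑(insert e ω) a b := fun h =>
          h.mono subset_rfl (by rw [Finset.coe_insert]; exact Set.subset_insert _ _)
        have hy : Cn ∅ ↑(insert e ω) x y := by
          rcases h2.of_wired_pair with h | ⟨h, h'⟩ | ⟨h, h'⟩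
          · exact absurd h h1
          · exact (hi h).symm.trans (he.trans (hi h'))
          · exact ((hi h).symm.trans (he.trans (hi h'))).symm
        rw [if_neg hn] at ih
        rw [if_pos hy]
        omega
      · rw [rk_insert_of_not_cn h2]
        split_ifs at ih ⊢ with a b
        exacts [by omega, by omega, absurd (hmono ‹_›) a, by omega]

end WiredPair

section Decay

lemma Cn.cr {ω : Set Edge} {u v : Site} (h : Cn ∅ ω u v) : CR (adjE ω) Set.univ u v := by
  induction h with
  | rel a b hab =>
    rcases hab with ⟨e, he, h⟩ | ⟨ha, -⟩
    · exact CR.single ⟨e, he, Or.inl h⟩ trivial trivial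
    · exact ha.elim
  | refl => exact CR.refl _
  | symm _ _ _ ih => exact ih.symm (adjE_symm ω)
  | trans _ _ _ _ _ ih1 ih2 => exact ih1.trans ih2

variable {q : ℝ}

/-- Connections to distant sites reach out of a box. -/
lemma Cn.reach (hq : 1 ≤ q) {ω : Set Edge} {u v : Site} {K : ℕ} (hv : v - u ∉ box K) (h : Cn ∅ ω u v) :
    (fkPerc q hq).reach K ↑(box (K + 1)) 0 ((fkPerc q hq).sh u ⁻¹' ω) := by
  have h1 : CR ((fkPerc q hq).adj ω) Set.univ (0 + u) ((v - u) + u) := by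
    rw [zero_add, sub_add_cancel]
    exact h.cr
  have h2 := (fkPerc q hq).cr_unshift (R := Set.univ) h1 fun _ _ => trivial
  have := (fkPerc q hq).reach_trunc (K := K) (mem_box.2 (by simp)) hv h2
  rwa [Set.univ_inter] at this

lemma marks_single {ω : Finset Edge} {G : Finset Edge} (h : ω ⊆ G) (x : Site) :
    marks G {x} ↑ω = 1 := by
  rw [marks_coe h]
  have : rk ↑({x} : Finset Site) ω = rk ∅ ω := rk_congr fun η _ e _ => by
    rw [Finset.coe_singleton]
    refine ⟨fun h => h.of_forall (fun e he => .of_edge he) ?_,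
      fun h => h.mono (Set.empty_subset _) subset_rfl⟩
    rintro a rfl b rfl
    exact .refl _
  rw [this, div_self (by positivity)]

lemma marks_pair {ω : Finset Edge} {G : Finset Edge} (h : ω ⊆ G) (x y : Site) :
    marks G {x, y} ↑ω ≤ 1 + ind (Cn ∅ ↑ω x y) := by
  rw [marks_coe h, div_le_iff₀ (by positivity)]
  have := rk_le_rk_pair x y ω
  rw [Finset.coe_pair]
  by_cases hc : Cn ∅ ↑ω x y
  · rw [if_pos hc] at this
    calc (2 : ℝ) ^ rk ∅ ω ≤ 2 ^ (rk {x, y} ω + 1) := pow_le_pow_right₀ one_le_two this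
      _ = _ := by rw [ind_true hc, pow_succ]; ring
  · rw [if_neg hc] at this
    calc (2 : ℝ) ^ rk ∅ ω ≤ 2 ^ (rk {x, y} ω) := pow_le_pow_right₀ one_le_two this
      _ = _ := by rw [ind_false hc]; ring

lemma fzModel_decay (hq : 2 ≤ q) (x y : Site) (ε : ℝ) (hε : 0 < ε) : ∀ᶠ n : ℕ in atTop,
    (fzModel q hq).cov (fun ω => ind (x ∈ ω)) (fun ω => ind (Equiv.addRight ((0, n) : Site) y ∈ ω))
      ≤ ε := by
  have hq1 : 1 ≤ q := by linarith
  set M := fzModel q hq with hM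
  set Q := fkPerc q hq1 with hQ
  obtain ⟨K, hK⟩ := (Q.tendsto_θ.eventually (gt_mem_nhds hε)).exists
  filter_upwards [eventually_gt_atTop (K + x.2.natAbs + y.2.natAbs)] with n hn
  set y' := Equiv.addRight ((0, n) : Site) y with hy'
  have hfar : y' - x ∉ box K := by
    rw [mem_box]
    simp only [hy', Equiv.coe_addRight, Prod.snd_add, Prod.snd_sub]
    omega
  have hne : x ≠ y' := by
    rintro h
    rw [← h, sub_self] at hfar
    exact hfar (mem_box.2 (by simp))
  have lm : ∀ x : Site, IsLocal fun ω : Set Site => ind (x ∈ ω) := fun x => (localP_mem x).isLocal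
  have single : ∀ x : Site, M.ev (fun ω => ind (x ∈ ω)) = 2⁻¹ := by
    intro x
    refine tendsto_nhds_unique (M.tendsto (lm x)) (tendsto_const_nhds.congr' ?_)
    obtain ⟨L₀, hL₀⟩ := sum_site_finite {x}
    filter_upwards [eventually_ge_atTop L₀] with L hL
    have h := ex_fzw_cyl (q := q) (hL₀ L hL) (subset_refl _)
    have e1 : (cyl {x} : Set Site → ℝ) = fun ω => ind (x ∈ ω) := by
      funext ω
      exact ind_congr (by simp)
    have e2 : ex (edgesIn (box L)) (fkw q) (marks (edgesIn (box L)) {x}) = 1 := by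
      rw [ex_congr (g := fun _ => 1) fun s hs => marks_single hs x, ex_one (fkw_pos hq1)]
    rw [e1, e2, Finset.card_singleton] at h
    change 2⁻¹ = ex (box L) (fzw q (box L)) fun ω => ind (x ∈ ω)
    rw [h]
    norm_num
  have pair : M.ev (fun ω => ind (x ∈ ω) * ind (y' ∈ ω)) ≤ 4⁻¹ * (1 + Q.θ K) := by
    have lr := (Q.localP_reach_box K 0).preimage (Q.sh x)
    have hθ : Q.ev (fun ω => ind (Q.reach K ↑(box (K + 1)) 0 (Q.sh x ⁻¹' ω))) = Q.θ K :=
      Q.P_preimage (Q.inv_sh x) (Q.localP_reach_box K 0)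
    rw [← hθ]
    refine le_of_tendsto_of_tendsto (M.tendsto ((lm x).mul (lm y')))
      (((Q.tendsto lr.isLocal).const_add 1).const_mul _) ?_
    obtain ⟨L₀, hL₀⟩ := sum_site_finite {x, y'}
    filter_upwards [eventually_ge_atTop L₀] with L hL
    have h := ex_fzw_cyl (q := q) (hL₀ L hL) (subset_refl _)
    have e1 : (cyl {x, y'} : Set Site → ℝ) = fun ω => ind (x ∈ ω) * ind (y' ∈ ω) := by
      funext ω
      rw [← ind_and]
      exact ind_congr (by simp [Set.insert_subset_iff])
    rw [e1, Finset.card_pair hne] at h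
    change ex (box L) (fzw q (box L)) (fun ω => ind (x ∈ ω) * ind (y' ∈ ω)) ≤ _
    rw [h, show ((2 : ℝ) ^ 2)⁻¹ = 4⁻¹ by norm_num]
    refine mul_le_mul_of_nonneg_left ?_ (by norm_num)
    have e3 : 1 + ex (Q.F L) (Q.w L) (fun ω => ind (Q.reach K ↑(box (K + 1)) 0 (Q.sh x ⁻¹' ω))) =
        ex (edgesIn (box L)) (fkw q)
          fun ω => 1 + ind (Q.reach K ↑(box (K + 1)) 0 (Q.sh x ⁻¹' ω)) := by
      rw [ex_add, ex_one (fkw_pos hq1)]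
      rfl
    rw [e3]
    refine ex_mono (fkw_pos hq1) fun s hs => (marks_pair hs x y').trans ?_
    exact add_le_add_right (ind_mono fun hc => hc.reach hq1 hfar) _
  rw [Model.cov, single x, single y']
  linarith

end Decay

section TriAdj

/-- An oriented step of the triangular lattice. -/
def stepT (u v : Site) : Prop :=
  (v.1 = u.1 + 1 ∧ v.2 = u.2) ∨ (v.1 = u.1 ∧ v.2 = u.2 + 1) ∨ (v.1 = u.1 + 1 ∧ v.2 = u.2 + 1)

/-- Adjacency in the triangular lattice. -/
def triAdj (u v : Site) : Prop := stepT u v ∨ stepT v u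

/-- Adjacency in the triangular lattice through marked sites. -/
def adjT (ω : Set Site) (u v : Site) : Prop := u ∈ ω ∧ v ∈ ω ∧ triAdj u v

lemma triAdj_comm {u v : Site} : triAdj u v ↔ triAdj v u := or_comm

lemma triAdj_range {u v : Site} (h : triAdj u v) :
    (v.1 ≤ u.1 + 1 ∧ u.1 ≤ v.1 + 1) ∧ (v.2 ≤ u.2 + 1 ∧ u.2 ≤ v.2 + 1) := by
  unfold triAdj stepT at h
  omega

lemma triAdj_add (z : Site) {u v : Site} : triAdj (u + z) (v + z) ↔ triAdj u v := by
  unfold triAdj stepT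
  simp only [Prod.fst_add, Prod.snd_add]
  omega

lemma triAdj_neg {u v : Site} : triAdj (-u) (-v) ↔ triAdj u v := by
  unfold triAdj stepT
  simp only [Prod.fst_neg, Prod.snd_neg]
  omega

lemma adjT_exit (ω : Set Site) (m : ℕ) (u : Site) (hu : u ∈ col m) (v : Site) (hv : v ∉ col m)
    (h : adjT ω u v) :
    (∃ y ∈ Finset.Icc (-(m : ℤ)) m, v = (1, y) ∧ ((1, y) : Site) ∈ ω) ∨
    (∃ y ∈ Finset.Icc (-(m : ℤ)) m, v = (-1, y) ∧ ((-1, y) : Site) ∈ ω) ∨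
    ∃ b ∈ ({(0, (m : ℤ) + 1), (0, -(m : ℤ) - 1), (1, (m : ℤ) + 1), (-1, -(m : ℤ) - 1)} : Finset Site),
      b ∈ ω := by
  obtain ⟨-, hvω, h⟩ := h
  obtain ⟨x, y⟩ := v
  obtain ⟨x', y'⟩ := u
  simp only [triAdj, stepT, col, Set.mem_ofPred_eq] at h hu hv
  have h3 : x = 0 ∨ x = 1 ∨ x = -1 := by omega
  rcases h3 with rfl | rfl | rfl
  · have : y = m + 1 ∨ y = -(m : ℤ) - 1 := by omega
    exact Or.inr (Or.inr ⟨(0, y), by rcases this with rfl | rfl <;> simp, hvω⟩)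
  · by_cases hy : y ≤ m
    · exact Or.inl ⟨y, Finset.mem_Icc.2 (by omega), rfl, hvω⟩
    · have : y = m + 1 := by omega
      exact Or.inr (Or.inr ⟨(1, y), by rw [this]; simp, hvω⟩)
  · by_cases hy : -(m : ℤ) ≤ y
    · exact Or.inr (Or.inl ⟨y, Finset.mem_Icc.2 (by omega), rfl, hvω⟩)
    · have : y = -(m : ℤ) - 1 := by omega
      exact Or.inr (Or.inr ⟨(-1, y), by rw [this]; simp, hvω⟩)

/-- The sites of the column. -/
noncomputable def insT (m : ℕ) : Finset Site := (Finset.Icc (-(m : ℤ)) m).image fun y => (0, y)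

lemma mem_insT {m : ℕ} {x : Site} : x ∈ insT m ↔ x ∈ col m := by
  rw [insT, Finset.mem_image]
  constructor
  · rintro ⟨y, hy, rfl⟩
    exact ⟨rfl, Finset.mem_Icc.1 hy⟩
  · rintro ⟨h, hy⟩
    exact ⟨x.2, Finset.mem_Icc.2 hy, by rw [← h]⟩

lemma planar_adjT (ω : Set Site) (m M : ℕ) (y₁ w₁ y₂ w₂ : ℤ) (v₁ v₂ : Site) (hM : m < M)
    (h0 : -(m : ℤ) ≤ y₁) (h1 : y₁ < w₁) (h2 : w₁ < y₂) (h3 : y₂ < w₂) (h4 : w₂ ≤ m)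
    (hc : CR (adjT ω) (↑(box M) \ col m) (1, y₁) (1, y₂))
    (hw₁ : ((1, w₁) : Site) ∉ ω) (hw₂ : ((1, w₂) : Site) ∉ ω)
    (hv₁ : v₁ ∉ box M) (hv₂ : v₂ ∉ box M)
    (hc₁ : CR (adjT ωᶜ) (col m)ᶜ (1, w₁) v₁) (hc₂ : CR (adjT ωᶜ) (col m)ᶜ (1, w₂) v₂) : False := by
  set R : Set Site := ω ∩ (↑(box M) \ col m) with hR
  set E : Set Edge := {e | (src e ∈ R ∧ tgt e ∈ R) ∨
    ∃ x ∈ R, x + (1, 1) ∈ R ∧ (e = (x, false) ∨ e = (x + (1, 0), true))} with hE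
  have step : ∀ a ∈ R, ∀ b ∈ R, stepT a b → Cn ∅ E a b := by
    rintro ⟨x, y⟩ ha ⟨x', y'⟩ hb h
    simp only [stepT] at h
    rcases h with ⟨rfl, rfl⟩ | ⟨rfl, rfl⟩ | ⟨rfl, rfl⟩
    · exact .of_edge (e := ((x, y'), false)) (Or.inl ⟨ha, hb⟩)
    · exact .of_edge (e := ((x', y), true)) (Or.inl ⟨ha, hb⟩)
    · exact (Cn.of_edge (e := ((x, y), false)) (Or.inr ⟨_, ha, hb, Or.inl rfl⟩)).trans
        (.of_edge (e := ((x + 1, y), true)) (Or.inr ⟨_, ha, hb, Or.inr (by simp)⟩))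
  have hcn : Cn ∅ E (1, y₁) (1, y₂) := by
    refine hc.cn fun a ha b hb hab => ?_
    obtain ⟨ha', hb', h | h⟩ := hab
    · exact step a ⟨ha', ha⟩ b ⟨hb', hb⟩ h
    · exact (step b ⟨hb', hb⟩ a ⟨ha', ha⟩ h).symm
  obtain ⟨γ, hγ, hb⟩ := hcn.exists_chain
  have hbox : ∀ x : Site, x ∈ R → x + (1, 1) ∈ R → x + (1, 0) ∈ box M := by
    intro x h h'
    have e1 := mem_box.1 h.2.1
    have e2 := mem_box.1 h'.2.1
    rw [mem_box]
    simp only [Prod.fst_add, Prod.snd_add] at e1 e2 ⊢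
    omega
  have tgt_false : ∀ x : Site, tgt (x, false) = x + (1, 0) := fun x => by simp [tgt, Prod.ext_iff]
  have tgt_true : ∀ x : Site, tgt (x, true) = x + (0, 1) := fun x => by simp [tgt, Prod.ext_iff]
  obtain ⟨z, hz, hzM, hzr, hne⟩ := exists_cycle hM h0 h1 h2 h3 h4 hb
    (fun e he => by
      rcases hγ e he with h | ⟨x, hx, hx', rfl | rfl⟩
      · exact ⟨h.1.2.1, h.2.2.1⟩
      · rw [tgt_false]
        exact ⟨hx.2.1, hbox x hx hx'⟩
      · rw [tgt_true, add_assoc, src_mk]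
        exact ⟨hbox x hx hx', hx'.2.1⟩) (fun y hy hy' => by
      by_contra hn
      have hcol : ((0, y) : Site) ∈ col m := ⟨rfl, hy, hy'⟩
      rcases hγ _ hn with h | ⟨x, hx, -, h | h⟩
      · exact h.1.2.2 hcol
      · rw [← (Prod.mk.inj h).1] at hx
        exact hx.2.2 hcol
      · exact Bool.false_ne_true (Prod.mk.inj h).2)
  have hright : ∀ d, d ∉ ω → d ∉ col m → z (d, false) = 0 := by
    intro d hd hd'
    by_contra hn
    rcases hzr _ hn with h | h | h | h
    · rcases hγ _ h with h | ⟨x, hx, -, h | h⟩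
      · exact hd h.1.1
      · rw [(Prod.mk.inj h).1] at hd
        exact hd hx.1
      · exact Bool.false_ne_true (Prod.mk.inj h).2
    · refine hd' ?_
      rw [(Prod.mk.inj h).1]
      have e1 : y₁ ≤ m := by omega
      exact ⟨rfl, h0, e1⟩
    · refine hd' ?_
      rw [(Prod.mk.inj h).1]
      have e1 : y₂ ≤ m := by omega
      have e2 : -(m : ℤ) ≤ y₂ := by omega
      exact ⟨rfl, e2, e1⟩
    · exact hd' h.1
  have hbelow : ∀ d : Site, d ∉ ω → d ∉ col m → z (d - (0, 1), true) = 0 := by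
    intro d hd hd'
    have ht' : tgt (d - (0, 1), true) = d := by rw [tgt_true, sub_add_cancel]
    by_contra hn
    rcases hzr _ hn with h | h | h | h
    · rcases hγ _ h with h | ⟨x, -, hx, h | h⟩
      · rw [ht'] at h
        exact hd h.2.1
      · exact Bool.false_ne_true (Prod.mk.inj h).2.symm
      · have : d = x + (1, 1) := by
          rw [← ht', h, tgt_true, add_assoc]
          rfl
        rw [this] at hd
        exact hd hx.1
    · exact Bool.false_ne_true (Prod.mk.inj h).2.symm
    · exact Bool.false_ne_true (Prod.mk.inj h).2.symm
    · rw [ht'] at h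
      exact hd' h.2
  have hup : ∀ x y : ℤ, ((x, y) : Site) ∉ ω → ((x, y) : Site) ∉ col m →
      ht (x, y - 1) z = ht (x, y) z := fun x y hd hd' => by
    have := ht_col x y z
    rw [hright _ hd hd'] at this
    exact CharTwo.add_eq_zero.1 this
  have hleft : ∀ x y : ℤ, ((x, y) : Site) ∉ ω → ((x, y) : Site) ∉ col m →
      ht (x - 1, y - 1) z = ht (x, y - 1) z := fun x y hd hd' => by
    have := ht_row x (y - 1) z
    have e1 : z ((x, y - 1), true) = 0 := by
      have := hbelow _ hd hd'
      rwa [Prod.mk_sub_mk, sub_zero] at this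
    rw [e1, hz, map_zero, add_zero] at this
    exact CharTwo.add_eq_zero.1 this
  have hstep : ∀ a b : Site, a ∉ ω → a ∉ col m → b ∉ ω → b ∉ col m → stepT a b →
      ht (a.1, a.2 - 1) z = ht (b.1, b.2 - 1) z := by
    rintro ⟨x, y⟩ ⟨x', y'⟩ ha ha' hb hb' h
    simp only [stepT] at h ⊢
    rcases h with ⟨rfl, rfl⟩ | ⟨rfl, rfl⟩ | ⟨rfl, rfl⟩
    · have := hleft _ _ hb hb'
      rwa [add_sub_cancel_right] at this
    · rw [add_sub_cancel_right]
      exact hup _ _ ha ha'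
    · have := hleft _ _ hb hb'
      rw [add_sub_cancel_right, add_sub_cancel_right] at this
      rw [add_sub_cancel_right]
      exact (hup _ _ ha ha').trans this
  have key : ∀ (w : ℤ) (v : Site), v ∉ box M → ((1, w) : Site) ∉ ω → CR (adjT ωᶜ) (col m)ᶜ (1, w) v →
      ht (0, w - 1) z = 0 := by
    intro w v hv hw hcr
    have e1 := hleft 1 w hw (fun h => one_ne_zero h.1)
    rw [sub_self] at e1
    have e2 := hcr.eq_of (f := fun x : Site => ht (x.1, x.2 - 1) z) fun a ha b hb hab => by
      obtain ⟨ha', hb', h | h⟩ := hab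
      · exact hstep a b ha' ha hb' hb h
      · exact (hstep b a hb' hb ha' ha h).symm
    rw [e1]
    refine e2.trans ?_
    have h00 := fun {x : Site} => ht_eq_zero hz (fun e he => (hzM e he).1) (x := x)
    obtain ⟨x, y⟩ := v
    have e3 := ht_col x y z
    have e4 : z ((x, y), false) = 0 := by
      by_contra hn
      exact hv (hzM _ hn).1
    rwa [e4, h00 hv, add_zero] at e3
  exact hne ((key w₁ v₁ hv₁ hw₁ hc₁).trans (key w₂ v₂ hv₂ hw₂ hc₂).symm)

/-- The marked sites as a planar percolation model. -/
noncomputable def fzPerc (q : ℝ) (hq : 2 ≤ q) : Perc Site where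
  toModel := fzModel q hq
  sh := Equiv.addRight
  iv := Equiv.neg Site
  sh_add z z' x := by
    simp only [Equiv.coe_addRight]
    abel
  inv_sh := fzModel_inv_sh hq
  inv_iv := fzModel_inv_iv hq
  adj := adjT
  adj_symm ω u v h := ⟨h.2.1, h.1, triAdj_comm.1 h.2.2⟩
  adj_mono ω ω' u v hs h := ⟨hs h.1, hs h.2.1, h.2.2⟩
  adj_range ω u v h := triAdj_range h.2.2
  loc u v := {u, v}
  adj_loc ω u v h := ⟨⟨h.1, by simp⟩, ⟨h.2.1, by simp⟩, h.2.2⟩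
  adj_sh z ω u v := by
    unfold adjT
    rw [triAdj_add]
    rfl
  adj_iv ω u v := by
    unfold adjT
    rw [triAdj_neg]
    rfl
  dm := id
  ev_dual f lf _ := fzModel_ev_dual hq f lf
  sR y := (1, y)
  sL y := (-1, y)
  iv_sR y := rfl
  decay := fzModel_decay hq
  ends m := {(0, (m : ℤ) + 1), (0, -(m : ℤ) - 1), (1, (m : ℤ) + 1), (-1, -(m : ℤ) - 1)}
  ends_card m := Finset.card_le_four
  exit := adjT_exit
  ins := insT
  ins_conn ω m h u hu v hv := by
    refine cr_col (fun a b h => ⟨h.2.1, h.1, triAdj_comm.1 h.2.2⟩) (fun y h1 h2 => ?_) hu hv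
    have h3 : -(m : ℤ) ≤ y + 1 := by omega
    have h4 : y + 1 ≤ (m : ℤ) := by omega
    exact ⟨h (mem_insT.2 ⟨rfl, h1, h2.le⟩), h (mem_insT.2 ⟨rfl, h3, h4⟩),
      Or.inl (Or.inr (Or.inl ⟨rfl, rfl⟩))⟩
  ins_adj ω m h y hy hs := ⟨h (mem_insT.2 ⟨rfl, Finset.mem_Icc.1 hy⟩), hs, Or.inl (Or.inl ⟨rfl, rfl⟩)⟩
  ins_out ω m u hu v hv h := ⟨h.1.resolve_right fun hi => hu (mem_insT.1 hi),
    h.2.1.resolve_right fun hi => hv (mem_insT.1 hi), h.2.2⟩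
  planar ω m M y₁ w₁ y₂ w₂ v₁ v₂ hM h0 h1 h2 h3 h4 _ _ hc hw₁ hw₂ hv₁ hv₂ hc₁ hc₂ :=
    planar_adjT ω m M y₁ w₁ y₂ w₂ v₁ v₂ hM h0 h1 h2 h3 h4 hc hw₁ hw₂ hv₁ hv₂ hc₁ hc₂

end TriAdj

section Domain

variable {q : ℝ}

/-- The sites of `U` with a neighbour outside `U`. -/
noncomputable def bdy (U : Finset Site) : Finset Site := U.filter fun x => ∃ y, triAdj x y ∧ y ∉ U

/-- The edges which, with their dual, lie inside `U`. -/
noncomputable def core (U : Finset Site) : Finset Edge := (edgesIn U).filter fun e => dl e ∈ edgesIn U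

/-- The random-cluster weight of a domain with half-wired boundary. -/
noncomputable def dw (q : ℝ) (U : Finset Site) : Finset Edge → ℝ :=
  wt √q (q / 2) 2 (↑(U \ bdy U))ᶜ

lemma bdy_subset (U : Finset Site) : bdy U ⊆ U := Finset.filter_subset _ _

lemma mem_compl_sdiff_bdy {U : Finset Site} {x : Site} :
    x ∈ ((↑(U \ bdy U) : Set Site)ᶜ) ↔ x ∉ U ∨ ∃ y, triAdj x y ∧ y ∉ U := by
  by_cases h : x ∈ U <;> simp [bdy, h]

lemma ends_of_notMem_core {U : Finset Site} {e : Edge} (he : e ∉ core U) :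
    (src e ∈ ((↑(U \ bdy U) : Set Site)ᶜ) ∧ tgt e ∈ ((↑(U \ bdy U) : Set Site)ᶜ)) ∧
    (src (dl e) ∈ ((↑(U \ bdy U) : Set Site)ᶜ) ∧ tgt (dl e) ∈ ((↑(U \ bdy U) : Set Site)ᶜ)) := by
  have key : ∀ a b c : Site, triAdj a b → triAdj a c → (a ∉ U ∨ b ∉ U ∨ c ∉ U) →
      a ∈ ((↑(U \ bdy U) : Set Site)ᶜ) := by
    rintro a b c hb hc (h | h | h) <;> rw [mem_compl_sdiff_bdy]
    exacts [Or.inl h, Or.inr ⟨b, hb, h⟩, Or.inr ⟨c, hc, h⟩]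
  rw [core, Finset.mem_filter, mem_edgesIn, mem_edgesIn] at he
  obtain ⟨⟨x, y⟩, _ | _⟩ := e
  · simp only [dl_h, src_mk, tgt_h, tgt_v, sub_add_cancel] at he ⊢
    have h : (x, y) ∉ U ∨ (x + 1, y) ∉ U ∨ (x, y - 1) ∉ U := by tauto
    refine ⟨⟨key _ (x + 1, y) (x, y - 1) ?_ ?_ h, key _ (x, y) (x, y - 1) ?_ ?_ (by tauto)⟩,
      key _ (x, y) (x + 1, y) ?_ ?_ (by tauto), key _ (x + 1, y) (x, y - 1) ?_ ?_ h⟩ <;>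
    simp [triAdj, stepT]
  · simp only [dl_v, src_mk, tgt_h, tgt_v, sub_add_cancel] at he ⊢
    have h : (x, y) ∉ U ∨ (x, y + 1) ∉ U ∨ (x - 1, y) ∉ U := by tauto
    refine ⟨⟨key _ (x, y + 1) (x - 1, y) ?_ ?_ h, key _ (x, y) (x - 1, y) ?_ ?_ (by tauto)⟩,
      key _ (x, y) (x, y + 1) ?_ ?_ (by tauto), key _ (x, y + 1) (x - 1, y) ?_ ?_ h⟩ <;>
    simp [triAdj, stepT]

lemma one_le_fac_mul_fac (h2 : 2 ≤ q) (h4 : q ≤ 4) {C : Set Site} {ω η : Set Edge} {e e' : Edge}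
    (h : Cn ∅ ω (src e) (tgt e) ∨ Cn C η (src e') (tgt e'))
    (h' : Cn ∅ η (src e') (tgt e') ∨ Cn C ω (src e) (tgt e)) :
    1 ≤ fac √q (q / 2) 2 C ω e * fac √q (q / 2) 2 C η e' := by
  have m1 : Cn ∅ ω (src e) (tgt e) → Cn C ω (src e) (tgt e) :=
    fun h => h.mono (Set.empty_subset C) subset_rfl
  have m2 : Cn ∅ η (src e') (tgt e') → Cn C η (src e') (tgt e') :=
    fun h => h.mono (Set.empty_subset C) subset_rfl
  unfold fac
  rw [div_mul_div_comm, Real.mul_self_sqrt (by linarith), one_le_div (by positivity)]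
  unfold dr
  by_cases a : Cn ∅ ω (src e) (tgt e) <;> by_cases b : Cn ∅ η (src e') (tgt e')
  · simp only [a, b, m1 a, m2 b, if_true]; norm_num; linarith
  · have := h'.resolve_left b
    by_cases c : Cn C η (src e') (tgt e') <;> simp only [a, b, c, this, if_true, if_false]
    · norm_num; nlinarith
    · norm_num
  · have := h.resolve_left a
    by_cases c : Cn C ω (src e) (tgt e) <;> simp only [a, b, c, this, if_true, if_false]
    · norm_num; nlinarith
    · norm_num
  · simp only [a, b, h.resolve_left a, h'.resolve_left b, if_true, if_false]
    norm_num
    nlinarith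

lemma dw_pos (hq : 2 ≤ q) (U : Finset Site) (s : Finset Edge) : 0 < dw q U s :=
  wt_pos (Real.sqrt_pos.2 (by linarith)) (by linarith) two_pos s

lemma edgeLe_dw (hq : 2 ≤ q) (U : Finset Site) (F : Finset Edge) : EdgeLe F (dw q U) (dw q U) :=
  edgeLe_wt (Real.sqrt_pos.2 (by linarith)) (by linarith) one_le_two F

lemma edgeLe_dw_dual (h2 : 2 ≤ q) (h4 : q ≤ 4) (U : Finset Site) :
    EdgeLe (core U) (fun s => dw q U ((core U \ s).map dl.toEmbedding)) (dw q U) := by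
  refine edgeLe_of_ratio (fun s => dw_pos h2 U _) (dw_pos h2 U) fun s t e hst htT heT het =>
    ⟨fac √q (q / 2) 2 (↑(U \ bdy U))ᶜ t e, ?_, ?_⟩
  · rw [map_dl_sdiff heT (fun h => het (hst h))]
    unfold dw
    rw [wt_insert (dl_notMem_map_sdiff _ s e), mul_comm (wt _ _ _ _ _), ← mul_assoc]
    refine le_mul_of_one_le_left (dw_pos h2 U _).le (one_le_fac_mul_fac h2 h4 ?_ ?_)
    · by_cases h : Cn ∅ ↑t (src e) (tgt e)
      · exact Or.inl h
      · refine Or.inr ((cn_dual_of_not_cn h).of_forall ?_ ?_)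
        · rintro _ ⟨e', ⟨h1, h3⟩, rfl⟩
          by_cases hc : e' ∈ core U
          · refine .of_edge ?_
            rw [Finset.mem_coe, Finset.mem_map_equiv, Equiv.symm_apply_apply]
            simp only [Finset.mem_sdiff, Finset.mem_insert, not_or]
            exact ⟨hc, h3, fun h => h1 (hst h)⟩
          · exact .of_wired (ends_of_notMem_core hc).2.1 (ends_of_notMem_core hc).2.2
        · simp
    · by_cases h : Cn ∅ ↑((core U \ insert e s).map dl.toEmbedding) (src (dl e)) (tgt (dl e))
      · exact Or.inl h
      · have := cn_dual_symm_of_not_cn h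
        rw [Equiv.symm_apply_apply] at this
        refine Or.inr (this.of_forall ?_ ?_)
        · rintro _ ⟨e', ⟨h1, h3⟩, rfl⟩
          obtain ⟨e', rfl⟩ := dl.surjective e'
          rw [Equiv.symm_apply_apply]
          rw [Finset.mem_map_equiv, Equiv.symm_apply_apply] at h1
          simp only [Finset.mem_sdiff, Finset.mem_insert, not_or, not_and, not_not] at h1
          by_cases hc : e' ∈ core U
          · exact .of_edge (hst (h1 hc (fun h => h3 (by rw [h]))))
          · exact .of_wired (ends_of_notMem_core hc).1.1 (ends_of_notMem_core hc).1.2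
        · simp
  · unfold dw
    rw [wt_insert het, mul_comm]

/-- In a half-wired domain the primal configuration dominates the dual one. -/
lemma ex_dw_dual_le (h2 : 2 ≤ q) (h4 : q ≤ 4) (U : Finset Site) {f : Set Edge → ℝ}
    (hf : Monotone f) (hd : DepOn ↑(core U) f) :
    ex (edgesIn U) (dw q U) (fun ω => f (dual ω)) ≤ ex (edgesIn U) (dw q U) f := by
  have hsub : (core U).map dl.toEmbedding ⊆ edgesIn U := by
    intro e he
    rw [Finset.mem_map_equiv, core, Finset.mem_filter, Equiv.apply_symm_apply] at he
    exact he.2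
  have h1 := ex_domain_mono (dw_pos h2 U) (edgeLe_dw h2 U _) hsub
    (f := fun ω => 0 - f (dual ω)) fun s t hst => sub_le_sub_left (hf (dual_anti hst)) 0
  rw [ex_sub (f := fun _ => 0), ex_sub (f := fun _ => 0), ex_dual _ _ hd] at h1
  have h3 := holley (fun s => dw_pos h2 U _) (dw_pos h2 U) (edgeLe_dw_dual h2 h4 U) hf
  have h5 : ex (core U) (dw q U) f ≤ ex (edgesIn U) (dw q U) f :=
    ex_domain_mono (dw_pos h2 U) (edgeLe_dw h2 U _) (Finset.filter_subset _ _) hf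
  have e0 : ∀ F : Finset Edge, ex F (dw q U) (fun _ => 0) = 0 := fun F => by simp [ex, wsum]
  rw [e0, e0] at h1
  linarith

end Domain

section Explore

variable {q : ℝ} {B U : Finset Site}

/-- The sites of `B` not joined to the outside of `B` by unmarked sites. -/
noncomputable def dom (B : Finset Site) (S : Set Site) : Finset Site :=
  B.filter fun x => ¬∃ v, v ∉ B ∧ CR (adjT Sᶜ) Set.univ x v

lemma mem_dom {S : Set Site} {x : Site} :
    x ∈ dom B S ↔ x ∈ B ∧ ∀ v, v ∉ B → ¬CR (adjT Sᶜ) Set.univ x v := by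
  simp [dom]

lemma dom_subset (B : Finset Site) (S : Set Site) : dom B S ⊆ B := Finset.filter_subset _ _

lemma subset_dom {S : Finset Site} (hS : S ⊆ B) : S ⊆ dom B S := by
  intro x hx
  refine mem_dom.2 ⟨hS hx, fun v hv h => ?_⟩
  obtain ⟨a, ha, b, hb, hab, -⟩ := h.first_exit (A := ↑S) hx (fun h => hv (hS h))
  exact hab.1 ha

lemma bdy_dom_subset {S : Finset Site} (hS : S ⊆ B) : bdy (dom B S) ⊆ S := by
  intro x hx
  rw [bdy, Finset.mem_filter] at hx
  obtain ⟨hx, y, hxy, hy⟩ := hx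
  by_contra hxS
  obtain ⟨hxB, hx⟩ := mem_dom.1 hx
  have hyS : y ∉ S := fun h => hy (subset_dom hS h)
  have hstep : CR (adjT (↑S)ᶜ) Set.univ x y :=
    CR.single ⟨by simpa using hxS, by simpa using hyS, hxy⟩ trivial trivial
  by_cases hyB : y ∈ B
  · rw [mem_dom] at hy
    push Not at hy
    obtain ⟨v, hv, h⟩ := hy hyB
    exact hx v hv (hstep.trans h)
  · exact hx y hyB hstep

lemma dom_eq_of_between {S S' : Finset Site} (h1 : bdy (dom B S) ⊆ S')
    (h2 : S' ⊆ dom B S) : dom B S' = dom B S := by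
  have hUB := dom_subset B S
  ext x
  constructor
  · intro hx
    obtain ⟨hxB, hx⟩ := mem_dom.1 hx
    refine mem_dom.2 ⟨hxB, fun v hv h => hx v hv ?_⟩
    have key : ∀ a, CR (adjT (↑S)ᶜ) Set.univ a v → CR (adjT (↑S')ᶜ) Set.univ a v := by
      intro a ha
      refine Relation.ReflTransGen.head_induction_on ha (CR.refl v) fun {a b} hab hb ih => ?_
      have out : ∀ c, CR (adjT (↑S)ᶜ) Set.univ c v → c ∉ S' := fun c hc hcS =>
        (mem_dom.1 (h2 hcS)).2 v hv hc
      exact (CR.single (R := Set.univ) ⟨by simpa using out a (Relation.ReflTransGen.head hab hb),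
        by simpa using out b hb, hab.1.2.2⟩ trivial trivial).trans ih
    exact key x h
  · intro hx
    refine mem_dom.2 ⟨hUB hx, fun v hv h => ?_⟩
    obtain ⟨a, ha, b, hb, hab, -⟩ := h.first_exit (A := ↑(dom B ↑S)) hx (fun h => hv (hUB h))
    exact hab.1 (h1 (Finset.mem_filter.2 ⟨ha, b, hab.2.2, hb⟩))

lemma compat_of_bdy {S : Finset Site} {ω : Set Edge} (h1 : bdy U ⊆ S) (h2 : S ⊆ U)
    (h : compat ↑S ω) : compat ↑U ω := by
  have key : ∀ a b : Site, triAdj a b → a ∈ U → (a ∈ S ↔ b ∈ S) → b ∈ U := fun a b hab ha hS => by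
    by_contra hb
    exact hb (h2 (hS.1 (h1 (Finset.mem_filter.2 ⟨ha, b, hab, hb⟩))))
  intro e he
  have hS := h e he
  have hadj : triAdj (src e) (tgt e) := by
    obtain ⟨⟨x, y⟩, _ | _⟩ := e <;> simp [src_mk, tgt_h, tgt_v, triAdj, stepT]
  exact ⟨fun hu => key _ _ hadj hu hS, fun hu => key _ _ (triAdj_comm.1 hadj) hu hS.symm⟩

lemma dw_eq {ω : Finset Edge} (hω : ω ⊆ edgesIn U) :
    dw q U ω = bw q ω / 2 ^ rk ↑(bdy U) ω := by
  unfold dw bw wt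
  rw [rk_wired_compl hω, one_pow, mul_one, div_div]

lemma sum_fiber (hU : U ⊆ B) {h : Set Edge → ℝ} (hd : DepOn ↑(edgesIn U) h) :
    ∑ S ∈ U.powerset, ind (bdy U ⊆ S) *
      ∑ ω ∈ (edgesIn B).powerset, ind (compat S ω) * (bw q ω * h ω) =
    part q (B \ U) * (2 ^ (U \ bdy U).card * wsum (edgesIn U) (dw q U) h) := by
  have inner : ∀ S ∈ U.powerset, ind (bdy U ⊆ S) *
      ∑ ω ∈ (edgesIn B).powerset, ind (compat S ω) * (bw q ω * h ω) =
      part q (B \ U) * (ind (bdy U ⊆ S) *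
        ∑ ω ∈ (edgesIn U).powerset, ind (compat S ω) * (bw q ω * h ω)) := by
    intro S hS
    rw [Finset.mem_powerset] at hS
    by_cases hb : bdy U ⊆ S
    swap
    · rw [ind_false hb, zero_mul, zero_mul, mul_zero]
    rw [ind_true hb, one_mul, one_mul]
    have e1 : ∑ ω ∈ (edgesIn B).powerset, ind (compat S ω) * (bw q ω * h ω) =
        ∑ ω ∈ (edgesIn B).powerset, ind (compat U ω) * (ind (compat S ω) * (bw q ω * h ω)) := by
      refine Finset.sum_congr rfl fun ω _ => ?_
      by_cases hc : compat ↑S ↑ω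
      · rw [ind_true (compat_of_bdy hb hS hc), one_mul]
      · rw [ind_false hc, zero_mul, mul_zero]
    rw [e1, sum_compat hU, part, zsum, Finset.sum_mul_sum]
    refine Finset.sum_congr rfl fun ω₁ h₁ => Finset.sum_congr rfl fun ω₂ h₂ => ?_
    have m₁ : ∀ e ∈ ω₁, src e ∉ U ∧ tgt e ∉ U := fun e he => by
      have := mem_edgesIn.1 (Finset.mem_powerset.1 h₁ he)
      exact ⟨(Finset.mem_sdiff.1 this.1).2, (Finset.mem_sdiff.1 this.2).2⟩
    have m₂ : ∀ e ∈ ω₂, src e ∈ U ∧ tgt e ∈ U := fun e he =>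
      mem_edgesIn.1 (Finset.mem_powerset.1 h₂ he)
    rw [bw_union (R := ↑U) m₁ m₂]
    have e2 : ind (compat ↑S ↑(ω₁ ∪ ω₂)) = ind (compat ↑S ↑ω₂) := by
      refine ind_congr ⟨fun hc e he => hc e (by simp at he ⊢; exact Or.inr he), fun hc e he => ?_⟩
      rw [Finset.mem_coe, Finset.mem_union] at he
      rcases he with he | he
      · exact iff_of_false (fun hs => (m₁ e he).1 (hS hs)) fun hs => (m₁ e he).2 (hS hs)
      · exact hc e he
    have e3 : h ↑(ω₁ ∪ ω₂) = h ↑ω₂ := by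
      rw [hd, hd ↑ω₂]
      congr 1
      ext e
      simp only [Finset.coe_union, Set.mem_inter_iff, Set.mem_union, Finset.mem_coe, mem_edgesIn]
      exact ⟨fun hh => ⟨hh.1.resolve_left fun h' => (m₁ e h').1 hh.2.1, hh.2⟩,
        fun hh => ⟨Or.inr hh.1, hh.2⟩⟩
    rw [e2, e3]
    ring
  rw [Finset.sum_congr rfl inner, ← Finset.mul_sum,
    sum_joint (bdy_subset U) fun ω => bw q ω * h ω, wsum]
  congr 2
  refine Finset.sum_congr rfl fun ω hω => ?_
  rw [dw_eq (Finset.mem_powerset.1 hω)]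
  ring

lemma depOn_sub_dual {f : Set Edge → ℝ} (hf : DepOn ↑(core U) f) :
    DepOn ↑(edgesIn U) fun ω => f ω - f (dual ω) := by
  have hc : core U ⊆ edgesIn U := Finset.filter_subset _ _
  intro ω
  simp only
  rw [← hf.mono (by exact_mod_cast hc) ω, hf (dual ω), hf (dual (ω ∩ _))]
  congr 2
  ext e
  simp only [dual, Set.mem_inter_iff, Set.mem_ofPred_eq, Finset.mem_coe]
  refine and_congr_left fun he => not_congr ?_
  exact ⟨fun h => ⟨h, (Finset.mem_filter.1 he).2⟩, fun h => h.1⟩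

lemma edgesIn_box_subset_core {r : ℕ} (h : box (r + 1) ⊆ U) : edgesIn (box r) ⊆ core U := by
  intro e he
  refine Finset.mem_filter.2 ⟨edgesIn_mono ((box_mono (Nat.le_succ r)).trans h) he,
    edgesIn_mono h ?_⟩
  have := edgesIn_subset_dual r he
  rwa [Finset.mem_map_equiv, Equiv.symm_symm] at this

lemma filter_dom_eq (S₀ : Finset Site) (g : Finset Site → ℝ) :
    ∑ S ∈ B.powerset.filter (fun S : Finset Site => dom B ↑S = dom B ↑S₀), g S =
      ∑ S ∈ (dom B ↑S₀).powerset, ind (bdy (dom B ↑S₀) ⊆ S) * g S := by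
  have hUB := dom_subset B S₀
  have e : ∀ S ∈ (dom B ↑S₀).powerset, ind (bdy (dom B ↑S₀) ⊆ S) * g S =
      if bdy (dom B ↑S₀) ⊆ S then g S else 0 := fun S _ => by
    by_cases h : bdy (dom B ↑S₀) ⊆ S <;> simp [h, ind]
  rw [Finset.sum_congr rfl e, ← Finset.sum_filter]
  refine Finset.sum_congr ?_ fun _ _ => rfl
  ext S
  simp only [Finset.mem_filter, Finset.mem_powerset]
  constructor
  · rintro ⟨h1, h2⟩
    rw [← h2]
    exact ⟨subset_dom h1, bdy_dom_subset h1⟩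
  · rintro ⟨h1, h2⟩
    exact ⟨h1.trans hUB, dom_eq_of_between h2 h1⟩

lemma sum_joint_empty (B : Finset Site) (g : Finset Edge → ℝ) :
    ∑ S ∈ B.powerset, ∑ ω ∈ (edgesIn B).powerset, ind (compat S ω) * (bw q ω * g ω) =
      2 ^ B.card * ∑ ω ∈ (edgesIn B).powerset, fkw q ω * g ω := by
  have := sum_joint (Finset.empty_subset B) fun ω => bw q ω * g ω
  simp only [Finset.empty_subset, ind_true, one_mul, Finset.sdiff_empty, Finset.coe_empty] at this
  rw [this]
  congr 1
  refine Finset.sum_congr rfl fun ω _ => ?_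
  rw [fkw_eq_bw]
  ring

lemma zsum_fzw (B : Finset Site) : zsum B (fzw q B) = 2 ^ B.card * zsum (edgesIn B) (fkw q) := by
  have := sum_joint_empty (q := q) B fun _ => 1
  simp only [mul_one] at this
  rw [zsum, zsum, ← this]
  exact Finset.sum_congr rfl fun S hS => (sum_compat_bw (Finset.mem_powerset.1 hS)).symm

/-- The dual configuration is almost dominated by the primal one. -/
lemma ex_dual_le (h2 : 2 ≤ q) (h4 : q ≤ 4) {r : ℕ} {f : Set Edge → ℝ}
    (hf : Monotone f) (h0 : ∀ ω, 0 ≤ f ω) (h1 : ∀ ω, f ω ≤ 1) (hd : DepOn ↑(edgesIn (box r)) f) :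
    ex (edgesIn B) (fkw q) (fun ω => f (dual ω)) ≤
      ex (edgesIn B) (fkw q) f + ex B (fzw q B) fun S => ind (¬box (r + 1) ⊆ dom B S) := by
  set h : Set Edge → ℝ := fun ω => f ω - f (dual ω) with hh
  set J : Finset Site → ℝ := fun S => ∑ ω ∈ (edgesIn B).powerset, ind (compat S ω) * (bw q ω * h ω)
    with hJ
  have key : -∑ S ∈ B.powerset, fzw q B S * ind (¬box (r + 1) ⊆ dom B S) ≤ ∑ S ∈ B.powerset, J S := by
    rw [← Finset.sum_fiberwise_of_maps_to
      (fun S hS => Finset.mem_image_of_mem (fun S : Finset Site => dom B ↑S) hS) J,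
      ← Finset.sum_fiberwise_of_maps_to
      (fun S hS => Finset.mem_image_of_mem (fun S : Finset Site => dom B ↑S) hS)
      (fun S : Finset Site => fzw q B S * ind (¬box (r + 1) ⊆ dom B S)), ← Finset.sum_neg_distrib]
    refine Finset.sum_le_sum fun U hU => ?_
    obtain ⟨S₀, hS₀, rfl⟩ := Finset.mem_image.1 hU
    rw [Finset.mem_powerset] at hS₀
    by_cases hbox : box (r + 1) ⊆ dom B ↑S₀
    · refine le_trans (neg_nonpos.2 (Finset.sum_nonneg fun S _ =>
        mul_nonneg (fzw_pos h2 B S).le (ind_nonneg _))) ?_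
      have hdc := hd.mono (H := ↑(core (dom B ↑S₀)))
        (by exact_mod_cast edgesIn_box_subset_core hbox)
      rw [filter_dom_eq S₀]
      have hsum := sum_fiber (q := q) (dom_subset B S₀) (depOn_sub_dual hdc)
      refine le_of_le_of_eq ?_ hsum.symm
      refine mul_nonneg (part_pos h2 _).le (mul_nonneg (by positivity) ?_)
      have := ex_dw_dual_le h2 h4 _ hf hdc
      rw [← sub_nonneg, ← ex_sub, ex] at this
      rwa [le_div_iff₀ (zsum_pos (dw_pos h2 _)), zero_mul] at this
    · rw [← Finset.sum_neg_distrib]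
      refine Finset.sum_le_sum fun S hS => ?_
      obtain ⟨hS, hSU⟩ := Finset.mem_filter.1 hS
      rw [hSU, ind_true hbox, mul_one, fzw, ← sum_compat_bw (Finset.mem_powerset.1 hS), hJ,
        ← Finset.sum_neg_distrib]
      refine Finset.sum_le_sum fun ω _ => ?_
      have a := mul_nonneg (ind_nonneg (compat (↑S) ↑ω)) (bw_pos h2 ω).le
      have b : -1 ≤ h ω := by
        have := h0 ω; have := h1 (dual ω); simp only [hh]; linarith
      nlinarith
  have hJs := sum_joint_empty (q := q) B fun ω => h ω
  have hz := zsum_fzw (q := q) B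
  have hzp : 0 < zsum (edgesIn B) (fkw q) := zsum_pos (fkw_pos (by linarith))
  have e : ex (edgesIn B) (fkw q) h = ex (edgesIn B) (fkw q) f - _ := ex_sub _ _
  have main : 0 ≤ ex (edgesIn B) (fkw q) h + ex B (fzw q B) fun S => ind (¬box (r + 1) ⊆ dom B S) := by
    rw [hJ, hJs] at key
    rw [ex, ex, hz]
    change _ ≤ 2 ^ B.card * wsum (edgesIn B) (fkw q) h at key
    change -wsum B (fzw q B) (fun S => ind (¬box (r + 1) ⊆ dom B S)) ≤ _ at key
    rw [← mul_div_mul_left (wsum (edgesIn B) (fkw q) h) _ (by positivity : (2 : ℝ) ^ B.card ≠ 0),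
      ← add_div]
    exact div_nonneg (by linarith) (by positivity)
  linarith

end Explore

/-! ### Comparison of the wired model with the dual of the free model -/

lemma Cn.line {C : Set Site} {ω : Set Edge} {f : ℤ → Site} (h : ∀ k, Cn C ω (f k) (f (k + 1)))
    (a b : ℤ) : Cn C ω (f a) (f b) := by
  have key : ∀ b, Cn C ω (f 0) (f b) := fun b => by
    induction b using Int.induction_on with
    | zero => exact .refl _
    | succ n ih => exact ih.trans (h n)
    | pred n ih =>
      have := h (-(n : ℤ) - 1)
      rw [sub_add_cancel] at this
      exact ih.trans this.symm
  exact (key a).symm.trans (key b)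

/-- The complement of a box is connected by the edges that start outside of the box. -/
lemma cn_compl_box {N : ℕ} {ω : Set Edge} (h : ∀ e, src e ∉ box N → e ∈ ω) {u v : Site}
    (hu : u ∉ box N) (hv : v ∉ box N) : Cn ∅ ω u v := by
  have hc : ∀ x a b : ℤ, (∀ k, ((x, k) : Site) ∉ box N) → Cn ∅ ω (x, a) (x, b) := fun x a b hx =>
    Cn.line (f := fun k => (x, k)) (fun k => Cn.of_edge (e := ((x, k), true)) (h _ (hx k))) a b
  have hr : ∀ y a b : ℤ, (∀ k, ((k, y) : Site) ∉ box N) → Cn ∅ ω (a, y) (b, y) := fun y a b hy =>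
    Cn.line (f := fun k => (k, y)) (fun k => Cn.of_edge (e := ((k, y), false)) (h _ (hy k))) a b
  have key : ∀ u : Site, u ∉ box N → Cn ∅ ω u ((N : ℤ) + 1, (N : ℤ) + 1) := by
    rintro ⟨x, y⟩ hu
    by_cases hx : ∀ k, ((x, k) : Site) ∉ box N
    · refine (hc x y (N + 1) hx).trans (hr (N + 1) x (N + 1) fun k => ?_)
      rw [mem_box]; omega
    · have hy : ∀ k, ((k, y) : Site) ∉ box N := by
        intro k hk
        push Not at hx
        obtain ⟨k', hk'⟩ := hx
        rw [mem_box] at hu hk hk'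
        omega
      refine (hr y x (N + 1) hy).trans (hc (N + 1) y (N + 1) fun k => ?_)
      rw [mem_box]; omega
  exact (key u hu).trans (key v hv).symm

/-- The edges with an endpoint in a set of sites. -/
noncomputable def touch (B : Finset Site) : Finset Edge :=
  B ×ˢ Finset.univ ∪ (B.map (Equiv.subRight ((1, 0) : Site)).toEmbedding ×ˢ {false} ∪
    B.map (Equiv.subRight ((0, 1) : Site)).toEmbedding ×ˢ {true})

lemma mem_touch {B : Finset Site} {e : Edge} : e ∈ touch B ↔ src e ∈ B ∨ tgt e ∈ B := by
  obtain ⟨⟨x, y⟩, _ | _⟩ := e <;>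
    simp [touch, src_mk, tgt_h, tgt_v, Finset.mem_map_equiv]

section Wired

variable {q : ℝ} {L N : ℕ}

/-- The weight of the random-cluster model on a box with wired boundary conditions. -/
noncomputable def ww (q : ℝ) (N : ℕ) : Finset Edge → ℝ := wt √q 1 q (↑(box N))ᶜ

lemma ww_pos (hq : 1 ≤ q) (s : Finset Edge) : 0 < ww q N s :=
  wt_pos (Real.sqrt_pos.2 (by linarith)) one_pos (by linarith) s

lemma fac_ww_le (hq : 1 ≤ q) (ω : Set Edge) (e : Edge) : fac √q 1 q (↑(box N))ᶜ ω e ≤ √q := by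
  unfold fac
  rw [one_pow, one_mul]
  exact div_le_self (Real.sqrt_nonneg q) (one_le_pow₀ hq)

/-- The edges whose dual lies in a box. -/
noncomputable def dualIn (L : ℕ) : Finset Edge := (edgesIn (box L)).map dl.symm.toEmbedding

lemma map_dualIn (L : ℕ) : (dualIn L).map dl.toEmbedding = edgesIn (box L) := by
  rw [dualIn, Finset.map_map]
  ext; simp

lemma src_mem_of_mem_dualIn {e : Edge} (he : e ∈ dualIn L) : src e ∈ box L := by
  rw [dualIn, Finset.mem_map_equiv, Equiv.symm_symm, mem_edgesIn] at he
  obtain ⟨⟨x, y⟩, _ | _⟩ := e <;>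
    simp only [dl_h, dl_v, src_mk, tgt_h, tgt_v, sub_add_cancel] at he ⊢
  · exact he.2
  · exact he.2

lemma dualIn_subset_touch (h : L ≤ N) : dualIn L ⊆ touch (box N) := fun _ he =>
  mem_touch.2 (Or.inl (box_mono h (src_mem_of_mem_dualIn he)))

/-- The weight of the dual free model, with independent edges outside of its domain. -/
noncomputable def dwt (q : ℝ) (L : ℕ) (s : Finset Edge) : ℝ :=
  fkw q ((dualIn L \ s).map dl.toEmbedding) * √q ^ (s \ dualIn L).card

lemma dwt_pos (hq : 1 ≤ q) (s : Finset Edge) : 0 < dwt q L s :=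
  mul_pos (fkw_pos hq _) (pow_pos (Real.sqrt_pos.2 (by linarith)) _)

lemma one_le_dr_wired_add_dr (h : L ≤ N) {s t : Finset Edge} {e : Edge} (hst : s ⊆ t)
    (het : e ∉ t) (he : e ∈ dualIn L) :
    1 ≤ dr (↑(box N))ᶜ s e + dr ∅ ((dualIn L \ insert e t).map dl.toEmbedding : Finset Edge) (dl e) := by
  by_cases h1 : Cn (↑(box N))ᶜ ↑s (src e) (tgt e)
  · have h2 : Cn ∅ (↑t ∪ (↑(dualIn L))ᶜ : Set Edge) (src e) (tgt e) :=
      h1.of_forall (fun e' he' => .of_edge (Or.inl (hst he'))) fun a ha b hb =>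
        cn_compl_box (N := N) (fun e' he' => Or.inr fun hm =>
          he' (box_mono h (src_mem_of_mem_dualIn hm))) ha hb
    have h3 := one_le_dr_add_dr (ω := ↑t ∪ (↑(dualIn L))ᶜ) (e := e)
      (η := ((dualIn L \ insert e t).map dl.toEmbedding : Finset Edge)) (by simp [het, he])
      fun e' he' => by
        rw [Finset.mem_coe, Finset.mem_map] at he'
        obtain ⟨e'', h1, h2⟩ := he'
        rw [Finset.mem_sdiff, Finset.mem_insert, not_or] at h1
        exact ⟨e'', by simp [h1], h1.2.1, h2⟩
    rw [dr, if_pos h2, zero_add] at h3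
    exact le_add_left h3
  · simp [dr, h1]

lemma edgeLe_ww_dwt (hq : 1 ≤ q) (h : L ≤ N) : EdgeLe (touch (box N)) (ww q N) (dwt q L) := by
  have hs : √q * √q = q := Real.mul_self_sqrt (by linarith)
  refine edgeLe_of_ratio (ww_pos hq) (dwt_pos hq) fun s t e hst _ _ het =>
    ⟨fac √q 1 q (↑(box N))ᶜ s e, ?_, ?_⟩
  · rw [ww, wt_insert (fun h => het (hst h)), mul_comm]
  by_cases he : e ∈ dualIn L
  · have e1 : insert e t \ dualIn L = t \ dualIn L := Finset.insert_sdiff_of_mem _ he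
    rw [dwt, dwt, e1, ← mul_assoc]
    refine mul_le_mul_of_nonneg_right ?_ (by positivity)
    rw [map_dl_sdiff he het, fkw, wt_insert (dl_notMem_map_sdiff _ t e), mul_comm (wt _ _ _ _ _),
      ← mul_assoc]
    refine mul_le_of_le_one_left (wt_pos (Real.sqrt_pos.2 (by linarith)) (by linarith) one_pos _).le ?_
    unfold fac
    rw [one_pow, one_pow, one_mul, mul_one, div_mul_div_comm, hs, ← pow_add,
      div_le_one (by positivity)]
    calc q = q ^ 1 := (pow_one q).symm
      _ ≤ _ := pow_le_pow_right₀ hq (one_le_dr_wired_add_dr h hst het he)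
  · have e1 : dualIn L \ insert e t = dualIn L \ t := Finset.sdiff_insert_of_notMem he t
    have e2 : (insert e t \ dualIn L).card = (t \ dualIn L).card + 1 := by
      rw [Finset.insert_sdiff_of_notMem _ he, Finset.card_insert_of_notMem]
      simp [het]
    rw [dwt, dwt, e1, e2, pow_succ]
    have := fac_ww_le (N := N) hq s e
    have := mul_le_mul_of_nonneg_right this (dwt_pos (L := L) hq t).le
    rw [dwt] at this
    refine this.trans (le_of_eq ?_)
    ring

lemma ex_dwt (hq : 1 ≤ q) (h : L ≤ N) {f : Set Edge → ℝ} (hd : DepOn ↑(dualIn L) f) :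
    ex (touch (box N)) (dwt q L) f = ex (edgesIn (box L)) (fkw q) fun ω => f (dual ω) := by
  have key : ∀ g : Set Edge → ℝ, DepOn ↑(dualIn L) g → wsum (touch (box N)) (dwt q L) g =
      (∑ η ∈ (touch (box N) \ dualIn L).powerset, √q ^ η.card) *
        wsum (dualIn L) (fun s => fkw q ((dualIn L \ s).map dl.toEmbedding)) g := by
    intro g hg
    rw [wsum, sum_powerset_split (dualIn_subset_touch h), wsum, Finset.sum_mul]
    refine Finset.sum_congr rfl fun η hη => ?_
    rw [Finset.mul_sum]
    refine Finset.sum_congr rfl fun s hs => ?_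
    rw [Finset.mem_powerset] at hη hs
    have d : ∀ e ∈ η, e ∉ dualIn L := fun e he => (Finset.mem_sdiff.1 (hη he)).2
    have e1 : dualIn L \ (s ∪ η) = dualIn L \ s := by
      ext e
      have := d e
      simp only [Finset.mem_sdiff, Finset.mem_union]
      tauto
    have e2 : (s ∪ η) \ dualIn L = η := by
      ext e
      have := d e
      have := @hs e
      simp only [Finset.mem_sdiff, Finset.mem_union]
      tauto
    have e3 : g ↑(s ∪ η) = g ↑s := by
      rw [hg, hg ↑s]
      congr 1
      ext e
      have := d e
      simp only [Finset.coe_union, Set.mem_inter_iff, Set.mem_union, Finset.mem_coe]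
      tauto
    rw [dwt, e1, e2, e3]
    ring
  rw [← map_dualIn, ex_dual _ _ hd, ex, ex, ← wsum_one, ← wsum_one, key f hd,
    key (fun _ => 1) fun _ => rfl, mul_div_mul_left]
  exact (Finset.sum_pos (fun s _ => pow_pos (Real.sqrt_pos.2 (by linarith)) _)
    (Finset.powerset_nonempty _)).ne'

/-- The wired model is dominated by the dual of the free model. -/
lemma ex_ww_le (hq : 1 ≤ q) (h : L ≤ N) {f : Set Edge → ℝ} (hf : Monotone f)
    (hd : DepOn ↑(dualIn L) f) : ex (touch (box N)) (ww q N) f ≤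
      ex (edgesIn (box L)) (fkw q) fun ω => f (dual ω) := by
  rw [← ex_dwt hq h hd]
  exact holley (ww_pos hq) (dwt_pos hq) (edgeLe_ww_dwt hq h) hf

end Wired

section Limit

variable {q : ℝ}

lemma ex_sum {α ι : Type*} [DecidableEq α] {F : Finset α} {w : Finset α → ℝ} (I : Finset ι)
    (f : ι → Set α → ℝ) : ex F w (fun s => ∑ i ∈ I, f i s) = ∑ i ∈ I, ex F w (f i) := by
  simp only [ex, wsum, Finset.mul_sum, Finset.sum_div]
  exact Finset.sum_comm

lemma reach_of_not_subset_dom (hq : 2 ≤ q) {L K r : ℕ} (hL : K + r ≤ L) {S : Set Site}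
    (h : ¬box r ⊆ dom (box L) S) :
    ∃ x ∈ box r, (fzPerc q hq).reach K ↑(box (K + 1)) 0 ((fzPerc q hq).sh x ⁻¹' Sᶜ) := by
  obtain ⟨x, hx, hxd⟩ := Finset.not_subset.1 h
  rw [mem_dom] at hxd
  push Not at hxd
  obtain ⟨v, hv, hc⟩ := hxd (box_mono (by omega) hx)
  refine ⟨x, hx, ?_⟩
  have h1 : CR ((fzPerc q hq).adj Sᶜ) Set.univ (0 + x) ((v - x) + x) := by
    rw [zero_add, sub_add_cancel]
    exact hc
  have h2 := (fzPerc q hq).cr_unshift (R := Set.univ) h1 fun _ _ => trivial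
  have := (fzPerc q hq).reach_trunc (K := K) (mem_box.2 (by simp)) (fun hk => hv (by
    rw [mem_box] at hk hx ⊢
    simp only [Prod.fst_sub, Prod.snd_sub] at hk
    omega)) h2
  rwa [Set.univ_inter] at this

/-- Distant connections in the complement of the marked sites are unlikely. -/
lemma tendsto_not_subset_dom (hq : 2 ≤ q) (r : ℕ) :
    Tendsto (fun L => ex (box L) (fzw q (box L)) fun S => ind (¬box r ⊆ dom (box L) S))
      atTop (nhds 0) := by
  set Q := fzPerc q hq with hQ
  set p : ℕ → Site → Set Site → Prop := fun K x ω => Q.reach K ↑(box (K + 1)) 0 (Q.sh x ⁻¹' ω) with hp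
  have lp : ∀ K x, LocalP (p K x) := fun K x => (Q.localP_reach_box K 0).preimage _
  have hP : ∀ K x, Q.P (p K x) = Q.θ K := fun K x => Q.P_preimage (Q.inv_sh x) (Q.localP_reach_box K 0)
  have lc : ∀ K x, IsLocal fun ω : Set Site => ind (p K x {y | id y ∉ ω}) := fun K x =>
    IsLocal.compl_preimage (lp K x).isLocal id
  have hc : ∀ K x, (fzModel q hq).ev (fun ω => ind (p K x {y | id y ∉ ω})) ≤ Q.θ K := fun K x => by
    refine (fzModel_ev_dual hq _ (lc K x)).trans (le_of_eq ?_)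
    rw [← hP K x]
    change _ = (fzModel q hq).ev _
    congr 1
    funext ω
    congr 2
    ext y
    simp
  rw [Metric.tendsto_atTop]
  intro ε hε
  have hcard : (0 : ℝ) < (box r).card :=
    Nat.cast_pos.2 (Finset.card_pos.2 ⟨0, mem_box.2 (by simp)⟩)
  obtain ⟨K, hK⟩ := (Q.tendsto_θ.eventually (gt_mem_nhds (by positivity :
    (0 : ℝ) < ε / (2 * (box r).card)))).exists
  have hlim : Tendsto (fun L => ∑ x ∈ box r, ex (box L) (fzw q (box L))
      fun ω => ind (p K x {y | id y ∉ ω})) atTop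
      (nhds (∑ x ∈ box r, (fzModel q hq).ev fun ω => ind (p K x {y | id y ∉ ω}))) :=
    tendsto_finsetSum _ fun x _ => (fzModel q hq).tendsto (lc K x)
  have hsum : ∑ x ∈ box r, (fzModel q hq).ev (fun ω => ind (p K x {y | id y ∉ ω})) < ε := by
    calc _ ≤ ∑ x ∈ box r, ε / (2 * (box r).card) := Finset.sum_le_sum fun x _ => (hc K x).trans hK.le
      _ = ε / 2 := by
        rw [Finset.sum_const, nsmul_eq_mul]
        field_simp
      _ < ε := by linarith
  obtain ⟨L₀, hL₀⟩ := eventually_atTop.1 (hlim.eventually (gt_mem_nhds hsum))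
  refine ⟨max L₀ (K + r), fun L hL => ?_⟩
  rw [Real.dist_eq, sub_zero, abs_of_nonneg (ex_nonneg (fzw_pos hq _) fun _ => ind_nonneg _)]
  refine lt_of_le_of_lt ?_ (hL₀ L (le_of_max_le_left hL))
  rw [← ex_sum]
  refine ex_mono (fzw_pos hq _) fun S _ => ?_
  by_cases h : box r ⊆ dom (box L) (S : Set Site)
  · rw [ind_false (not_not.2 h)]
    exact Finset.sum_nonneg fun _ _ => ind_nonneg _
  · rw [ind_true h]
    obtain ⟨x, hx, hr⟩ := reach_of_not_subset_dom hq (le_of_max_le_right hL) h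
    have : ind (p K x {y | id y ∉ (S : Set Site)}) = 1 := ind_true hr
    rw [← this]
    exact Finset.single_le_sum (f := fun x => ind (p K x {y | id y ∉ (S : Set Site)}))
      (fun _ _ => ind_nonneg _) hx

/-- The origin is connected to the complement of the box. -/
def conn (N : ℕ) (ω : Set Edge) : Prop := ∃ v, v ∉ box N ∧ Cn (↑(box N))ᶜ ω 0 v

lemma conn.reach (hq : 1 ≤ q) {K N : ℕ} (hK : K ≤ N) {ω : Set Edge} (h : conn N ω) :
    (fkPerc q hq).reach K ↑(box (K + 1)) 0 ω := by
  have : ∃ v, v ∉ box N ∧ Cn ∅ ω 0 v := by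
    by_contra hno
    push Not at hno
    obtain ⟨v, hv, hc⟩ := h
    have := hc.eq_of (f := fun y => Cn ∅ ω 0 y) (fun e he => propext
      ⟨fun h => h.trans (.of_edge he), fun h => h.trans (Cn.of_edge he).symm⟩)
      fun a ha b hb => propext (iff_of_false (hno a ha) (hno b hb))
    exact hno v hv (this.mp (.refl _))
  obtain ⟨v, hv, hc⟩ := this
  have := (fkPerc q hq).reach_trunc (K := K) (mem_box.2 (by simp)) (fun h => hv (box_mono hK h)) hc.cr
  rwa [Set.univ_inter] at this

/-- The wired random-cluster model does not percolate. -/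
lemma tendsto_conn (h2 : 2 ≤ q) (h4 : q ≤ 4) :
    Tendsto (fun N => ex (touch (box N)) (ww q N) fun ω => ind (conn N ω)) atTop (nhds 0) := by
  have h1 : 1 ≤ q := by linarith
  set Q := fkPerc q h1 with hQ
  rw [Metric.tendsto_atTop]
  intro ε hε
  obtain ⟨K, hK⟩ := (Q.tendsto_θ.eventually (gt_mem_nhds (half_pos hε))).exists
  set f : Set Edge → ℝ := fun ω => ind (Q.reach K ↑(box (K + 1)) 0 ω) with hf
  have lf : IsLocal f := (Q.localP_reach_box K 0).isLocal
  have mf : Monotone f := fun _ _ h => ind_mono fun hr => Q.reach_mono h hr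
  obtain ⟨G, hG⟩ := lf
  obtain ⟨r, hr⟩ := sum_edge_finite G
  have hd : DepOn ↑(edgesIn (box r)) f := DepOn.mono hG (by exact_mod_cast hr r le_rfl)
  have e1 := ((fkModel q h1).tendsto ⟨G, hG⟩).eventually (gt_mem_nhds hK)
  have e2 := (tendsto_not_subset_dom h2 (r + 1)).eventually (gt_mem_nhds (half_pos hε))
  obtain ⟨L, ⟨e1, e2⟩, hL⟩ := ((e1.and e2).and (eventually_ge_atTop (r + 1))).exists
  refine ⟨max L K, fun N hN => ?_⟩
  rw [Real.dist_eq, sub_zero, abs_of_nonneg (ex_nonneg (ww_pos h1) fun _ => ind_nonneg _)]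
  have hsub : edgesIn (box r) ⊆ dualIn L := by
    obtain ⟨L, rfl⟩ : ∃ L', L = L' + 1 := ⟨L - 1, by omega⟩
    exact (edgesIn_mono (box_mono (by omega))).trans (edgesIn_subset_dual L)
  calc _ ≤ ex (touch (box N)) (ww q N) f :=
        ex_mono (ww_pos h1) fun ω _ => ind_mono (conn.reach h1 (le_of_max_le_right hN))
    _ ≤ ex (edgesIn (box L)) (fkw q) fun ω => f (dual ω) :=
        ex_ww_le h1 (le_of_max_le_left hN) mf (hd.mono (by exact_mod_cast hsub))
    _ ≤ ex (edgesIn (box L)) (fkw q) f + _ :=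
        ex_dual_le h2 h4 mf (fun _ => ind_nonneg _) (fun _ => ind_le_one _) hd
    _ < ε / 2 + ε / 2 := add_lt_add e1 e2
    _ = ε := by ring

end Limit

/-! ### The Edwards–Sokal coupling -/

section Energy

/-- The coordinates of a site. -/
def toSite : (Fin 2 → ℤ) ≃ Site := finTwoArrowEquiv ℤ

lemma toSite_apply (u : Fin 2 → ℤ) : toSite u = (u 0, u 1) := rfl

lemma toSite_zero : toSite (fun _ => 0) = 0 := rfl

lemma toSite_mem_box {N : ℕ} {u : Fin 2 → ℤ} : toSite u ∈ box N ↔ u ∈ cube N := by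
  simp only [toSite_apply, mem_box, cube, Fintype.mem_piFinset, Fin.forall_fin_two, Finset.mem_Icc]

lemma sum_cube {N : ℕ} (f : Site → ℝ) : ∑ u ∈ cube N, f (toSite u) = ∑ x ∈ box N, f x :=
  Finset.sum_equiv toSite (fun _ => toSite_mem_box.symm) fun _ _ => rfl

/-- The nearest neighbours of a site. -/
def nb (x : Site) : Finset Site :=
  {(x.1 + 1, x.2), (x.1, x.2 + 1), (x.1 - 1, x.2), (x.1, x.2 - 1)}

lemma sum_nb (x : Site) (f : Site → ℝ) : ∑ y ∈ nb x, f y =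
    ∑ b : Bool, (f (tgt (x, b)) + f (if b then (x.1, x.2 - 1) else (x.1 - 1, x.2))) := by
  have : tgt (x, true) = (x.1, x.2 + 1) := rfl
  have : tgt (x, false) = (x.1 + 1, x.2) := rfl
  rw [nb, Finset.sum_insert, Finset.sum_insert, Finset.sum_insert, Finset.sum_singleton,
    Fintype.sum_bool]
  · simp [*]
    ring
  all_goals
    simp only [Finset.mem_insert, Finset.mem_singleton, Prod.mk.injEq]
    omega

lemma dist1_eq_one {u v : Fin 2 → ℤ} : dist1 u v = 1 ↔ toSite v ∈ nb (toSite u) := by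
  simp only [dist1, Fin.sum_univ_two, toSite_apply, nb, Finset.mem_insert, Finset.mem_singleton,
    Prod.mk.injEq, abs_eq_max_neg]
  omega

lemma mem_nbrs {u v : Fin 2 → ℤ} : v ∈ nbrs u ↔ toSite v ∈ nb (toSite u) := by
  rw [nbrs, Finset.mem_filter, ← dist1_eq_one, and_iff_right_iff_imp]
  simp only [dist1, Fin.sum_univ_two, Fintype.mem_piFinset, Fin.forall_fin_two, Finset.mem_Icc,
    abs_eq_max_neg]
  omega

lemma bCount_eq (N : ℕ) (u : Fin 2 → ℤ) :
    (bCount N u : ℝ) = ∑ y ∈ nb (toSite u), if y ∈ box N then 0 else 1 := by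
  have : bCount N u = ((nb (toSite u)).filter fun y => y ∉ box N).card := by
    refine Finset.card_bij (fun v _ => toSite v) (fun v hv => ?_) (fun _ _ _ _ h => toSite.injective h)
      fun y hy => ⟨toSite.symm y, ?_, toSite.apply_symm_apply y⟩
    · rw [Finset.mem_sdiff, mem_nbrs] at hv
      rw [Finset.mem_filter, toSite_mem_box]
      exact hv
    · rw [Finset.mem_sdiff, mem_nbrs, ← toSite_mem_box, toSite.apply_symm_apply]
      exact Finset.mem_filter.1 hy
  rw [this, Finset.card_eq_sum_ones, Nat.cast_sum, Finset.sum_filter]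
  refine Finset.sum_congr rfl fun y _ => ?_
  by_cases h : y ∈ box N <;> simp [h]

lemma sum_touch (B : Finset Site) (k : Site → Site → ℝ) :
    ∑ x ∈ B, ∑ y ∈ nb x, k x y = ∑ e ∈ touch B,
      ((if src e ∈ B then k (src e) (tgt e) else 0) + if tgt e ∈ B then k (tgt e) (src e) else 0) := by
  simp only [sum_nb, Finset.sum_add_distrib]
  congr 1
  · rw [← Finset.sum_filter, ← Finset.sum_product']
    refine Finset.sum_congr ?_ fun _ _ => rfl
    ext e
    rw [Finset.mem_filter, mem_touch, Finset.mem_product]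
    simp only [Finset.mem_univ, and_true, src]
    tauto
  · rw [← Finset.sum_filter, ← Finset.sum_product']
    refine Finset.sum_bij' (fun p _ => (if p.2 then (p.1.1, p.1.2 - 1) else (p.1.1 - 1, p.1.2), p.2))
      (fun e _ => (tgt e, e.2)) ?_ ?_ ?_ ?_ ?_
    · intro p h
      have ht : tgt (if p.2 then (p.1.1, p.1.2 - 1) else (p.1.1 - 1, p.1.2), p.2) = p.1 := by
        obtain ⟨⟨x, y⟩, _ | _⟩ := p <;> simp [tgt]
      have := (Finset.mem_product.1 h).1
      rw [Finset.mem_filter, mem_touch, ht]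
      exact ⟨Or.inr this, this⟩
    · intro e h
      rw [Finset.mem_filter] at h
      exact Finset.mem_product.2 ⟨h.2, Finset.mem_univ _⟩
    · rintro ⟨⟨x, y⟩, _ | _⟩ h <;> simp [tgt]
    · rintro ⟨⟨x, y⟩, _ | _⟩ h <;> simp [tgt]
    · rintro ⟨⟨x, y⟩, _ | _⟩ h <;> simp [tgt, src]

end Energy

section EdwardsSokal

variable {q N : ℕ} {c₀ : Fin q}

/-- The extension of a spin configuration by the boundary colour. -/
noncomputable def extend (c₀ : Fin q) (σ : {x // x ∈ cube N} → Fin q) (x : Site) : Fin q :=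
  if h : toSite.symm x ∈ cube N then σ ⟨toSite.symm x, h⟩ else c₀

lemma extend_toSite (σ : {x // x ∈ cube N} → Fin q) {u : Fin 2 → ℤ} (hu : u ∈ cube N) :
    extend c₀ σ (toSite u) = σ ⟨u, hu⟩ := by
  simp [extend, hu]

lemma extend_of_notMem (σ : {x // x ∈ cube N} → Fin q) {x : Site} (hx : x ∉ box N) :
    extend c₀ σ x = c₀ := by
  refine dif_neg fun h => hx ?_
  rwa [← toSite_mem_box, toSite.apply_symm_apply] at h

/-- The number of edges along which a configuration is constant. -/
lemma energy_eq (σ : {x // x ∈ cube N} → Fin q) :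
    (1 / 2) * (∑ u ∈ (cube N).attach, ∑ v ∈ (cube N).attach,
      if dist1 (u : Fin 2 → ℤ) (v : Fin 2 → ℤ) = 1 then
        (if σ u = σ v then (1 : ℝ) else 0) else 0) +
    ∑ u ∈ (cube N).attach,
      (bCount N (u : Fin 2 → ℤ) : ℝ) * (if σ u = c₀ then (1 : ℝ) else 0) =
    ∑ e ∈ touch (box N), ind (extend c₀ σ (src e) = extend c₀ σ (tgt e)) := by
  set τ := extend c₀ σ with hτ
  have h1 : ∀ u ∈ (cube N).attach, (∑ v ∈ (cube N).attach,
      if dist1 (u : Fin 2 → ℤ) (v : Fin 2 → ℤ) = 1 then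
        (if σ u = σ v then (1 : ℝ) else 0) else 0) =
      ∑ y ∈ nb (toSite u), if y ∈ box N then ind (τ (toSite u) = τ y) else 0 := by
    rintro ⟨u, hu⟩ -
    have : ∀ v ∈ (cube N).attach, (if dist1 u (v : Fin 2 → ℤ) = 1 then
        (if σ ⟨u, hu⟩ = σ v then (1 : ℝ) else 0) else 0) =
        (fun v => if toSite v ∈ nb (toSite u) then ind (τ (toSite u) = τ (toSite v)) else 0) ↑v := by
      rintro ⟨v, hv⟩ -
      simp only [hτ, extend_toSite σ hu, extend_toSite σ hv, dist1_eq_one, ind]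
    rw [Finset.sum_congr rfl this, Finset.sum_attach (cube N)
      (fun v => if toSite v ∈ nb (toSite u) then ind (τ (toSite u) = τ (toSite v)) else 0),
      sum_cube fun y => if y ∈ nb (toSite u) then ind (τ (toSite u) = τ y) else 0,
      ← Finset.sum_filter, ← Finset.sum_filter]
    exact Finset.sum_congr (by ext; simp [and_comm]) fun _ _ => rfl
  have h2 : ∀ u ∈ (cube N).attach,
      (bCount N (u : Fin 2 → ℤ) : ℝ) * (if σ u = c₀ then (1 : ℝ) else 0) =
      ∑ y ∈ nb (toSite u), if y ∈ box N then 0 else ind (τ (toSite u) = τ y) := by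
    rintro ⟨u, hu⟩ -
    rw [bCount_eq, Finset.sum_mul]
    refine Finset.sum_congr rfl fun y _ => ?_
    by_cases hy : y ∈ box N
    · simp [hy]
    · simp only [hy, if_false, one_mul, hτ, extend_toSite σ hu, extend_of_notMem σ hy, ind]
  rw [Finset.sum_congr rfl h1, Finset.sum_congr rfl h2, Finset.mul_sum, ← Finset.sum_add_distrib]
  have h3 : ∀ u ∈ (cube N).attach,
      (1 / 2) * (∑ y ∈ nb (toSite u), if y ∈ box N then ind (τ (toSite u) = τ y) else 0) +
      (∑ y ∈ nb (toSite u), if y ∈ box N then 0 else ind (τ (toSite u) = τ y)) =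
      (fun u => ∑ y ∈ nb (toSite u),
        ind (τ (toSite u) = τ y) * (if y ∈ box N then 1 / 2 else 1)) ↑u := by
    intro u _
    rw [Finset.mul_sum, ← Finset.sum_add_distrib]
    refine Finset.sum_congr rfl fun y _ => ?_
    by_cases hy : y ∈ box N <;> simp [hy, mul_comm]
  rw [Finset.sum_congr rfl h3, Finset.sum_attach (cube N) (fun u => ∑ y ∈ nb (toSite u),
      ind (τ (toSite u) = τ y) * (if y ∈ box N then 1 / 2 else 1)),
    sum_cube fun x => ∑ y ∈ nb x, ind (τ x = τ y) * (if y ∈ box N then 1 / 2 else 1),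
    sum_touch (box N) fun x y => ind (τ x = τ y) * (if y ∈ box N then 1 / 2 else 1)]
  refine Finset.sum_congr rfl fun e he => ?_
  rw [mem_touch] at he
  rw [ind_congr (eq_comm (a := τ (tgt e)))]
  by_cases hs : src e ∈ box N <;> by_cases ht : tgt e ∈ box N
  · simp only [hs, ht, if_true]
    ring
  · simp [hs, ht]
  · simp [hs, ht]
  · exact absurd he (by simp [hs, ht])

lemma pottsWeight_eq (σ : {x // x ∈ cube N} → Fin q) :
    pottsWeight q N c₀ (Real.log (1 + √q)) σ =
      ∑ ω ∈ (touch (box N)).powerset, √q ^ ω.card * ind (extend c₀ σ ∈ Cols (box N) c₀ ↑ω) := by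
  set τ := extend c₀ σ with hτ
  have hq : 0 < 1 + √(q : ℝ) := by positivity
  rw [pottsWeight, energy_eq, Finset.mul_sum, Real.exp_sum]
  have : ∀ e : Edge, Real.exp (Real.log (1 + √q) * ind (τ (src e) = τ (tgt e))) =
      1 + √q * ind (τ (src e) = τ (tgt e)) := by
    intro e
    by_cases h : τ (src e) = τ (tgt e) <;> simp [h, ind, Real.exp_log hq]
  simp only [← hτ, this, Finset.prod_one_add, Finset.prod_mul_distrib, Finset.prod_const]
  refine Finset.sum_congr rfl fun ω _ => ?_
  congr 1
  by_cases h : ∀ e ∈ ω, τ (src e) = τ (tgt e)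
  · rw [ind_true ⟨fun x hx => extend_of_notMem σ hx, h⟩]
    exact Finset.prod_eq_one fun e he => ind_true (h e he)
  · rw [ind_false fun h' => h h'.2]
    push Not at h
    obtain ⟨e, he, hne⟩ := h
    exact Finset.prod_eq_zero he (ind_false hne)

lemma sum_ind_extend (S : Set (Site → Fin q)) (hS : ∀ τ ∈ S, ∀ x ∉ box N, τ x = c₀) :
    ∑ σ : {x // x ∈ cube N} → Fin q, ind (extend c₀ σ ∈ S) = Nat.card S := by
  have : Nat.card S = (Finset.univ.filter fun σ : {x // x ∈ cube N} → Fin q =>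
      extend c₀ σ ∈ S).card := by
    rw [← Fintype.card_subtype, ← Nat.card_eq_fintype_card]
    refine (Nat.card_congr (Equiv.ofBijective (fun σ : {σ // _} => ⟨extend c₀ σ.1, σ.2⟩)
      ⟨?_, ?_⟩)).symm
    · rintro ⟨σ, hσ⟩ ⟨σ', hσ'⟩ h
      refine Subtype.ext (funext fun u => ?_)
      have : extend c₀ σ (toSite u) = extend c₀ σ' (toSite u) := congrFun (Subtype.ext_iff.1 h) _
      rwa [extend_toSite σ u.2, extend_toSite σ' u.2] at this
    · rintro ⟨τ, hτ⟩
      have : extend c₀ (fun u : {x // x ∈ cube N} => τ (toSite u)) = τ := by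
        funext x
        by_cases hx : x ∈ box N
        · rw [← toSite.apply_symm_apply x, toSite_mem_box] at hx
          simp [extend, hx]
        · rw [extend_of_notMem _ hx, hS τ hτ x hx]
      exact ⟨⟨fun u => τ (toSite u), this.symm ▸ hτ⟩, Subtype.ext this⟩
  rw [this, Finset.card_eq_sum_ones, Nat.cast_sum, Finset.sum_filter]
  refine Finset.sum_congr rfl fun σ _ => ?_
  by_cases h : extend c₀ σ ∈ S <;> simp [h, ind]

end EdwardsSokal

section Colourings

variable {K : Type*} {B : Finset Site} {c : K} {ω : Finset Edge} {u : Site}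

lemma mem_cols_erase {σ : Site → K} :
    σ ∈ Cols (B.erase u) c (ω : Set Edge) ↔ σ ∈ Cols B c (ω : Set Edge) ∧ σ u = c := by
  constructor
  · rintro ⟨h1, h2⟩
    exact ⟨⟨fun x hx => h1 x fun h => hx (Finset.mem_of_mem_erase h), h2⟩,
      h1 u (Finset.notMem_erase u B)⟩
  · rintro ⟨⟨h1, h2⟩, h3⟩
    refine ⟨fun x hx => ?_, h2⟩
    by_cases hxu : x = u
    · rw [hxu, h3]
    · exact h1 x fun h => hx (Finset.mem_erase.2 ⟨hxu, h⟩)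

variable [AddCommGroup K] [Fintype K]

lemma finite_cols (B : Finset Site) (c : K) (ω : Finset Edge) : Finite (Cols B c (ω : Set Edge)) := by
  refine Nat.finite_of_card_ne_zero fun h => ?_
  have := card_cols B c ω
  rw [h, zero_mul] at this
  exact pow_ne_zero _ Fintype.card_ne_zero this.symm

lemma card_cols_erase_le :
    Nat.card (Cols (B.erase u) c (ω : Set Edge)) ≤ Nat.card (Cols B c (ω : Set Edge)) := by
  have := finite_cols B c ω
  exact Nat.card_mono (Set.toFinite (Cols B c (ω : Set Edge)))
    fun σ h => (mem_cols_erase.1 h).1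

lemma card_cols_le_mul_erase (hu : u ∈ B) : Nat.card (Cols B c (ω : Set Edge)) ≤
    Fintype.card K * Nat.card (Cols (B.erase u) c (ω : Set Edge)) := by
  have hK : 0 < Fintype.card K := Fintype.card_pos
  refine Nat.le_of_mul_le_mul_right ?_ (pow_pos hK (rk ((B : Set Site)ᶜ) ω))
  have hB : B.card = (B.erase u).card + 1 := (Finset.card_erase_add_one hu).symm
  rw [card_cols, hB, pow_succ', ← card_cols (B.erase u) c ω, mul_assoc]
  gcongr
  exact rk_wired_le (Set.compl_subset_compl.2 (by exact_mod_cast Finset.erase_subset u B)) ω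

lemma mul_card_cols_erase_le (h : ∀ v ∉ B, ¬Cn ((B : Set Site)ᶜ) (ω : Set Edge) u v) :
    Fintype.card K * Nat.card (Cols (B.erase u) c (ω : Set Edge)) ≤
      Nat.card (Cols B c (ω : Set Edge)) := by
  have := finite_cols B c ω
  rw [← Nat.card_eq_fintype_card, ← Nat.card_prod]
  have hm : ∀ (k : K) (σ : Site → K), σ ∈ Cols (B.erase u) c (ω : Set Edge) →
      (fun x => σ x + if Cn ((B : Set Site)ᶜ) (ω : Set Edge) u x then k else 0) ∈
        Cols B c (ω : Set Edge) := by
    intro k σ hσ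
    have hσ := (mem_cols_erase.1 hσ).1
    refine ⟨fun x hx => ?_, fun e he => ?_⟩
    · simp only [h x hx, if_false, add_zero, hσ.1 x hx]
    · have : Cn ((B : Set Site)ᶜ) (ω : Set Edge) u (src e) ↔
          Cn ((B : Set Site)ᶜ) (ω : Set Edge) u (tgt e) :=
        ⟨fun h => h.trans (.of_edge he), fun h => h.trans (Cn.of_edge he).symm⟩
      simp only [this, hσ.2 e he]
  refine Nat.card_le_card_of_injective
    (fun p : K × Cols (B.erase u) c (ω : Set Edge) => ⟨_, hm p.1 p.2 p.2.2⟩) ?_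
  rintro ⟨k, σ, hσ⟩ ⟨k', σ', hσ'⟩ heq
  have heq := fun x => congrFun (Subtype.ext_iff.1 heq) x
  have hk : k = k' := by
    have := heq u
    simpa [Cn.refl, (mem_cols_erase.1 hσ).2, (mem_cols_erase.1 hσ').2] using this
  subst hk
  have : σ = σ' := funext fun x => by simpa using heq x
  subst this
  rfl

end Colourings

section Magnetisation

variable {q N : ℕ} {c₀ : Fin q}

lemma sum_pottsWeight_mul (S : Set (Site → Fin q)) :
    ∑ σ : {x // x ∈ cube N} → Fin q,
      pottsWeight q N c₀ (Real.log (1 + √q)) σ * ind (extend c₀ σ ∈ S) =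
    ∑ ω ∈ (touch (box N)).powerset,
      √q ^ ω.card * Nat.card ↥(Cols (box N) c₀ (ω : Set Edge) ∩ S) := by
  simp only [pottsWeight_eq, Finset.sum_mul]
  rw [Finset.sum_comm]
  refine Finset.sum_congr rfl fun ω _ => ?_
  rw [← sum_ind_extend _ fun τ hτ x hx => hτ.1.1 x hx, Finset.mul_sum]
  refine Finset.sum_congr rfl fun σ _ => ?_
  rw [mul_assoc, ← ind_and]
  rfl

lemma card_cols_eq_ww [NeZero q] (ω : Finset Edge) :
    √q ^ ω.card * Nat.card (Cols (box N) c₀ (ω : Set Edge)) =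
      (q : ℝ) ^ (box N).card * ww q N ω := by
  have h := card_cols (box N) c₀ ω
  have hq : (q : ℝ) ≠ 0 := Nat.cast_ne_zero.2 (NeZero.ne q)
  rw [Fintype.card_fin] at h
  rw [ww, wt, one_pow, one_mul, ← Nat.cast_pow q (box N).card, ← h, Nat.cast_mul, Nat.cast_pow]
  field_simp

lemma zero_mem_box (N : ℕ) : (0 : Site) ∈ box N := by
  rw [← toSite_zero, toSite_mem_box]
  exact origin_mem_cube N

lemma pottsMag_bounds (hq : 1 ≤ q) :
    0 ≤ pottsMag q N c₀ (Real.log (1 + √q)) ∧ pottsMag q N c₀ (Real.log (1 + √q)) ≤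
      ex (touch (box N)) (ww q N) fun ω => ind (conn N ω) := by
  have : NeZero q := ⟨by omega⟩
  have hq0 : (0 : ℝ) < q := by exact_mod_cast hq
  have hw : ∀ s, 0 < ww q N s := ww_pos (by exact_mod_cast hq)
  have h0 := zero_mem_box N
  set P := (touch (box N)).powerset
  set c : Finset Edge → ℝ := fun ω => Nat.card (Cols (box N) c₀ (ω : Set Edge)) with hc
  set a : Finset Edge → ℝ := fun ω => Nat.card (Cols ((box N).erase 0) c₀ (ω : Set Edge)) with ha
  have hZ : ∑ σ : {x // x ∈ cube N} → Fin q, pottsWeight q N c₀ (Real.log (1 + √q)) σ =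
      ∑ ω ∈ P, √q ^ ω.card * c ω := by
    simpa only [Set.mem_univ, ind_true trivial, mul_one, Set.inter_univ] using
      sum_pottsWeight_mul (c₀ := c₀) (N := N) Set.univ
  have hN : ∑ σ : {x // x ∈ cube N} → Fin q, pottsWeight q N c₀ (Real.log (1 + √q)) σ *
      (if σ ⟨fun _ => 0, origin_mem_cube N⟩ = c₀ then (1 : ℝ) else 0) =
      ∑ ω ∈ P, √q ^ ω.card * a ω := by
    have := sum_pottsWeight_mul (c₀ := c₀) (N := N) {τ | τ 0 = c₀}
    have e : ∀ ω : Finset Edge, Cols (box N) c₀ (ω : Set Edge) ∩ {τ | τ 0 = c₀} =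
        Cols ((box N).erase 0) c₀ (ω : Set Edge) := fun ω => Set.ext fun σ => mem_cols_erase.symm
    simp only [e] at this
    rw [← this]
    refine Finset.sum_congr rfl fun σ _ => ?_
    rw [Set.mem_ofPred_eq, ← toSite_zero, extend_toSite σ (origin_mem_cube N), ind]
    congr
  have hac : ∀ ω, a ω ≤ c ω := fun ω => Nat.cast_le.2 card_cols_erase_le
  have hca : ∀ ω, c ω ≤ a ω * q := fun ω => by
    have := card_cols_le_mul_erase (c := c₀) (ω := ω) h0
    rw [Fintype.card_fin, mul_comm] at this
    simpa only [Nat.cast_mul] using (Nat.cast_le (α := ℝ)).2 this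
  have hna : ∀ ω : Finset Edge, ¬conn N ω → q * a ω ≤ c ω := fun ω h => by
    have := mul_card_cols_erase_le (c := c₀) (ω := ω) (u := 0) fun v hv hcn => h ⟨v, hv, hcn⟩
    rw [Fintype.card_fin] at this
    simpa only [Nat.cast_mul] using (Nat.cast_le (α := ℝ)).2 this
  have hcw : ∀ ω, √q ^ ω.card * c ω = (q : ℝ) ^ (box N).card * ww q N ω := card_cols_eq_ww
  have hc0 : ∀ ω, 0 ≤ c ω := fun ω => Nat.cast_nonneg _
  clear_value a c
  have hcz : ∑ ω ∈ P, √q ^ ω.card * c ω = q ^ (box N).card * zsum (touch (box N)) (ww q N) := by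
    rw [zsum, Finset.mul_sum]
    exact Finset.sum_congr rfl fun ω _ => hcw ω
  have hcpos : 0 < ∑ ω ∈ P, √q ^ ω.card * c ω := by
    rw [hcz]
    exact mul_pos (pow_pos hq0 _) (zsum_pos hw)
  rw [pottsMag, hZ, hN]
  constructor
  · rw [sub_nonneg, div_le_div_iff₀ hq0 hcpos, one_mul, Finset.sum_mul]
    refine Finset.sum_le_sum fun ω _ => ?_
    rw [mul_assoc]
    exact mul_le_mul_of_nonneg_left (hca ω) (by positivity)
  · have key : ∑ ω ∈ P, √q ^ ω.card * a ω - (1 / q) * ∑ ω ∈ P, √q ^ ω.card * c ω ≤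
        q ^ (box N).card * wsum (touch (box N)) (ww q N) fun ω => ind (conn N ω) := by
      rw [wsum, Finset.mul_sum, Finset.mul_sum, ← Finset.sum_sub_distrib]
      refine Finset.sum_le_sum fun ω _ => ?_
      rw [← mul_assoc (_ ^ _), ← hcw, mul_left_comm, ← mul_sub, mul_assoc]
      refine mul_le_mul_of_nonneg_left ?_ (by positivity)
      by_cases h : conn N (ω : Set Edge)
      · rw [ind_true h, mul_one]
        have : 0 ≤ 1 / q * c ω := mul_nonneg (by positivity) (hc0 ω)
        linarith [hac ω]
      · rw [ind_false h, mul_zero, sub_nonpos, one_div, le_inv_mul_iff₀ hq0]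
        exact hna ω h
    rw [ex, sub_le_iff_le_add, div_le_iff₀ hcpos, add_mul, hcz]
    rw [hcz] at key
    have hz := (zsum_pos (F := touch (box N)) hw).ne'
    have : wsum (touch (box N)) (ww q N) (fun ω => ind (conn N ω)) / zsum (touch (box N)) (ww q N) *
        (q ^ (box N).card * zsum (touch (box N)) (ww q N)) =
        q ^ (box N).card * wsum (touch (box N)) (ww q N) fun ω => ind (conn N ω) := by
      field_simp
    linarith

end Magnetisation

end PlanarPotts

/-- continuity of the phase transition for the planar Potts model with
`q ∈ {2,3,4}`: at the critical point `β_c(q) = log(1+√q)` the spontaneous magnetisation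
(with boundary condition given by the first colour) vanishes. -/
theorem potts_continuous (q : ℕ) (hq : q = 2 ∨ q = 3 ∨ q = 4) :
    pottsMstar q ⟨0, by omega⟩ (Real.log (1 + Real.sqrt q)) = 0 := by
  have h2 : (2 : ℝ) ≤ q := by exact_mod_cast (by omega : 2 ≤ q)
  have h4 : (q : ℝ) ≤ 4 := by exact_mod_cast (by omega : q ≤ 4)
  have hb := fun N => PlanarPotts.pottsMag_bounds (N := N) (c₀ := ⟨0, by omega⟩)
    (by omega : 1 ≤ q)
  exact (squeeze_zero (fun N => (hb N).1) (fun N => (hb N).2)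
    (PlanarPotts.tendsto_conn h2 h4)).limsup_eq
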